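/- Existence and uniqueness (stationary problem). Let Ω ⊂ ℝ^N be an open set of class W^{2,∞}, let the measures μ_x satisfy (M), the jump function j satisfy (J0) and (J1), and let H be either a Hamiltonian of Bellman type satisfying (C), (L), (B), or a coercive Hamiltonian satisfying (H1), (Ha) or (H1), (Hb), (Hc). Assume also (E): for every R > 0 there is a constant H_R with sup_{x∈cl(Ω)}|H(x,p)| ≤ H_R for all p ∈ ℝ^N with |p| ≤ R. Then there exists a unique bounded viscosity solution of u − I[u](x) + H(x,Du) = 0 in Ω with generalized Neumann boundary condition ∂u/∂n = 0 on ∂Ω. -/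

import Mathlib

set_option autoImplicit false

/- Common framework for censored nonlocal Hamilton–Jacobi equations with
Neumann boundary conditions (Barles-type viscosity solutions). -/

open Set Metric MeasureTheory Filter Topology Function
open scoped RealInnerProductSpace NNReal ENNReal

noncomputable section

namespace Censored

abbrev Euc (N : ℕ) : Type := EuclideanSpace ℝ (Fin N)

variable {N : ℕ}

/-- Signed distance to the boundary of `Ω`, positive inside `Ω`. -/
def sdist (Ω : Set (Euc N)) (x : Euc N) : ℝ := infDist x Ωᶜ - infDist x Ω

/-- A modulus of continuity. -/
def IsModulus (ω : ℝ → ℝ) : Prop :=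
  (∀ s, 0 ≤ ω s) ∧ Monotone ω ∧ Tendsto ω (nhdsWithin 0 (Ioi 0)) (nhds 0)

/-- A `W^{2,∞}` boundary chart for `Ω` at `s`, with radius `r`: a diffeomorphism of
class `W^{2,∞}` (i.e. `C^1` with Lipschitz differential, with inverse of the same
regularity) whose `N`-th component coincides with the signed distance. -/
def IsW2Chart (hN : 0 < N) (Ω : Set (Euc N)) (s : Euc N) (r : ℝ)
    (ψ ψinv : Euc N → Euc N) : Prop :=
  0 < r ∧
  ContDiffOn ℝ 1 ψ (ball s r) ∧
  (∃ L : ℝ≥0, LipschitzOnWith L (fun x => fderiv ℝ ψ x) (ball s r)) ∧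
  ContDiffOn ℝ 1 ψinv (ψ '' ball s r) ∧
  (∃ L : ℝ≥0, LipschitzOnWith L (fun x => fderiv ℝ ψinv x) (ψ '' ball s r)) ∧
  (∀ x ∈ ball s r, ψinv (ψ x) = x) ∧
  (∀ x ∈ ball s r, ψ x ⟨N - 1, Nat.sub_lt hN Nat.one_pos⟩ = sdist Ω x)

/-- Assumption (O): `Ω` is open of class `W^{2,∞}`. -/
def IsW2Domain (hN : 0 < N) (Ω : Set (Euc N)) : Prop :=
  IsOpen Ω ∧ ∀ s ∈ frontier Ω, ∃ r ψ ψinv, IsW2Chart hN Ω s r ψ ψinv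

/-- `n` is the exterior unit normal vector field to `∂Ω`:  `n = -D d` where `d` is the
signed distance (positive inside). -/
def IsExteriorNormal (Ω : Set (Euc N)) (n : Euc N → Euc N) : Prop :=
  ∀ x ∈ frontier Ω, ‖n x‖ = 1 ∧ HasGradientAt (sdist Ω) (-(n x)) x

/-- First part of assumption (M): the measures `μ_x` have a (measurable, nonnegative)
density `g x` with respect to Lebesgue measure, bounded by `Cμ |z|^{-(N+σ)}`. -/
def AssumptionM1 (Ω : Set (Euc N)) (g : Euc N → Euc N → ℝ) (Cμ σ : ℝ) : Prop :=
  0 < Cμ ∧ σ ∈ Ioo (0:ℝ) 1 ∧ (∀ x, Measurable (g x)) ∧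
  (∀ x ∈ closure Ω, ∀ z : Euc N, 0 ≤ g x z) ∧
  (∀ x ∈ closure Ω, ∀ z : Euc N, g x z ≤ Cμ * ‖z‖ ^ (-((N : ℝ) + σ)))

/-- Assumption (M). -/
def AssumptionM (Ω : Set (Euc N)) (g : Euc N → Euc N → ℝ) (Cμ Dμ σ : ℝ) : Prop :=
  AssumptionM1 Ω g Cμ σ ∧ 0 < Dμ ∧
  (∀ x ∈ closure Ω, ∀ y ∈ closure Ω, ∀ z : Euc N,
    |g x z - g y z| ≤ Dμ * ‖x - y‖ * ‖z‖ ^ (-((N : ℝ) + σ)))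

/-- Assumption (J0). -/
def AssumptionJ0 (Ω : Set (Euc N)) (j : Euc N → Euc N → Euc N) (Aj : ℝ) : Prop :=
  ∀ x ∈ closure Ω,
    ContDiff ℝ 1 (j x) ∧ Function.Bijective (j x) ∧
    ContDiff ℝ 1 (Function.invFun (j x)) ∧
    ∀ z : Euc N, ‖fderiv ℝ (Function.invFun (j x)) z‖ ≤ Aj

/-- Assumption (J1). -/
def AssumptionJ1 (Ω : Set (Euc N)) (j : Euc N → Euc N → Euc N) (Cj' Cj Dj : ℝ) : Prop :=
  0 < Cj' ∧ 0 < Cj ∧ 0 < Dj ∧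
  (∀ x ∈ closure Ω, ∀ z : Euc N, Cj' * ‖z‖ ≤ ‖j x z‖ ∧ ‖j x z‖ ≤ Cj * ‖z‖) ∧
  (∀ x ∈ closure Ω, ∀ y ∈ closure Ω, ∀ z : Euc N, ‖j x z - j y z‖ ≤ Dj * ‖z‖ * ‖x - y‖)

/-- The truncated censored nonlocal term over `{|z| ≥ ξ}` (`I^ξ`). -/
def Iout (Ω : Set (Euc N)) (j : Euc N → Euc N → Euc N) (g : Euc N → Euc N → ℝ)
    (ξ : ℝ) (u : Euc N → ℝ) (x : Euc N) : ℝ :=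
  ∫ z in {z : Euc N | ξ ≤ ‖z‖ ∧ x + j x z ∈ closure Ω}, (u (x + j x z) - u x) * g x z

/-- The truncated censored nonlocal term over `{|z| < ξ}` (`I_ξ`). -/
def Iin (Ω : Set (Euc N)) (j : Euc N → Euc N → Euc N) (g : Euc N → Euc N → ℝ)
    (ξ : ℝ) (φ : Euc N → ℝ) (x : Euc N) : ℝ :=
  ∫ z in {z : Euc N | ‖z‖ < ξ ∧ x + j x z ∈ closure Ω}, (φ (x + j x z) - φ x) * g x z

/-- The censored nonlocal operator of order `σ < 1`, as a principal value. -/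
def Ipv (Ω : Set (Euc N)) (j : Euc N → Euc N → Euc N) (g : Euc N → Euc N → ℝ)
    (u : Euc N → ℝ) (x : Euc N) : ℝ :=
  limUnder (nhdsWithin (0:ℝ) (Ioi 0)) (fun δ =>
    ∫ z in {z : Euc N | δ < ‖z‖ ∧ x + j x z ∈ closure Ω}, (u (x + j x z) - u x) * g x z)

/-- `u` is bounded on `S`. -/
def BddOn (u : Euc N → ℝ) (S : Set (Euc N)) : Prop := ∃ M, ∀ x ∈ S, |u x| ≤ M

/-- `u = u(x,t)` is bounded on `S × I`. -/
def BddOnT (u : Euc N → ℝ → ℝ) (S : Set (Euc N)) (I : Set ℝ) : Prop :=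
  ∃ M, ∀ x ∈ S, ∀ t ∈ I, |u x t| ≤ M

/-- Viscosity subsolution, with generalized Neumann boundary conditions, of the
stationary equation `F(x, u, Du, I[u]) = 0` in `Ω`, `∂u/∂n = 0` on `∂Ω`,
for the censored operator determined by `j, g` (with constant `Cj` from (J1)). -/
def IsSubSol (Ω : Set (Euc N)) (j : Euc N → Euc N → Euc N) (g : Euc N → Euc N → ℝ)
    (n : Euc N → Euc N) (Cj : ℝ) (F : Euc N → ℝ → Euc N → ℝ → ℝ) (u : Euc N → ℝ) : Prop :=
  ∀ ξ > (0:ℝ), ∀ φ : Euc N → ℝ, ContDiff ℝ 1 φ →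
    ∀ x ∈ closure Ω,
      (∀ y ∈ closedBall x (Cj * ξ) ∩ closure Ω, u y - φ y ≤ u x - φ x) →
      (x ∈ Ω → F x (u x) (gradient φ x) (Iin Ω j g ξ φ x + Iout Ω j g ξ u x) ≤ 0) ∧
      (x ∈ frontier Ω →
        min (F x (u x) (gradient φ x) (Iin Ω j g ξ φ x + Iout Ω j g ξ u x))
          ⟪gradient φ x, n x⟫ ≤ 0)

/-- Viscosity supersolution, with generalized Neumann boundary conditions. -/
def IsSuperSol (Ω : Set (Euc N)) (j : Euc N → Euc N → Euc N) (g : Euc N → Euc N → ℝ)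
    (n : Euc N → Euc N) (Cj : ℝ) (F : Euc N → ℝ → Euc N → ℝ → ℝ) (v : Euc N → ℝ) : Prop :=
  ∀ ξ > (0:ℝ), ∀ φ : Euc N → ℝ, ContDiff ℝ 1 φ →
    ∀ x ∈ closure Ω,
      (∀ y ∈ closedBall x (Cj * ξ) ∩ closure Ω, v x - φ x ≤ v y - φ y) →
      (x ∈ Ω → 0 ≤ F x (v x) (gradient φ x) (Iin Ω j g ξ φ x + Iout Ω j g ξ v x)) ∧
      (x ∈ frontier Ω →
        0 ≤ max (F x (v x) (gradient φ x) (Iin Ω j g ξ φ x + Iout Ω j g ξ v x))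
          ⟪gradient φ x, n x⟫)

/-- `F` corresponding to the stationary equation `u - I[u] + H(x,Du) = 0`. -/
def statF (H : Euc N → Euc N → ℝ) : Euc N → ℝ → Euc N → ℝ → ℝ :=
  fun x r p I => r - I + H x p

/-- `F` corresponding to the ergodic equation `λ - I[w] - H(x,Dw) = 0`. -/
def ergF (H : Euc N → Euc N → ℝ) (lam : ℝ) : Euc N → ℝ → Euc N → ℝ → ℝ :=
  fun x _ p I => lam - I - H x p

/-- Parabolic viscosity subsolution with generalized Neumann boundary conditions,
for `F(x, t, ∂_t u, u, Du, I[u(·,t)]) = 0` in `Ω × (0,∞)`. -/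
def IsParSubSol (Ω : Set (Euc N)) (j : Euc N → Euc N → Euc N) (g : Euc N → Euc N → ℝ)
    (n : Euc N → Euc N) (Cj : ℝ) (F : Euc N → ℝ → ℝ → ℝ → Euc N → ℝ → ℝ)
    (u : Euc N → ℝ → ℝ) : Prop :=
  ∀ ξ > (0:ℝ), ∀ φ : Euc N → ℝ → ℝ,
    ContDiff ℝ 1 (fun q : Euc N × ℝ => φ q.1 q.2) →
    ∀ x ∈ closure Ω, ∀ t ∈ Ioi (0:ℝ),
      (∀ y ∈ closedBall x (Cj * ξ) ∩ closure Ω, ∀ s ∈ Ioi (0:ℝ), |s - t| ≤ ξ →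
        u y s - φ y s ≤ u x t - φ x t) →
      (x ∈ Ω →
        F x t (deriv (φ x) t) (u x t) (gradient (fun y => φ y t) x)
          (Iin Ω j g ξ (fun y => φ y t) x + Iout Ω j g ξ (fun y => u y t) x) ≤ 0) ∧
      (x ∈ frontier Ω →
        min (F x t (deriv (φ x) t) (u x t) (gradient (fun y => φ y t) x)
              (Iin Ω j g ξ (fun y => φ y t) x + Iout Ω j g ξ (fun y => u y t) x))
          ⟪gradient (fun y => φ y t) x, n x⟫ ≤ 0)

/-- Parabolic viscosity supersolution with generalized Neumann boundary conditions. -/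
def IsParSuperSol (Ω : Set (Euc N)) (j : Euc N → Euc N → Euc N) (g : Euc N → Euc N → ℝ)
    (n : Euc N → Euc N) (Cj : ℝ) (F : Euc N → ℝ → ℝ → ℝ → Euc N → ℝ → ℝ)
    (v : Euc N → ℝ → ℝ) : Prop :=
  ∀ ξ > (0:ℝ), ∀ φ : Euc N → ℝ → ℝ,
    ContDiff ℝ 1 (fun q : Euc N × ℝ => φ q.1 q.2) →
    ∀ x ∈ closure Ω, ∀ t ∈ Ioi (0:ℝ),
      (∀ y ∈ closedBall x (Cj * ξ) ∩ closure Ω, ∀ s ∈ Ioi (0:ℝ), |s - t| ≤ ξ →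
        v x t - φ x t ≤ v y s - φ y s) →
      (x ∈ Ω →
        0 ≤ F x t (deriv (φ x) t) (v x t) (gradient (fun y => φ y t) x)
          (Iin Ω j g ξ (fun y => φ y t) x + Iout Ω j g ξ (fun y => v y t) x)) ∧
      (x ∈ frontier Ω →
        0 ≤ max (F x t (deriv (φ x) t) (v x t) (gradient (fun y => φ y t) x)
              (Iin Ω j g ξ (fun y => φ y t) x + Iout Ω j g ξ (fun y => v y t) x))
          ⟪gradient (fun y => φ y t) x, n x⟫)

/-- `F` for the parabolic equation `∂_t u - I[u] + H(x,t,u,Du) = 0`. -/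
def parF (H : Euc N → ℝ → ℝ → Euc N → ℝ) : Euc N → ℝ → ℝ → ℝ → Euc N → ℝ → ℝ :=
  fun x t pt r p I => pt - I + H x t r p

/-! ### Hamiltonians: Bellman form and coercive form (stationary) -/




/-- `H` is of Bellman type with drift `b` and cost `l` over the control set `A`. -/
def IsBellman {A : Type} (b : Euc N → A → Euc N) (l : Euc N → A → ℝ)
    (H : Euc N → Euc N → ℝ) : Prop :=
  ∀ x p, H x p = ⨆ α : A, (-⟪b x α, p⟫ - l x α)

/-- Continuity and boundedness of the Bellman data `b, l`. -/
def BellmanData {A : Type} [TopologicalSpace A]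
    (b : Euc N → A → Euc N) (l : Euc N → A → ℝ) : Prop :=
  Continuous (fun q : Euc N × A => b q.1 q.2) ∧ (∃ M, ∀ x α, ‖b x α‖ ≤ M) ∧
  Continuous (fun q : Euc N × A => l q.1 q.2) ∧ (∃ M, ∀ x α, |l x α| ≤ M)

/-- Assumption (C): uniform continuity of the cost `l`. -/
def AssumptionC (Ω : Set (Euc N)) {A : Type} (l : Euc N → A → ℝ) : Prop :=
  ∃ ω, IsModulus ω ∧ ∀ (α : A), ∀ x ∈ closure Ω, ∀ y ∈ closure Ω,
    |l x α - l y α| ≤ ω ‖x - y‖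

/-- Assumption (L): uniform Lipschitz continuity of the drift `b`. -/
def AssumptionL (Ω : Set (Euc N)) {A : Type} (b : Euc N → A → Euc N) : Prop :=
  ∃ C > (0:ℝ), ∀ (α : A), ∀ x ∈ closure Ω, ∀ y ∈ closure Ω,
    ‖b x α - b y α‖ ≤ C * ‖x - y‖

/-- The part of the boundary where the drift points inwards for every control. -/
def GammaIn (Ω : Set (Euc N)) (n : Euc N → Euc N) {A : Type}
    (b : Euc N → A → Euc N) : Set (Euc N) :=
  {x | x ∈ frontier Ω ∧ ∀ α : A, ⟪b x α, n x⟫ < 0}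

/-- The part of the boundary where the drift points outwards for every control. -/
def GammaOut (Ω : Set (Euc N)) (n : Euc N → Euc N) {A : Type}
    (b : Euc N → A → Euc N) : Set (Euc N) :=
  {x | x ∈ frontier Ω ∧ ∀ α : A, 0 < ⟪b x α, n x⟫}

/-- The part of the boundary where the drift points both inwards and outwards. -/
def GammaMix (Ω : Set (Euc N)) (n : Euc N → Euc N) {A : Type}
    (b : Euc N → A → Euc N) : Set (Euc N) :=
  {x | x ∈ frontier Ω ∧ ∃ α₁ α₂ : A, ⟪b x α₁, n x⟫ < 0 ∧ 0 < ⟪b x α₂, n x⟫}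

/-- `S` is a union of connected components of `T`. -/
def IsUnionOfComponents (S T : Set (Euc N)) : Prop :=
  S ⊆ T ∧ ∀ x ∈ S, connectedComponentIn T x ⊆ S

/-- Assumption (B). -/
def AssumptionB (Ω : Set (Euc N)) (n : Euc N → Euc N) {A : Type}
    (b : Euc N → A → Euc N) : Prop :=
  GammaIn Ω n b ∪ GammaOut Ω n b ∪ GammaMix Ω n b = frontier Ω ∧
  IsUnionOfComponents (GammaIn Ω n b) (frontier Ω) ∧
  IsUnionOfComponents (GammaOut Ω n b) (frontier Ω) ∧
  IsUnionOfComponents (GammaMix Ω n b) (frontier Ω)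

/-- All the structural assumptions on a Bellman Hamiltonian: (C), (L), (B) together
with continuity and boundedness of the data. -/
def StatBellmanOK (Ω : Set (Euc N)) (n : Euc N → Euc N) {A : Type} [TopologicalSpace A]
    (b : Euc N → A → Euc N) (l : Euc N → A → ℝ) (H : Euc N → Euc N → ℝ) : Prop :=
  BellmanData b l ∧ IsBellman b l H ∧ AssumptionC Ω l ∧ AssumptionL Ω b ∧ AssumptionB Ω n b

/-- Assumption (H1): superfractional coercivity of order `m > σ`. -/
def AssumptionH1 (Ω : Set (Euc N)) (H : Euc N → Euc N → ℝ) (σ m c₀ D : ℝ) : Prop :=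
  σ < m ∧ 0 < c₀ ∧ 0 < D ∧ ∀ x ∈ closure Ω, ∀ p : Euc N, c₀ * ‖p‖ ^ m - D ≤ H x p

/-- Assumption (Ha) (sublinear case) with constant `C` and modulus `ω₁`. -/
def AssumptionHa (H : Euc N → Euc N → ℝ) (C : ℝ) (ω₁ : ℝ → ℝ) : Prop :=
  0 < C ∧ IsModulus ω₁ ∧
  ∀ x y p q : Euc N, H y p - H x q ≤ ω₁ ‖x - y‖ * (1 + ‖p‖) + C * ‖p - q‖

/-- Assumption (Hb) (superlinear case) with constants `m, A, Cb`. -/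
def AssumptionHb (H : Euc N → Euc N → ℝ) (m A Cb : ℝ) : Prop :=
  1 < m ∧ 0 < A ∧ 0 < Cb ∧
  ∀ μ ∈ Ioo (0:ℝ) 1, ∀ x p : Euc N,
    H x p - μ * H x (μ⁻¹ • p) ≤ (1 - μ) * (Cb * (1 - m) * ‖p‖ ^ m + A)

/-- Assumption (Hc) with constant `C` and modulus `ω₁`. -/
def AssumptionHc (H : Euc N → Euc N → ℝ) (m C : ℝ) (ω₁ : ℝ → ℝ) : Prop :=
  0 < C ∧ IsModulus ω₁ ∧
  ∀ x y p q : Euc N,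
    H y p - H x q ≤ ω₁ ‖x - y‖ * (1 + (max ‖p‖ ‖q‖) ^ m)
      + C * ‖p - q‖ * (max ‖p‖ ‖q‖) ^ (m - 1)

/-- The structural assumptions on a coercive Hamiltonian:
(H1), (Ha) (sublinear) or (H1), (Hb), (Hc) (superlinear). -/
def StatCoerciveOK (Ω : Set (Euc N)) (H : Euc N → Euc N → ℝ) (σ : ℝ) : Prop :=
  ∃ m c₀ D, AssumptionH1 Ω H σ m c₀ D ∧
    ((m ≤ 1 ∧ ∃ C ω₁, AssumptionHa H C ω₁) ∨
     (∃ A Cb, AssumptionHb H m A Cb ∧ ∃ C ω₁, AssumptionHc H m C ω₁))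

/-- Assumption (E). -/
def AssumptionE (Ω : Set (Euc N)) (H : Euc N → Euc N → ℝ) : Prop :=
  ∀ R > (0:ℝ), ∃ HR : ℝ, ∀ x ∈ closure Ω, ∀ p : Euc N, ‖p‖ ≤ R → |H x p| ≤ HR

/-! ### Parabolic Hamiltonians and assumptions -/

/-- `H(x,t,r,p)` is of (time-dependent) Bellman type. -/
def IsParBellman {A : Type} (lam : Euc N → ℝ → A → ℝ) (b : Euc N → ℝ → A → Euc N)
    (l : Euc N → ℝ → A → ℝ) (H : Euc N → ℝ → ℝ → Euc N → ℝ) : Prop :=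
  ∀ x t r p, H x t r p = ⨆ α : A, (lam x t α * r - ⟪b x t α, p⟫ - l x t α)

/-- Continuity and boundedness of the parabolic Bellman data. -/
def ParBellmanData {A : Type} [TopologicalSpace A] (lam : Euc N → ℝ → A → ℝ)
    (b : Euc N → ℝ → A → Euc N) (l : Euc N → ℝ → A → ℝ) : Prop :=
  Continuous (fun q : Euc N × ℝ × A => lam q.1 q.2.1 q.2.2) ∧
  (∃ M, ∀ x t α, |lam x t α| ≤ M) ∧
  Continuous (fun q : Euc N × ℝ × A => b q.1 q.2.1 q.2.2) ∧
  (∃ M, ∀ x t α, ‖b x t α‖ ≤ M) ∧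
  Continuous (fun q : Euc N × ℝ × A => l q.1 q.2.1 q.2.2) ∧
  (∃ M, ∀ x t α, |l x t α| ≤ M)

/-- Assumption (C'): uniform continuity of `l` and `λ` in `(x,t)`, uniformly in `α`. -/
def AssumptionC' (Ω : Set (Euc N)) {A : Type} (lam l : Euc N → ℝ → A → ℝ) : Prop :=
  (∃ ω, IsModulus ω ∧ ∀ (α : A), ∀ x ∈ closure Ω, ∀ y ∈ closure Ω,
      ∀ t ∈ Ici (0:ℝ), ∀ s ∈ Ici (0:ℝ), |l x t α - l y s α| ≤ ω (‖x - y‖ + |t - s|)) ∧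
  (∃ ω, IsModulus ω ∧ ∀ (α : A), ∀ x ∈ closure Ω, ∀ y ∈ closure Ω,
      ∀ t ∈ Ici (0:ℝ), ∀ s ∈ Ici (0:ℝ), |lam x t α - lam y s α| ≤ ω (‖x - y‖ + |t - s|))

/-- Assumption (L'): uniform Lipschitz continuity of the drift `b` in `(x,t)`. -/
def AssumptionL' (Ω : Set (Euc N)) {A : Type} (b : Euc N → ℝ → A → Euc N) : Prop :=
  ∃ C > (0:ℝ), ∀ (α : A), ∀ x ∈ closure Ω, ∀ y ∈ closure Ω, ∀ s ∈ Ici (0:ℝ), ∀ t ∈ Ici (0:ℝ),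
    ‖b x s α - b y t α‖ ≤ C * (‖x - y‖ + |s - t|)

/-- Inward part of the boundary for time-dependent drift. -/
def GammaInT (Ω : Set (Euc N)) (n : Euc N → Euc N) {A : Type}
    (b : Euc N → ℝ → A → Euc N) : Set (Euc N) :=
  {x | x ∈ frontier Ω ∧ ∀ t ∈ Ici (0:ℝ), ∀ α : A, ⟪b x t α, n x⟫ < 0}

/-- Outward part of the boundary for time-dependent drift. -/
def GammaOutT (Ω : Set (Euc N)) (n : Euc N → Euc N) {A : Type}
    (b : Euc N → ℝ → A → Euc N) : Set (Euc N) :=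
  {x | x ∈ frontier Ω ∧ ∀ t ∈ Ici (0:ℝ), ∀ α : A, 0 < ⟪b x t α, n x⟫}

/-- Mixed part of the boundary for time-dependent drift. -/
def GammaMixT (Ω : Set (Euc N)) (n : Euc N → Euc N) {A : Type}
    (b : Euc N → ℝ → A → Euc N) : Set (Euc N) :=
  {x | x ∈ frontier Ω ∧ ∀ t ∈ Ici (0:ℝ),
    ∃ α₁ α₂ : A, ⟪b x t α₁, n x⟫ < 0 ∧ 0 < ⟪b x t α₂, n x⟫}

/-- Assumption (B'). -/
def AssumptionB' (Ω : Set (Euc N)) (n : Euc N → Euc N) {A : Type}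
    (b : Euc N → ℝ → A → Euc N) : Prop :=
  GammaInT Ω n b ∪ GammaOutT Ω n b ∪ GammaMixT Ω n b = frontier Ω ∧
  IsUnionOfComponents (GammaInT Ω n b) (frontier Ω) ∧
  IsUnionOfComponents (GammaOutT Ω n b) (frontier Ω) ∧
  IsUnionOfComponents (GammaMixT Ω n b) (frontier Ω)

/-- All the structural assumptions on a parabolic Bellman Hamiltonian: (C'), (L'), (B'). -/
def ParBellmanOK (Ω : Set (Euc N)) (n : Euc N → Euc N) {A : Type} [TopologicalSpace A]
    (lam : Euc N → ℝ → A → ℝ) (b : Euc N → ℝ → A → Euc N) (l : Euc N → ℝ → A → ℝ)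
    (H : Euc N → ℝ → ℝ → Euc N → ℝ) : Prop :=
  ParBellmanData lam b l ∧ IsParBellman lam b l H ∧
  AssumptionC' Ω lam l ∧ AssumptionL' Ω b ∧ AssumptionB' Ω n b

/-- Assumption (H'): monotonicity of `H` in the `u` variable. -/
def AssumptionH' (Ω : Set (Euc N)) (H : Euc N → ℝ → ℝ → Euc N → ℝ) : Prop :=
  ∃ K : ℝ, ∀ R > (0:ℝ), ∃ γ, -K ≤ γ ∧
    ∀ x ∈ closure Ω, ∀ t ∈ Icc (0:ℝ) R, ∀ r s : ℝ, |r| ≤ R → |s| ≤ R → s ≤ r →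
      ∀ p : Euc N, γ * (r - s) ≤ H x t r p - H x t s p

/-- Assumption (H''): the monotonicity constants `γ_R` are bounded below by some `γ₀ > 0`. -/
def AssumptionH'' (Ω : Set (Euc N)) (H : Euc N → ℝ → ℝ → Euc N → ℝ) : Prop :=
  ∃ γ₀ > (0:ℝ), ∀ R > (0:ℝ), ∃ γ, γ₀ ≤ γ ∧
    ∀ x ∈ closure Ω, ∀ t ∈ Icc (0:ℝ) R, ∀ r s : ℝ, |r| ≤ R → |s| ≤ R → s ≤ r →
      ∀ p : Euc N, γ * (r - s) ≤ H x t r p - H x t s p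

/-- Assumption (E'). -/
def AssumptionE' (Ω : Set (Euc N)) (H : Euc N → ℝ → ℝ → Euc N → ℝ) : Prop :=
  ∀ T > (0:ℝ), ∀ R > (0:ℝ), ∃ HR : ℝ, ∀ x ∈ Ω, ∀ t ∈ Icc (0:ℝ) T, ∀ r : ℝ, ∀ p : Euc N,
    |r| ≤ R → ‖p‖ ≤ R → |H x t r p| ≤ HR

/-- Assumption (H0'): separated structure `H(x,t,r,p) = H₀(x,r,p) - f(x,t)`. -/
def AssumptionH0' (H : Euc N → ℝ → ℝ → Euc N → ℝ) : Prop :=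
  ∃ (H₀ : Euc N → ℝ → Euc N → ℝ) (f : Euc N → ℝ → ℝ),
    Continuous (fun q : Euc N × ℝ × Euc N => H₀ q.1 q.2.1 q.2.2) ∧
    UniformContinuous (fun q : Euc N × ℝ => f q.1 q.2) ∧
    (∃ M, ∀ x t, |f x t| ≤ M) ∧
    ∀ x t r p, H x t r p = H₀ x r p - f x t

/-- Assumption (He'): `H` satisfies (H1), (Ha) in `x`, uniformly in `t`
and uniformly on compact sets in `r` (sublinearly coercive case). -/
def AssumptionHe' (Ω : Set (Euc N)) (H : Euc N → ℝ → ℝ → Euc N → ℝ) (σ : ℝ) : Prop :=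
  ∃ m : ℝ, σ < m ∧ m ≤ 1 ∧
    ∀ R > (0:ℝ),
      (∃ c₀ > (0:ℝ), ∃ D > (0:ℝ), ∀ x ∈ closure Ω, ∀ t ∈ Ici (0:ℝ), ∀ r : ℝ, |r| ≤ R →
        ∀ p : Euc N, c₀ * ‖p‖ ^ m - D ≤ H x t r p) ∧
      (∃ C > (0:ℝ), ∃ ω₁, IsModulus ω₁ ∧ ∀ x y : Euc N, ∀ t ∈ Ici (0:ℝ), ∀ r : ℝ, |r| ≤ R →
        ∀ p q : Euc N, H y t r p - H x t r q ≤ ω₁ ‖x - y‖ * (1 + ‖p‖) + C * ‖p - q‖)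

/-- Assumption (He''): `H` satisfies (H1), (Hb), (Hc) in `x`, uniformly in `t`
and uniformly on compact sets in `r` (superlinearly coercive case, exponent `m`). -/
def AssumptionHe'' (Ω : Set (Euc N)) (H : Euc N → ℝ → ℝ → Euc N → ℝ) (σ m : ℝ) : Prop :=
  1 < m ∧ σ < m ∧
  ∀ R > (0:ℝ),
    (∃ c₀ > (0:ℝ), ∃ D > (0:ℝ), ∀ x ∈ closure Ω, ∀ t ∈ Ici (0:ℝ), ∀ r : ℝ, |r| ≤ R →
      ∀ p : Euc N, c₀ * ‖p‖ ^ m - D ≤ H x t r p) ∧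
    (∃ A > (0:ℝ), ∃ Cb > (0:ℝ), ∀ μ ∈ Ioo (0:ℝ) 1, ∀ x ∈ closure Ω, ∀ t ∈ Ici (0:ℝ),
      ∀ r : ℝ, |r| ≤ R → ∀ p : Euc N,
        H x t r p - μ * H x t r (μ⁻¹ • p) ≤ (1 - μ) * (Cb * (1 - m) * ‖p‖ ^ m + A)) ∧
    (∃ C > (0:ℝ), ∃ ω₁, IsModulus ω₁ ∧ ∀ x y : Euc N, ∀ t ∈ Ici (0:ℝ), ∀ r : ℝ, |r| ≤ R →
      ∀ p q : Euc N, H y t r p - H x t r q ≤ ω₁ ‖x - y‖ * (1 + (max ‖p‖ ‖q‖) ^ m)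
        + C * ‖p - q‖ * (max ‖p‖ ‖q‖) ^ (m - 1))

/-- Structural parabolic coercive assumptions: (H0') and (He') or (He''). -/
def ParCoerciveOK (Ω : Set (Euc N)) (H : Euc N → ℝ → ℝ → Euc N → ℝ) (σ : ℝ) : Prop :=
  AssumptionH0' H ∧ (AssumptionHe' Ω H σ ∨ ∃ m, AssumptionHe'' Ω H σ m)

/-! ### Iterative covering property -/

/-- The iterated reachable sets `X_r(x)` of the censored jump process. -/
def Xiter (Ω : Set (Euc N)) (j : Euc N → Euc N → Euc N) (g : Euc N → Euc N → ℝ)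
    (x : Euc N) : ℕ → Set (Euc N)
  | 0 => {x}
  | r + 1 => (⋃ ξ ∈ Xiter Ω j g x r,
      (fun z => ξ + j ξ z) '' closure (Function.support (g ξ))) ∩ closure Ω

/-- Iterative covering property: `𝒳(x) = Ω` (i.e. the closure of the reachable set
is all of `closure Ω`) for every `x ∈ Ω`. -/
def CoveringProperty (Ω : Set (Euc N)) (j : Euc N → Euc N → Euc N)
    (g : Euc N → Euc N → ℝ) : Prop :=
  ∀ x ∈ Ω, closure (⋃ r : ℕ, Xiter Ω j g x r) = closure Ω

section Aux
set_option autoImplicit false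

/-! ### Data -/

/-- All the data of the problem, except for the Hamiltonian. -/
structure Dat (N : ℕ) where
  hN : 0 < N
  Ω : Set (Euc N)
  hΩ : IsW2Domain hN Ω
  n : Euc N → Euc N
  hn : IsExteriorNormal Ω n
  g : Euc N → Euc N → ℝ
  Cμ : ℝ
  Dμ : ℝ
  σ : ℝ
  hM : AssumptionM Ω g Cμ Dμ σ
  j : Euc N → Euc N → Euc N
  Aj : ℝ
  hJ0 : AssumptionJ0 Ω j Aj
  Cj' : ℝ
  Cj : ℝ
  Dj : ℝ
  hJ1 : AssumptionJ1 Ω j Cj' Cj Dj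

namespace Dat

variable (D : Dat N)

/-- The closed domain. -/
def C : Set (Euc N) := closure D.Ω

/-- The weight. -/
def wt (z : Euc N) : ℝ := ‖z‖ ^ (-((N : ℝ) + D.σ))

lemma isClosed_C : IsClosed D.C := isClosed_closure
lemma isOpen_Ω : IsOpen D.Ω := D.hΩ.1
lemma Ω_sub : D.Ω ⊆ D.C := subset_closure
lemma σ_pos : 0 < D.σ := D.hM.1.2.1.1
lemma σ_lt : D.σ < 1 := D.hM.1.2.1.2
lemma Cμ_pos : 0 < D.Cμ := D.hM.1.1
lemma Dμ_pos : 0 < D.Dμ := D.hM.2.1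
lemma Cj_pos : 0 < D.Cj := D.hJ1.2.1
lemma Cj'_pos : 0 < D.Cj' := D.hJ1.1
lemma Dj_pos : 0 < D.Dj := D.hJ1.2.2.1
lemma g_meas (x : Euc N) : Measurable (D.g x) := D.hM.1.2.2.1 x
lemma g_nonneg {x : Euc N} (hx : x ∈ D.C) (z : Euc N) : 0 ≤ D.g x z := D.hM.1.2.2.2.1 x hx z
lemma g_le {x : Euc N} (hx : x ∈ D.C) (z : Euc N) : D.g x z ≤ D.Cμ * D.wt z :=
  D.hM.1.2.2.2.2 x hx z
lemma g_diff {x y : Euc N} (hx : x ∈ D.C) (hy : y ∈ D.C) (z : Euc N) :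
    |D.g x z - D.g y z| ≤ D.Dμ * ‖x - y‖ * D.wt z := D.hM.2.2 x hx y hy z
lemma wt_nonneg (z : Euc N) : 0 ≤ D.wt z := by unfold wt; positivity
lemma j_le {x : Euc N} (hx : x ∈ D.C) (z : Euc N) : ‖D.j x z‖ ≤ D.Cj * ‖z‖ :=
  (D.hJ1.2.2.2.1 x hx z).2
lemma j_ge {x : Euc N} (hx : x ∈ D.C) (z : Euc N) : D.Cj' * ‖z‖ ≤ ‖D.j x z‖ :=
  (D.hJ1.2.2.2.1 x hx z).1
lemma j_diff {x y : Euc N} (hx : x ∈ D.C) (hy : y ∈ D.C) (z : Euc N) :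
    ‖D.j x z - D.j y z‖ ≤ D.Dj * ‖z‖ * ‖x - y‖ := D.hJ1.2.2.2.2 x hx y hy z
lemma j_cont {x : Euc N} (hx : x ∈ D.C) : Continuous (D.j x) := (D.hJ0 x hx).1.continuous
lemma frontier_eq : frontier D.Ω = D.C \ D.Ω := by
  rw [frontier, D.isOpen_Ω.interior_eq]; rfl
lemma frontier_sub : frontier D.Ω ⊆ D.C := by rw [frontier_eq]; exact sdiff_subset
lemma mem_or {x : Euc N} (hx : x ∈ D.C) : x ∈ D.Ω ∨ x ∈ frontier D.Ω := by
  rw [frontier_eq]; by_cases h : x ∈ D.Ω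
  · exact Or.inl h
  · exact Or.inr ⟨hx, h⟩

lemma nontriv (D : Dat N) : Nontrivial (Euc N) := by
  have : Nonempty (Fin N) := ⟨⟨0, D.hN⟩⟩
  infer_instance

lemma wt_meas : Measurable D.wt := by unfold wt; fun_prop

/-- The volume constant. -/
def cV : ℝ := N * (volume : Measure (Euc N)).real (ball 0 1)
lemma cV_nonneg : 0 ≤ cV (N := N) := by unfold cV; positivity

/-- Far-field mass. -/
def kf (ξ : ℝ) : ℝ := cV (N := N) * (ξ ^ (-D.σ) / D.σ)
/-- Near-field mass. -/
def kn (ξ : ℝ) : ℝ := cV (N := N) * (ξ ^ (1 - D.σ) / (1 - D.σ))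

lemma kf_nonneg {ξ : ℝ} (h : 0 ≤ ξ) : 0 ≤ D.kf ξ := by
  have := D.σ_pos; have := cV_nonneg (N := N); unfold kf; positivity
lemma kn_nonneg {ξ : ℝ} (h : 0 ≤ ξ) : 0 ≤ D.kn ξ := by
  have : 0 < 1 - D.σ := by linarith [D.σ_lt]
  have := cV_nonneg (N := N); unfold kn; positivity

lemma pow_aux {y : ℝ} (hy : 0 < y) (a : ℝ) :
    y ^ (N - 1) * y ^ (-((N : ℝ) + D.σ) + a) = y ^ (-D.σ - 1 + a) := by
  rw [← Real.rpow_natCast, ← Real.rpow_add hy]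
  congr 1
  rw [Nat.cast_sub D.hN]; push_cast; ring

lemma far_aux {ξ : ℝ} (hξ : 0 < ξ) :
    (IntegrableOn D.wt {z : Euc N | ξ ≤ ‖z‖}) ∧
    ∫ z in {z : Euc N | ξ ≤ ‖z‖}, D.wt z = D.kf ξ := by
  have := D.nontriv
  have hms : MeasurableSet {z : Euc N | ξ ≤ ‖z‖} := measurableSet_le measurable_const measurable_norm
  set f : ℝ → ℝ := (Ici ξ).indicator (fun y => y ^ (-((N : ℝ) + D.σ))) with hf
  have e1 : {z : Euc N | ξ ≤ ‖z‖}.indicator D.wt = fun z => f ‖z‖ := by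
    ext z; simp only [hf, indicator, mem_ofPred_eq, mem_Ici, wt]
  have e2 : EqOn (fun y : ℝ => y ^ (N - 1) • f y) ((Ici ξ).indicator (fun y => y ^ (-D.σ - 1)))
      (Ioi 0) := by
    intro y hy
    simp only [hf, indicator, mem_Ici, smul_eq_mul]
    split_ifs
    · have := D.pow_aux hy 0; simpa using this
    · simp
  have hi : IntegrableOn (fun t : ℝ => t ^ (-D.σ - 1)) (Ioi ξ) :=
    integrableOn_Ioi_rpow_of_lt (by linarith [D.σ_pos]) hξ
  have hi' : IntegrableOn (fun t : ℝ => t ^ (-D.σ - 1)) (Ici ξ) := by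
    rwa [integrableOn_Ici_iff_integrableOn_Ioi]
  have hsub : Ioi 0 ∩ Ici ξ = Ici ξ := inter_eq_right.2 (fun y hy => lt_of_lt_of_le hξ hy)
  constructor
  · rw [← integrable_indicator_iff hms, e1, integrable_fun_norm_addHaar]
    simp only [finrank_euclideanSpace, Fintype.card_fin]
    rw [integrableOn_congr_fun e2 measurableSet_Ioi, IntegrableOn,
      integrable_indicator_iff measurableSet_Ici, IntegrableOn,
      Measure.restrict_restrict measurableSet_Ici, inter_comm, hsub]
    exact hi'
  · rw [← integral_indicator hms, e1, integral_fun_norm_addHaar]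
    simp only [finrank_euclideanSpace, Fintype.card_fin]
    rw [setIntegral_congr_fun measurableSet_Ioi e2, setIntegral_indicator measurableSet_Ici, hsub,
      integral_Ici_eq_integral_Ioi, integral_Ioi_rpow_of_lt (by linarith [D.σ_pos]) hξ]
    simp only [nsmul_eq_mul, smul_eq_mul, kf, cV]
    have : D.σ ≠ 0 := D.σ_pos.ne'
    have : -D.σ - 1 + 1 = -D.σ := by ring
    rw [this]
    field_simp

lemma near_aux {ξ : ℝ} (hξ : 0 < ξ) :
    (IntegrableOn (fun z => ‖z‖ * D.wt z) {z : Euc N | ‖z‖ < ξ}) ∧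
    ∫ z in {z : Euc N | ‖z‖ < ξ}, ‖z‖ * D.wt z = D.kn ξ := by
  have := D.nontriv
  have hms : MeasurableSet {z : Euc N | ‖z‖ < ξ} := measurableSet_lt measurable_norm measurable_const
  set f : ℝ → ℝ := (Iio ξ).indicator (fun y => y * y ^ (-((N : ℝ) + D.σ))) with hf
  have e1 : {z : Euc N | ‖z‖ < ξ}.indicator (fun z => ‖z‖ * D.wt z) = fun z => f ‖z‖ := by
    ext z; simp only [hf, indicator, mem_ofPred_eq, mem_Iio, wt]
  have e2 : EqOn (fun y : ℝ => y ^ (N - 1) • f y) ((Iio ξ).indicator (fun y => y ^ (-D.σ)))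
      (Ioi 0) := by
    intro y hy
    simp only [hf, indicator, mem_Iio, smul_eq_mul]
    split_ifs
    · have := D.pow_aux hy 1
      rw [Real.rpow_add hy, Real.rpow_one] at this
      rw [mul_comm y, this]; congr 1; ring
    · simp
  have hsub : Ioi 0 ∩ Iio ξ = Ioo 0 ξ := rfl
  have hii : IntervalIntegrable (fun t : ℝ => t ^ (-D.σ)) volume 0 ξ :=
    intervalIntegral.intervalIntegrable_rpow' (by linarith [D.σ_lt])
  have hi : IntegrableOn (fun t : ℝ => t ^ (-D.σ)) (Ioo 0 ξ) := by
    rw [intervalIntegrable_iff_integrableOn_Ioo_of_le hξ.le] at hii; exact hii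
  constructor
  · rw [← integrable_indicator_iff hms, e1, integrable_fun_norm_addHaar]
    simp only [finrank_euclideanSpace, Fintype.card_fin]
    rw [integrableOn_congr_fun e2 measurableSet_Ioi, IntegrableOn,
      integrable_indicator_iff measurableSet_Iio, IntegrableOn,
      Measure.restrict_restrict measurableSet_Iio, inter_comm, hsub]
    exact hi
  · rw [← integral_indicator hms, e1, integral_fun_norm_addHaar]
    simp only [finrank_euclideanSpace, Fintype.card_fin]
    rw [setIntegral_congr_fun measurableSet_Ioi e2, setIntegral_indicator measurableSet_Iio, hsub,
      ← integral_Ioc_eq_integral_Ioo, ← intervalIntegral.integral_of_le hξ.le,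
      integral_rpow (Or.inl (by linarith [D.σ_lt]))]
    simp only [nsmul_eq_mul, smul_eq_mul, kn, cV]
    have h0 : -D.σ + 1 = 1 - D.σ := by ring
    have : (1 - D.σ) ≠ 0 := by linarith [D.σ_lt]
    rw [h0, Real.zero_rpow this, sub_zero, mul_assoc]

/-- far region -/
def fr (ξ : ℝ) : Set (Euc N) := {z : Euc N | ξ ≤ ‖z‖}
/-- near region -/
def nr (ξ : ℝ) : Set (Euc N) := {z : Euc N | ‖z‖ < ξ}
lemma fr_meas (ξ : ℝ) : MeasurableSet (fr (N := N) ξ) := measurableSet_le measurable_const measurable_norm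
lemma nr_meas (ξ : ℝ) : MeasurableSet (nr (N := N) ξ) := measurableSet_lt measurable_norm measurable_const
lemma compl_fr (ξ : ℝ) : (fr (N := N) ξ)ᶜ = nr ξ := by ext z; simp [fr, nr]
lemma wt_far {ξ : ℝ} (hξ : 0 < ξ) : IntegrableOn D.wt (fr ξ) := (D.far_aux hξ).1
lemma wt_near {ξ : ℝ} (hξ : 0 < ξ) : IntegrableOn (fun z => ‖z‖ * D.wt z) (nr ξ) := (D.near_aux hξ).1
lemma int_far {ξ : ℝ} (hξ : 0 < ξ) : ∫ z in fr ξ, D.wt z = D.kf ξ := (D.far_aux hξ).2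
lemma int_near {ξ : ℝ} (hξ : 0 < ξ) : ∫ z in nr ξ, ‖z‖ * D.wt z = D.kn ξ := (D.near_aux hξ).2

lemma kn_tendsto : Tendsto D.kn (𝓝[>] 0) (𝓝 0) := by
  have h1 : 0 < 1 - D.σ := by linarith [D.σ_lt]
  have : Tendsto D.kn (𝓝 0) (𝓝 (D.kn 0)) := by
    apply ContinuousAt.tendsto
    unfold kn
    exact continuousAt_const.mul ((Real.continuousAt_rpow_const _ _ (Or.inr h1.le)).div_const _)
  have h0 : D.kn 0 = 0 := by unfold kn; rw [Real.zero_rpow h1.ne']; simp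
  rw [h0] at this
  exact this.mono_left nhdsWithin_le_nhds

/-- The constant in `A3`. -/
def kA (A : ℝ) : ℝ := cV (N := N) * (1 / (1 - D.σ) + A / D.σ)

lemma min_aux {A B : ℝ} (hA : 0 ≤ A) (hB : 0 < B) :
    Integrable (fun z => min A (B * ‖z‖) * D.wt z) ∧
    ∫ z, min A (B * ‖z‖) * D.wt z ≤ D.kA A * B ^ D.σ := by
  have hb : 0 < B⁻¹ := inv_pos.2 hB
  have hm : Measurable (fun z => min A (B * ‖z‖) * D.wt z) := by
    have := D.wt_meas; fun_prop
  have hN1 : IntegrableOn (fun z => B * (‖z‖ * D.wt z)) (nr B⁻¹) := (D.wt_near hb).const_mul B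
  have hF1 : IntegrableOn (fun z => A * D.wt z) (fr B⁻¹) := (D.wt_far hb).const_mul A
  have hle1 : ∀ z : Euc N, min A (B * ‖z‖) * D.wt z ≤ B * (‖z‖ * D.wt z) := fun z => by
    rw [← mul_assoc]; exact mul_le_mul_of_nonneg_right (min_le_right _ _) (D.wt_nonneg z)
  have hle2 : ∀ z : Euc N, min A (B * ‖z‖) * D.wt z ≤ A * D.wt z := fun z =>
    mul_le_mul_of_nonneg_right (min_le_left _ _) (D.wt_nonneg z)
  have hnn : ∀ z : Euc N, 0 ≤ min A (B * ‖z‖) * D.wt z := fun z =>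
    mul_nonneg (le_min hA (by positivity)) (D.wt_nonneg z)
  have i1 : IntegrableOn (fun z => min A (B * ‖z‖) * D.wt z) (nr B⁻¹) :=
    Integrable.mono' hN1 hm.aestronglyMeasurable (ae_of_all _ fun z => by
      rw [Real.norm_of_nonneg (hnn z)]; exact hle1 z)
  have i2 : IntegrableOn (fun z => min A (B * ‖z‖) * D.wt z) (fr B⁻¹) :=
    Integrable.mono' hF1 hm.aestronglyMeasurable (ae_of_all _ fun z => by
      rw [Real.norm_of_nonneg (hnn z)]; exact hle2 z)
  have hint : Integrable (fun z => min A (B * ‖z‖) * D.wt z) := by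
    rw [← integrableOn_univ, ← union_compl_self (fr B⁻¹), compl_fr]
    exact i2.union i1
  refine ⟨hint, ?_⟩
  rw [← integral_add_compl (fr_meas B⁻¹) hint, compl_fr]
  have h1 := setIntegral_mono i1 hN1 hle1
  have h2 := setIntegral_mono i2 hF1 hle2
  rw [integral_const_mul, int_near _ hb] at h1
  rw [integral_const_mul, int_far _ hb] at h2
  have e : B * D.kn B⁻¹ + A * D.kf B⁻¹ = D.kA A * B ^ D.σ := by
    unfold kn kf kA
    rw [Real.inv_rpow hB.le, Real.inv_rpow hB.le, Real.rpow_neg hB.le, Real.rpow_sub hB, Real.rpow_one]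
    have := D.σ_pos
    have : (1 - D.σ) ≠ 0 := by linarith [D.σ_lt]
    field_simp
  linarith

lemma kA_nonneg {A : ℝ} (hA : 0 ≤ A) : 0 ≤ D.kA A := by
  have : 0 < 1 - D.σ := by linarith [D.σ_lt]
  have := D.σ_pos
  have := cV_nonneg (N := N); unfold kA; positivity

/-! ### frontier is null -/

lemma frontier_null : volume (frontier D.Ω) = 0 := by
  apply measure_null_of_locally_null
  intro s hs
  obtain ⟨r, ψ, ψinv, hr, -, -, hψi, -, hinv, hd⟩ := D.hΩ.2 s hs
  refine ⟨frontier D.Ω ∩ ball s r, inter_mem_nhdsWithin _ (ball_mem_nhds s hr), ?_⟩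
  set i : Fin N := ⟨N - 1, Nat.sub_lt D.hN Nat.one_pos⟩ with hi
  set S : Set (Euc N) := {y | y i = 0} ∩ ψ '' ball s r
  have hS : volume S = 0 := by
    refine measure_mono_null inter_subset_left ?_
    have := Measure.addHaar_submodule (volume : Measure (Euc N))
      (LinearMap.ker (EuclideanSpace.proj i : Euc N →L[ℝ] ℝ).toLinearMap) (by
        intro h
        rw [LinearMap.ker_eq_top] at h
        have := LinearMap.congr_fun h (EuclideanSpace.single i (1:ℝ))
        simp at this)
    refine measure_mono_null ?_ this
    intro y hy
    simpa using hy
  have h2 := addHaar_image_eq_zero_of_differentiableOn_of_addHaar_eq_zero volume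
    (f := ψinv) (s := S) ((hψi.differentiableOn one_ne_zero).mono inter_subset_right) hS
  refine measure_mono_null ?_ h2
  rintro x ⟨hx, hxb⟩
  refine ⟨ψ x, ⟨?_, mem_image_of_mem _ hxb⟩, hinv x hxb⟩
  rw [mem_ofPred_eq, hd x hxb, sdist]
  have h3 : infDist x D.Ω = 0 := by
    rw [← mem_closure_iff_infDist_zero]
    · exact D.frontier_sub hx
    · have := D.frontier_sub hx; exact closure_nonempty_iff.1 ⟨x, this⟩
  have h4 : infDist x D.Ωᶜ = 0 := by
    rw [frontier_eq] at hx
    exact infDist_zero_of_mem hx.2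
  rw [h3, h4, sub_zero]

lemma land_null {x : Euc N} (hx : x ∈ D.C) : ∀ᵐ z : Euc N, x + D.j x z ∉ frontier D.Ω := by
  rw [ae_iff]
  simp only [not_not]
  have h0 : volume ((fun y => x + y) ⁻¹' frontier D.Ω) = 0 := by
    rw [measure_preimage_add]; exact D.frontier_null
  have h := addHaar_image_eq_zero_of_differentiableOn_of_addHaar_eq_zero volume
    (f := Function.invFun (D.j x)) (s := (fun y => x + y) ⁻¹' frontier D.Ω)
    (((D.hJ0 x hx).2.2.1.differentiable one_ne_zero).differentiableOn) h0
  refine measure_mono_null ?_ h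
  intro z hz
  exact ⟨D.j x z, hz, Function.leftInverse_invFun (D.hJ0 x hx).2.1.1 z⟩

end Dat

namespace Dat
variable (D : Dat N)

/-! ### The nonlocal functional -/

/-- Upper semicontinuity on the closed domain. -/
def Usc (u : Euc N → ℝ) : Prop := ∀ x ∈ D.C, ∀ a, u x < a → ∀ᶠ y in 𝓝[D.C] x, u y < a

/-- Measurability on the closed domain. -/
def Mes (u : Euc N → ℝ) : Prop := Measurable (D.C.indicator u)

/-- Bound on the closed domain. -/
def Bd (u : Euc N → ℝ) (M : ℝ) : Prop := ∀ x ∈ D.C, |u x| ≤ M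

variable {D}

lemma Usc.mes {u : Euc N → ℝ} (hu : D.Usc u) : D.Mes u := by
  apply measurable_of_Iio
  intro a
  have hO : ∃ O : Set (Euc N), IsOpen O ∧ ∀ x ∈ D.C, (u x < a ↔ x ∈ O) := by
    have : ∀ x : Euc N, ∃ O : Set (Euc N), IsOpen O ∧ (x ∈ D.C → u x < a → x ∈ O) ∧
        ∀ y ∈ O, y ∈ D.C → u y < a := by
      intro x
      by_cases h : x ∈ D.C ∧ u x < a
      · have := hu x h.1 a h.2
        rw [eventually_nhdsWithin_iff, _root_.eventually_nhds_iff] at this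
        obtain ⟨t, h1, h2, h3⟩ := this
        exact ⟨t, h2, fun _ _ => h3, h1⟩
      · exact ⟨∅, isOpen_empty, fun h1 h2 => absurd ⟨h1, h2⟩ h, by simp⟩
    choose O h1 h2 h3 using this
    refine ⟨⋃ x, O x, isOpen_iUnion h1, fun x hx => ⟨fun h => mem_iUnion.2 ⟨x, h2 x hx h⟩, fun h => ?_⟩⟩
    obtain ⟨y, hy⟩ := mem_iUnion.1 h
    exact h3 y x hy hx
  obtain ⟨O, hO1, hO2⟩ := hO
  have : D.C.indicator u ⁻¹' Iio a = (D.C ∩ O) ∪ (D.Cᶜ ∩ {_x | (0:ℝ) < a}) := by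
    ext x
    by_cases hx : x ∈ D.C
    · simp [hx, hO2 x hx]
    · simp [hx]
  rw [this]
  exact (D.isClosed_C.measurableSet.inter hO1.measurableSet).union
    (D.isClosed_C.measurableSet.compl.inter (MeasurableSet.const _))

lemma Mes.neg {u : Euc N → ℝ} (hu : D.Mes u) : D.Mes (fun x => - u x) := by
  have := Measurable.neg hu
  unfold Mes
  convert this using 1
  ext x; by_cases hx : x ∈ D.C <;> simp [hx]

lemma Mes.add {u v : Euc N → ℝ} (hu : D.Mes u) (hv : D.Mes v) : D.Mes (fun x => u x + v x) := by
  have := Measurable.add hu hv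
  unfold Mes
  convert this using 1
  ext x; by_cases hx : x ∈ D.C <;> simp [hx]

lemma Mes.of_cont {u : Euc N → ℝ} (hu : Continuous u) : D.Mes u :=
  hu.measurable.indicator D.isClosed_C.measurableSet

lemma Bd.neg {u : Euc N → ℝ} {M : ℝ} (hu : D.Bd u M) : D.Bd (fun x => - u x) M := fun x hx => by
  simpa using hu x hx

lemma Bd.nonneg {u : Euc N → ℝ} {M : ℝ} (hu : D.Bd u M) {x : Euc N} (hx : x ∈ D.C) : 0 ≤ M :=
  (abs_nonneg _).trans (hu x hx)

variable (D)

/-- landing set -/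
def ld (x : Euc N) : Set (Euc N) := {z | x + D.j x z ∈ D.C}

/-- The integrand. -/
def K (u : Euc N → ℝ) (c : ℝ) (x z : Euc N) : ℝ :=
  (D.ld x).indicator (fun z => (u (x + D.j x z) - c) * D.g x z) z

/-- The truncated functional. -/
def J (ξ : ℝ) (u : Euc N → ℝ) (c : ℝ) (x : Euc N) : ℝ := ∫ z in fr ξ, D.K u c x z

variable {D}

lemma ld_meas {x : Euc N} (hx : x ∈ D.C) : MeasurableSet (D.ld x) :=
  (D.isClosed_C.preimage (continuous_const.add (D.j_cont hx))).measurableSet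

lemma K_of_mem {x z : Euc N} (h : x + D.j x z ∈ D.C) (u : Euc N → ℝ) (c : ℝ) :
    D.K u c x z = (u (x + D.j x z) - c) * D.g x z := indicator_of_mem (s := D.ld x) h _

lemma K_of_notMem {x z : Euc N} (h : x + D.j x z ∉ D.C) (u : Euc N → ℝ) (c : ℝ) :
    D.K u c x z = 0 := indicator_of_notMem (s := D.ld x) h _

lemma Iout_eq {x : Euc N} (hx : x ∈ D.C) (ξ : ℝ) (u : Euc N → ℝ) :
    Iout D.Ω D.j D.g ξ u x = D.J ξ u (u x) x := by
  unfold Iout J K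
  rw [setIntegral_indicator (ld_meas hx)]
  rfl

lemma Iin_eq {x : Euc N} (hx : x ∈ D.C) (ξ : ℝ) (u : Euc N → ℝ) :
    Iin D.Ω D.j D.g ξ u x = ∫ z in nr ξ, D.K u (u x) x z := by
  unfold Iin K
  rw [setIntegral_indicator (ld_meas hx)]
  rfl

lemma K_meas {x : Euc N} (hx : x ∈ D.C) {u : Euc N → ℝ} (hu : D.Mes u) (c : ℝ) :
    Measurable (D.K u c x) := by
  have : D.K u c x = (D.ld x).indicator
      (fun z => (D.C.indicator u (x + D.j x z) - c) * D.g x z) := by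
    ext z
    unfold K
    by_cases h : z ∈ D.ld x
    · rw [indicator_of_mem h, indicator_of_mem h]
      congr 2
      exact (indicator_of_mem (s := D.C) h u).symm
    · rw [indicator_of_notMem h, indicator_of_notMem h]
  rw [this]
  refine Measurable.indicator ?_ (ld_meas hx)
  have h1 : Measurable (fun z => x + D.j x z) := (continuous_const.add (D.j_cont hx)).measurable
  exact ((Measurable.comp hu h1).sub_const c).mul (D.g_meas x)

lemma K_bound {x : Euc N} (hx : x ∈ D.C) {u : Euc N → ℝ} {M : ℝ} (hu : D.Bd u M) (c : ℝ) (z : Euc N) :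
    |D.K u c x z| ≤ (M + |c|) * (D.Cμ * D.wt z) := by
  have hM := hu.nonneg hx
  by_cases h : x + D.j x z ∈ D.C
  · rw [K_of_mem h, abs_mul, abs_of_nonneg (D.g_nonneg hx z)]
    refine mul_le_mul ?_ (D.g_le hx z) (D.g_nonneg hx z) (by positivity)
    exact (abs_sub _ _).trans (by linarith [hu _ h])
  · rw [K_of_notMem h, abs_zero]
    have := D.wt_nonneg z; have := D.Cμ_pos; positivity

lemma bound_int {ξ : ℝ} (hξ : 0 < ξ) (a : ℝ) :
    IntegrableOn (fun z => a * (D.Cμ * D.wt z)) (fr ξ) :=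
  ((D.wt_far hξ).const_mul _).const_mul _

lemma K_int {x : Euc N} (hx : x ∈ D.C) {u : Euc N → ℝ} {M : ℝ} (hu : D.Bd u M) (hm : D.Mes u) (c : ℝ)
    {ξ : ℝ} (hξ : 0 < ξ) : IntegrableOn (D.K u c x) (fr ξ) :=
  Integrable.mono' (bound_int hξ (M + |c|)) (K_meas hx hm c).aestronglyMeasurable
    (ae_of_all _ fun z => by rw [Real.norm_eq_abs]; exact K_bound hx hu c z)

lemma K_mono {x z : Euc N} (hx : x ∈ D.C) {u v : Euc N → ℝ} {c c' : ℝ}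
    (h : x + D.j x z ∈ D.C → u (x + D.j x z) - c ≤ v (x + D.j x z) - c') :
    D.K u c x z ≤ D.K v c' x z := by
  by_cases h' : x + D.j x z ∈ D.C
  · rw [K_of_mem h', K_of_mem h']
    exact mul_le_mul_of_nonneg_right (h h') (D.g_nonneg hx z)
  · rw [K_of_notMem h', K_of_notMem h']

lemma J_mono {x : Euc N} (hx : x ∈ D.C) {u v : Euc N → ℝ} {M M' c c' ξ : ℝ} (hξ : 0 < ξ)
    (hu : D.Bd u M) (hum : D.Mes u) (hv : D.Bd v M') (hvm : D.Mes v)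
    (h : ∀ y ∈ D.C, u y - c ≤ v y - c') : D.J ξ u c x ≤ D.J ξ v c' x :=
  setIntegral_mono (K_int hx hu hum c hξ) (K_int hx hv hvm c' hξ) fun _ => K_mono hx (h _)

lemma K_neg (x z : Euc N) (u : Euc N → ℝ) (c : ℝ) :
    D.K (fun y => - u y) (-c) x z = - D.K u c x z := by
  by_cases h' : x + D.j x z ∈ D.C
  · rw [K_of_mem h', K_of_mem h']; ring
  · rw [K_of_notMem h', K_of_notMem h', neg_zero]

lemma J_neg (x : Euc N) (u : Euc N → ℝ) (c ξ : ℝ) :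
    D.J ξ (fun y => - u y) (-c) x = - D.J ξ u c x := by
  unfold J; rw [← integral_neg]; simp only [K_neg]

lemma K_add (x z : Euc N) (u v : Euc N → ℝ) (c c' : ℝ) :
    D.K (fun y => u y + v y) (c + c') x z = D.K u c x z + D.K v c' x z := by
  by_cases h' : x + D.j x z ∈ D.C
  · rw [K_of_mem h', K_of_mem h', K_of_mem h']; ring
  · rw [K_of_notMem h', K_of_notMem h', K_of_notMem h', add_zero]

lemma J_add {x : Euc N} (hx : x ∈ D.C) {u v : Euc N → ℝ} {M M' c c' ξ : ℝ} (hξ : 0 < ξ)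
    (hu : D.Bd u M) (hum : D.Mes u) (hv : D.Bd v M') (hvm : D.Mes v) :
    D.J ξ (fun y => u y + v y) (c + c') x = D.J ξ u c x + D.J ξ v c' x := by
  unfold J; rw [← integral_add (K_int hx hu hum c hξ) (K_int hx hv hvm c' hξ)]; simp only [K_add]

lemma K_le_near {x z : Euc N} (hx : x ∈ D.C) {u : Euc N → ℝ} {b c : ℝ} (hb : 0 ≤ b)
    (h : x + D.j x z ∈ D.C → u (x + D.j x z) - c ≤ b) :
    D.K u c x z ≤ b * (D.Cμ * D.wt z) := by
  have h0 := D.wt_nonneg z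
  have h1 := D.Cμ_pos
  by_cases h' : x + D.j x z ∈ D.C
  · rw [K_of_mem h']
    exact (mul_le_mul_of_nonneg_right (h h') (D.g_nonneg hx z)).trans
      (mul_le_mul_of_nonneg_left (D.g_le hx z) hb)
  · rw [K_of_notMem h']; positivity

lemma near_split {x : Euc N} (hx : x ∈ D.C) {u : Euc N → ℝ} {M c ξ ξ' B : ℝ} (hξ' : 0 < ξ')
    (hle : ξ' ≤ ξ) (hu : D.Bd u M) (hum : D.Mes u) (hB : 0 ≤ B)
    (h : ∀ z : Euc N, ‖z‖ < ξ → x + D.j x z ∈ D.C → u (x + D.j x z) - c ≤ B * ‖z‖) :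
    D.J ξ' u c x ≤ B * D.Cμ * D.kn ξ + D.J ξ u c x := by
  have hξ : 0 < ξ := hξ'.trans_le hle
  have hsplit : fr (N := N) ξ' = (fr ξ' ∩ nr ξ) ∪ fr ξ := by
    ext z; simp only [fr, nr, mem_union, mem_inter_iff, mem_ofPred_eq]
    constructor
    · intro h; rcases lt_or_ge ‖z‖ ξ with h1 | h1
      · exact Or.inl ⟨h, h1⟩
      · exact Or.inr h1
    · rintro (h | h)
      · exact h.1
      · exact hle.trans h
  have hdisj : Disjoint (fr ξ' ∩ nr (N := N) ξ) (fr ξ) := by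
    rw [← compl_fr]; exact disjoint_compl_left.mono_left inter_subset_right
  have hK := K_int hx hu hum c hξ'
  have hK1 : IntegrableOn (D.K u c x) (fr ξ' ∩ nr ξ) := hK.mono_set inter_subset_left
  have hb : IntegrableOn (fun z => B * D.Cμ * (‖z‖ * D.wt z)) (nr ξ) := (D.wt_near hξ).const_mul _
  have h1 : ∫ z in fr ξ' ∩ nr ξ, D.K u c x z ≤ ∫ z in fr ξ' ∩ nr ξ, B * D.Cμ * (‖z‖ * D.wt z) := by
    refine setIntegral_mono_on hK1 (hb.mono_set inter_subset_right) ((fr_meas _).inter (nr_meas _)) ?_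
    intro z hz
    have := K_le_near (u := u) (c := c) hx (b := B * ‖z‖) (by positivity) (h z hz.2)
    calc _ ≤ _ := this
      _ = _ := by ring
  have h2 : ∫ z in fr ξ' ∩ nr ξ, B * D.Cμ * (‖z‖ * D.wt z) ≤ ∫ z in nr ξ, B * D.Cμ * (‖z‖ * D.wt z) := by
    refine setIntegral_mono_set hb (ae_of_all _ fun z => ?_) (ae_of_all _ fun z hz => hz.2)
    have := D.wt_nonneg z; have := D.Cμ_pos
    simp only [Pi.zero_apply]; positivity
  have h3 : ∫ z in nr ξ, B * D.Cμ * (‖z‖ * D.wt z) = B * D.Cμ * D.kn ξ := by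
    rw [integral_const_mul, D.int_near hξ]
  rw [h3] at h2
  unfold J
  conv_lhs => rw [hsplit]
  rw [setIntegral_union hdisj (fr_meas _) hK1 (K_int hx hu hum c hξ)]
  linarith

lemma J_le_min {x : Euc N} (hx : x ∈ D.C) {u : Euc N → ℝ} {M c ξ A B : ℝ} (hξ : 0 < ξ)
    (hu : D.Bd u M) (hum : D.Mes u) (hA : 0 ≤ A) (hB : 0 < B)
    (h1 : ∀ z : Euc N, x + D.j x z ∈ D.C → u (x + D.j x z) - c ≤ A)
    (h2 : ∀ z : Euc N, x + D.j x z ∈ D.C → u (x + D.j x z) - c ≤ B * ‖z‖) :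
    D.J ξ u c x ≤ D.Cμ * (D.kA A * B ^ D.σ) := by
  obtain ⟨hi, hle⟩ := D.min_aux hA hB
  have := D.Cμ_pos
  have hnn : ∀ z : Euc N, 0 ≤ min A (B * ‖z‖) := fun z => le_min hA (by positivity)
  calc D.J ξ u c x ≤ ∫ z in fr ξ, D.Cμ * (min A (B * ‖z‖) * D.wt z) := by
        refine setIntegral_mono (K_int hx hu hum c hξ) (hi.const_mul _).integrableOn fun z => ?_
        have := K_le_near (u := u) (c := c) hx (hnn z) (fun h => le_min (h1 z h) (h2 z h))
        calc _ ≤ _ := this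
          _ = _ := by ring
    _ ≤ ∫ z, D.Cμ * (min A (B * ‖z‖) * D.wt z) := by
        refine setIntegral_le_integral (hi.const_mul _) (ae_of_all _ fun z => ?_)
        have := D.wt_nonneg z; have := hnn z
        simp only [Pi.zero_apply]; positivity
    _ ≤ _ := by
        rw [integral_const_mul]; exact mul_le_mul_of_nonneg_left hle D.Cμ_pos.le

/-- Upper semicontinuity of the far-field functional. -/
lemma J_usc {u : Euc N → ℝ} {M ξ : ℝ} (hξ : 0 < ξ) (hu : D.Bd u M) (husc : D.Usc u)
    {xs : ℕ → Euc N} {x : Euc N} (hxs : ∀ k, xs k ∈ D.C) (hx : x ∈ D.C)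
    (hlim : Tendsto xs atTop (𝓝 x)) {cs : ℕ → ℝ} {c : ℝ} (hc : Tendsto cs atTop (𝓝 c))
    {δ : ℝ} (hδ : 0 < δ) : ∀ᶠ k in atTop, D.J ξ u (cs k) (xs k) ≤ D.J ξ u c x + δ := by
  have hum := husc.mes
  obtain ⟨Cc, hCc⟩ : ∃ Cc, ∀ k, |cs k| ≤ Cc := by
    obtain ⟨Cc, h⟩ := (hc.abs).bddAbove_range
    exact ⟨Cc, fun k => h (mem_range_self k)⟩
  have hcC : |c| ≤ Cc := le_of_tendsto' hc.abs hCc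
  have hM := hu.nonneg hx
  have hlimJ : Tendsto (fun k => ∫ z in fr ξ, max (D.K u (cs k) (xs k) z) (D.K u c x z)) atTop
      (𝓝 (∫ z in fr ξ, D.K u c x z)) := by
    refine tendsto_integral_of_dominated_convergence (fun z => (M + Cc) * (D.Cμ * D.wt z)) ?_
      (bound_int hξ _) ?_ ?_
    · intro k
      exact ((K_meas (hxs k) hum _).max (K_meas hx hum _)).aestronglyMeasurable
    · intro k
      refine ae_of_all _ fun z => ?_
      have h0 : 0 ≤ D.Cμ * D.wt z := by have := D.wt_nonneg z; have := D.Cμ_pos; positivity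
      have b1 := (K_bound (hxs k) hu (cs k) z).trans
        (mul_le_mul_of_nonneg_right (add_le_add_right (hCc k) M) h0)
      have b2 := (K_bound hx hu c z).trans
        (mul_le_mul_of_nonneg_right (add_le_add_right hcC M) h0)
      rw [Real.norm_eq_abs]
      exact abs_max_le_max_abs_abs.trans (max_le b1 b2)
    · refine ae_restrict_of_ae ?_
      filter_upwards [D.land_null hx] with z hz
      have hjlim : Tendsto (fun k => xs k + D.j (xs k) z) atTop (𝓝 (x + D.j x z)) := by
        refine hlim.add ?_
        rw [tendsto_iff_norm_sub_tendsto_zero]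
        refine squeeze_zero (fun _ => norm_nonneg _) (fun k => D.j_diff (hxs k) hx z) ?_
        have := (tendsto_iff_norm_sub_tendsto_zero.1 hlim).const_mul (D.Dj * ‖z‖)
        simpa using this
      have hglim : Tendsto (fun k => D.g (xs k) z) atTop (𝓝 (D.g x z)) := by
        rw [tendsto_iff_norm_sub_tendsto_zero]
        refine squeeze_zero (fun _ => norm_nonneg _) (fun k => D.g_diff (hxs k) hx z) ?_
        have := ((tendsto_iff_norm_sub_tendsto_zero.1 hlim).const_mul D.Dμ).mul_const (D.wt z)
        simpa using this
      have key : ∀ a > 0, ∀ᶠ k in atTop, D.K u (cs k) (xs k) z ≤ D.K u c x z + a := by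
        intro a ha
        by_cases h : x + D.j x z ∈ D.C
        · have hΩ : x + D.j x z ∈ D.Ω := (D.mem_or h).resolve_right hz
          have e1 : ∀ᶠ k in atTop, xs k + D.j (xs k) z ∈ D.Ω :=
            hjlim.eventually (D.isOpen_Ω.mem_nhds hΩ)
          rw [K_of_mem h]
          obtain ⟨s, hs, hs2⟩ : ∃ s > 0, s * D.g x z < a := by
            have hg := D.g_nonneg hx z
            refine ⟨a / (2 * (D.g x z + 1)), by positivity, ?_⟩
            rw [div_mul_eq_mul_div, div_lt_iff₀ (by positivity)]
            nlinarith
          have e2 : ∀ᶠ k in atTop, u (xs k + D.j (xs k) z) < u (x + D.j x z) + s := by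
            have := husc _ h (u (x + D.j x z) + s) (by linarith)
            have ht : Tendsto (fun k => xs k + D.j (xs k) z) atTop (𝓝[D.C] (x + D.j x z)) :=
              tendsto_nhdsWithin_iff.2 ⟨hjlim, e1.mono fun k hk => D.Ω_sub hk⟩
            exact ht.eventually this
          have e3 : ∀ᶠ k in atTop, (u (x + D.j x z) + s - cs k) * D.g (xs k) z
              < (u (x + D.j x z) - c) * D.g x z + a := by
            have : Tendsto (fun k => (u (x + D.j x z) + s - cs k) * D.g (xs k) z) atTop
                (𝓝 ((u (x + D.j x z) + s - c) * D.g x z)) := (hc.const_sub _).mul hglim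
            refine this.eventually_lt_const ?_
            nlinarith
          filter_upwards [e1, e2, e3] with k h1 h2 h3
          rw [K_of_mem (D.Ω_sub h1)]
          refine le_trans (mul_le_mul_of_nonneg_right ?_ (D.g_nonneg (hxs k) z)) h3.le
          linarith
        · have e1 : ∀ᶠ k in atTop, xs k + D.j (xs k) z ∈ D.Cᶜ :=
            hjlim.eventually (D.isClosed_C.isOpen_compl.mem_nhds h)
          filter_upwards [e1] with k hk
          rw [K_of_notMem hk, K_of_notMem h]; linarith
      rw [Metric.tendsto_atTop']
      intro a ha
      obtain ⟨k0, hk0⟩ := eventually_atTop.1 (key (a / 2) (by positivity))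
      refine ⟨k0, fun k hk => ?_⟩
      have h1 := hk0 k hk.le
      rw [Real.dist_eq, abs_of_nonneg (by linarith [le_max_right (D.K u (cs k) (xs k) z) (D.K u c x z)])]
      have : max (D.K u (cs k) (xs k) z) (D.K u c x z) ≤ D.K u c x z + a / 2 :=
        max_le h1 (by linarith)
      linarith
  have := hlimJ.eventually_lt_const (show D.J ξ u c x < D.J ξ u c x + δ by linarith)
  filter_upwards [this] with k hk
  refine le_trans ?_ hk.le
  have i1 := K_int (hxs k) hu hum (cs k) hξ
  have i2 := K_int hx hu hum c hξ
  exact setIntegral_mono i1 (i1.sup i2) fun z => le_max_left _ _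

end Dat

namespace Dat
variable (D : Dat N)

/-! ### Working notion of subsolution -/

/-- The equation inequality. -/
def EqSub (H : Euc N → Euc N → ℝ) (u : Euc N → ℝ) (x p : Euc N) : Prop :=
  ∀ δ > 0, ∃ ξ0 > 0, ∀ ξ, 0 < ξ → ξ < ξ0 → u x - D.J ξ u (u x) x + H x p ≤ δ

/-- Working notion of subsolution. -/
def WSub (H : Euc N → Euc N → ℝ) (u : Euc N → ℝ) : Prop :=
  ∀ x ∈ D.C, ∀ ρ > 0, ∀ φ : Euc N → ℝ, ContDiffOn ℝ 1 φ (ball x ρ) →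
    (∀ y ∈ ball x ρ, y ∈ D.C → u y - φ y ≤ u x - φ x) →
    (x ∈ frontier D.Ω ∧ ⟪gradient φ x, D.n x⟫ ≤ 0) ∨ D.EqSub H u x (gradient φ x)

variable {D}

/-- The reflected Hamiltonian. -/
def hat (H : Euc N → Euc N → ℝ) : Euc N → Euc N → ℝ := fun x p => - H x (-p)

lemma hat_hat (H : Euc N → Euc N → ℝ) : hat (hat H) = H := by
  ext x p; simp [hat]

lemma gradient_neg' (φ : Euc N → ℝ) (x : Euc N) : gradient (fun y => - φ y) x = - gradient φ x := by
  unfold gradient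
  rw [show (fun y => - φ y) = -φ from rfl, fderiv_neg, map_neg]

lemma super_iff {H : Euc N → Euc N → ℝ} {v : Euc N → ℝ} :
    IsSuperSol D.Ω D.j D.g D.n D.Cj (statF H) v ↔
      IsSubSol D.Ω D.j D.g D.n D.Cj (statF (hat H)) (fun x => - v x) := by
  have hI : ∀ (ξ : ℝ) (φ : Euc N → ℝ) (x : Euc N),
      Iin D.Ω D.j D.g ξ (fun y => - φ y) x = - Iin D.Ω D.j D.g ξ φ x := by
    intro ξ φ x; unfold Iin; rw [← integral_neg]; congr 1; ext z; ring
  have hO : ∀ (ξ : ℝ) (φ : Euc N → ℝ) (x : Euc N),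
      Iout D.Ω D.j D.g ξ (fun y => - φ y) x = - Iout D.Ω D.j D.g ξ φ x := by
    intro ξ φ x; unfold Iout; rw [← integral_neg]; congr 1; ext z; ring
  constructor
  · intro h ξ hξ φ hφ x hx hmax
    obtain ⟨h1, h2⟩ := h ξ hξ (fun y => - φ y) hφ.neg x hx (fun y hy => by linarith [hmax y hy])
    simp only [statF, hI, hO, gradient_neg', hat, inner_neg_left] at h1 h2 ⊢
    refine ⟨fun hx => by linarith [h1 hx], fun hx => ?_⟩
    rcases le_max_iff.1 (h2 hx) with h3 | h3
    · exact min_le_iff.2 (Or.inl (by linarith))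
    · exact min_le_iff.2 (Or.inr (by linarith))
  · intro h ξ hξ φ hφ x hx hmax
    obtain ⟨h1, h2⟩ := h ξ hξ (fun y => - φ y) hφ.neg x hx (fun y hy => by linarith [hmax y hy])
    simp only [statF, hI, hO, gradient_neg', hat, inner_neg_left, neg_neg] at h1 h2 ⊢
    refine ⟨fun hx => by linarith [h1 hx], fun hx => ?_⟩
    rcases min_le_iff.1 (h2 hx) with h3 | h3
    · exact le_max_iff.2 (Or.inl (by linarith))
    · exact le_max_iff.2 (Or.inr (by linarith))

lemma C1_lip {φ : Euc N → ℝ} {x : Euc N} {ρ r : ℝ} (hr : r < ρ) (hφ : ContDiffOn ℝ 1 φ (ball x ρ)) :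
    ∃ L ≥ 0, ∀ y ∈ closedBall x r, ∀ z ∈ closedBall x r, |φ y - φ z| ≤ L * ‖y - z‖ := by
  have hsub : closedBall x r ⊆ ball x ρ := closedBall_subset_ball hr
  have hc : ContinuousOn (fun y => fderiv ℝ φ y) (closedBall x r) :=
    (hφ.continuousOn_fderiv_of_isOpen isOpen_ball le_rfl).mono hsub
  obtain ⟨L, hL⟩ := (isCompact_closedBall x r).exists_bound_of_continuousOn hc
  refine ⟨max L 0, le_max_right _ _, fun y hy z hz => ?_⟩
  have := (convex_closedBall x r).norm_image_sub_le_of_norm_fderiv_le (𝕜 := ℝ) (f := φ)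
    (C := max L 0) (fun w hw => ((hφ.differentiableOn one_ne_zero) w (hsub hw)).differentiableAt
      (isOpen_ball.mem_nhds (hsub hw))) (fun w hw => (hL w hw).trans (le_max_left _ _)) hz hy
  simpa using this

lemma near_le {x : Euc N} (hx : x ∈ D.C) {u : Euc N → ℝ} {c ξ B : ℝ} (hξ : 0 < ξ) (hB : 0 ≤ B)
    (h : ∀ z : Euc N, ‖z‖ < ξ → x + D.j x z ∈ D.C → u (x + D.j x z) - c ≤ B * ‖z‖) :
    ∫ z in nr ξ, D.K u c x z ≤ B * D.Cμ * D.kn ξ := by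
  have h3 : ∫ z in nr ξ, B * D.Cμ * (‖z‖ * D.wt z) = B * D.Cμ * D.kn ξ := by
    rw [integral_const_mul, D.int_near hξ]
  by_cases hi : IntegrableOn (D.K u c x) (nr ξ)
  · rw [← h3]
    refine setIntegral_mono_on hi ((D.wt_near hξ).const_mul _) (nr_meas _) fun z hz => ?_
    have := K_le_near (u := u) (c := c) hx (b := B * ‖z‖) (by positivity) (h z hz)
    calc _ ≤ _ := this
      _ = _ := by ring
  · rw [integral_undef hi]
    have := D.kn_nonneg hξ.le; have := D.Cμ_pos; positivity

lemma cutoff {φ : Euc N → ℝ} {x : Euc N} {ρ : ℝ} (hρ : 0 < ρ) (hφ : ContDiffOn ℝ 1 φ (ball x ρ)) :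
    ∃ φ' : Euc N → ℝ, ContDiff ℝ 1 φ' ∧ ∀ y ∈ closedBall x (ρ / 4), φ' y = φ y := by
  let b : ContDiffBump x := ⟨ρ / 4, ρ / 2, by positivity, by linarith⟩
  refine ⟨fun y => b y * φ y, ?_, fun y hy => ?_⟩
  · rw [contDiff_iff_contDiffAt]
    intro y
    by_cases hy : y ∈ ball x ρ
    · exact b.contDiff.contDiffAt.mul (hφ.contDiffAt (isOpen_ball.mem_nhds hy))
    · have : (fun y => b y * φ y) =ᶠ[𝓝 y] fun _ => 0 := by
        have hy' : y ∈ (closedBall x (ρ / 2))ᶜ := by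
          simp only [mem_compl_iff, mem_closedBall, mem_ball, not_le, not_lt] at hy ⊢; linarith
        filter_upwards [isClosed_closedBall.isOpen_compl.mem_nhds hy'] with w hw
        have : b w = 0 := b.zero_of_le_dist (by
          simp only [mem_compl_iff, mem_closedBall, not_le] at hw; exact hw.le)
        rw [this, zero_mul]
      exact contDiffAt_const.congr_of_eventuallyEq this
  · have : b y = 1 := b.one_of_mem_closedBall hy
    simp [this]

lemma wsub_of_sub {H : Euc N → Euc N → ℝ} {u : Euc N → ℝ}
    (h : IsSubSol D.Ω D.j D.g D.n D.Cj (statF H) u) : D.WSub H u := by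
  intro x hx ρ hρ φ hφ hmax
  obtain ⟨φ', hφ', heq⟩ := cutoff hρ hφ
  have hgr : gradient φ' x = gradient φ x := by
    have : φ' =ᶠ[𝓝 x] φ := by
      filter_upwards [closedBall_mem_nhds x (show 0 < ρ / 4 by positivity)] with y hy using heq y hy
    unfold gradient; rw [this.fderiv_eq]
  have hxx : φ' x = φ x := heq x (mem_closedBall_self (by positivity))
  obtain ⟨L, hL0, hL⟩ := C1_lip (x := x) (show ρ / 4 < ρ by linarith) hφ'.contDiffOn
  by_cases hb : x ∈ frontier D.Ω ∧ ⟪gradient φ x, D.n x⟫ ≤ 0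
  · exact Or.inl hb
  refine Or.inr fun δ hδ => ?_
  have hCj := D.Cj_pos
  have ht : Tendsto (fun ξ => L * D.Cj * D.Cμ * D.kn ξ) (𝓝[>] 0) (𝓝 0) := by
    simpa using D.kn_tendsto.const_mul (L * D.Cj * D.Cμ)
  have hev := ht.eventually_lt_const hδ
  rw [eventually_nhdsWithin_iff, Metric.eventually_nhds_iff] at hev
  obtain ⟨ξ1, hξ1, hev⟩ := hev
  refine ⟨min ξ1 (ρ / (4 * D.Cj)), lt_min hξ1 (by positivity), fun ξ hξ hlt => ?_⟩
  have hξ4 : D.Cj * ξ ≤ ρ / 4 := by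
    have := (hlt.trans_le (min_le_right _ _)).le
    rw [le_div_iff₀ (by positivity)] at this; linarith
  have hk := hev (y := ξ) (by rw [Real.dist_eq, sub_zero, abs_of_pos hξ]; exact hlt.trans_le (min_le_left _ _)) hξ
  have hin : ∫ z in nr ξ, D.K φ' (φ' x) x z ≤ L * D.Cj * D.Cμ * D.kn ξ := by
    refine near_le hx hξ (by positivity) fun z hz _ => ?_
    have hj := D.j_le hx z
    have hmem : x + D.j x z ∈ closedBall x (ρ / 4) := by
      rw [mem_closedBall, dist_eq_norm, add_sub_cancel_left]
      refine hj.trans (le_trans ?_ hξ4)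
      exact mul_le_mul_of_nonneg_left hz.le hCj.le
    have := hL _ hmem x (mem_closedBall_self (by positivity))
    rw [add_sub_cancel_left] at this
    calc _ ≤ _ := le_abs_self _
      _ ≤ _ := this
      _ ≤ L * (D.Cj * ‖z‖) := mul_le_mul_of_nonneg_left hj hL0
      _ = _ := by ring
  obtain ⟨h1, h2⟩ := h ξ hξ φ' hφ' x hx (by
    rintro y ⟨hy, hyC⟩
    have hy4 : y ∈ closedBall x (ρ / 4) := closedBall_subset_closedBall hξ4 hy
    rw [heq y hy4, hxx]
    exact hmax y (closedBall_subset_ball (by linarith) hy4) hyC)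
  rw [Iin_eq hx, Iout_eq hx, hgr] at h1 h2
  have : u x - ((∫ z in nr ξ, D.K φ' (φ' x) x z) + D.J ξ u (u x) x) + H x (gradient φ x) ≤ 0 := by
    rcases D.mem_or hx with hm | hm
    · exact h1 hm
    · rcases min_le_iff.1 (h2 hm) with h3 | h3
      · exact h3
      · exact absurd ⟨hm, h3⟩ hb
  linarith

lemma sub_of_wsub {H : Euc N → Euc N → ℝ} {u : Euc N → ℝ} {M : ℝ} (hu : D.Bd u M) (hum : D.Mes u)
    (h : D.WSub H u) : IsSubSol D.Ω D.j D.g D.n D.Cj (statF H) u := by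
  intro ξ hξ φ hφ x hx hmax
  have hCj := D.Cj_pos
  have hCμ := D.Cμ_pos
  suffices hh : (x ∈ frontier D.Ω ∧ ⟪gradient φ x, D.n x⟫ ≤ 0) ∨
      statF H x (u x) (gradient φ x) (Iin D.Ω D.j D.g ξ φ x + Iout D.Ω D.j D.g ξ u x) ≤ 0 by
    rcases hh with ⟨h1, h2⟩ | h1
    · refine ⟨fun h3 => ?_, fun _ => min_le_iff.2 (Or.inr h2)⟩
      rw [D.frontier_eq] at h1; exact absurd h3 h1.2
    · exact ⟨fun _ => h1, fun _ => min_le_iff.2 (Or.inl h1)⟩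
  rcases h x hx (D.Cj * ξ) (by positivity) φ hφ.contDiffOn
    (fun y hy hyC => hmax y ⟨ball_subset_closedBall hy, hyC⟩) with h1 | h1
  · exact Or.inl h1
  refine Or.inr ?_
  rw [Iin_eq hx, Iout_eq hx]
  unfold statF
  obtain ⟨L, hL0, hL⟩ := C1_lip (x := x) (show D.Cj * ξ < D.Cj * ξ + 1 by linarith) hφ.contDiffOn
  have hmem : ∀ z : Euc N, ‖z‖ < ξ → x + D.j x z ∈ closedBall x (D.Cj * ξ) := fun z hz => by
    rw [mem_closedBall, dist_eq_norm, add_sub_cancel_left]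
    exact (D.j_le hx z).trans (mul_le_mul_of_nonneg_left hz.le hCj.le)
  have habs : ∀ z : Euc N, ‖z‖ < ξ → |φ (x + D.j x z) - φ x| ≤ L * D.Cj * ‖z‖ := fun z hz => by
    have := hL _ (hmem z hz) x (mem_closedBall_self (by positivity))
    rw [add_sub_cancel_left] at this
    calc _ ≤ _ := this
      _ ≤ L * (D.Cj * ‖z‖) := mul_le_mul_of_nonneg_left (D.j_le hx z) hL0
      _ = _ := by ring
  have hφm : D.Mes φ := Mes.of_cont hφ.continuous
  have hKi : IntegrableOn (D.K φ (φ x) x) (nr ξ) := by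
    refine Integrable.mono' ((D.wt_near hξ).const_mul (L * D.Cj * D.Cμ))
      (K_meas hx hφm _).aestronglyMeasurable ?_
    refine (ae_restrict_iff' (nr_meas ξ)).2 (ae_of_all _ fun z hz => ?_)
    have h0 := K_le_near (u := φ) (c := φ x) hx (b := L * D.Cj * ‖z‖) (by positivity)
      (fun _ => (le_abs_self _).trans (habs z hz))
    have h1 := K_le_near (u := fun y => - φ y) (c := - φ x) hx (b := L * D.Cj * ‖z‖) (by positivity)
      (fun _ => by
        have := (neg_abs_le (φ (x + D.j x z) - φ x))
        linarith [habs z hz])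
    rw [K_neg] at h1
    rw [Real.norm_eq_abs, abs_le]
    constructor <;> linarith
  have ht : Tendsto (fun ξ => L * D.Cj * D.Cμ * D.kn ξ) (𝓝[>] 0) (𝓝 0) := by
    simpa using D.kn_tendsto.const_mul (L * D.Cj * D.Cμ)
  refine le_of_forall_pos_le_add fun δ hδ => ?_
  obtain ⟨ξ0, hξ0, hE⟩ := h1 (δ / 2) (by positivity)
  have hev := ht.eventually_lt_const (show 0 < δ / 2 by positivity)
  have hev2 : ∀ᶠ ξ' in 𝓝[>] (0:ℝ), 0 < ξ' ∧ ξ' < ξ0 ∧ ξ' < ξ := by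
    have : Ioo (0:ℝ) (min ξ0 ξ) ∈ 𝓝[>] (0:ℝ) := Ioo_mem_nhdsGT (lt_min hξ0 hξ)
    filter_upwards [this] with a ha
    exact ⟨ha.1, ha.2.trans_le (min_le_left _ _), ha.2.trans_le (min_le_right _ _)⟩
  obtain ⟨ξ', hk, hξ', hlt0, hlt⟩ := (hev.and hev2).exists
  have hEE := hE ξ' hξ' hlt0
  -- split
  have hsplit : fr (N := N) ξ' = (nr ξ \ nr ξ') ∪ fr ξ := by
    ext z; simp only [fr, nr, mem_union, Set.mem_sdiff, mem_ofPred_eq, not_lt]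
    constructor
    · intro h; rcases lt_or_ge ‖z‖ ξ with h1 | h1
      · exact Or.inl ⟨h1, h⟩
      · exact Or.inr h1
    · rintro (h | h)
      · exact h.2
      · exact hlt.le.trans h
  have hdisj : Disjoint (nr ξ \ nr (N := N) ξ') (fr ξ) := by
    rw [← compl_fr]; exact disjoint_compl_left.mono_left sdiff_subset
  have hsubn : nr (N := N) ξ' ⊆ nr ξ := fun z hz => lt_trans hz hlt
  have hK := K_int hx hu hum (u x) hξ'
  have hK1 : IntegrableOn (D.K u (u x) x) (nr ξ \ nr ξ') := hK.mono_set (by rw [hsplit]; exact subset_union_left)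
  have e1 : D.J ξ' u (u x) x = (∫ z in nr ξ \ nr ξ', D.K u (u x) x z) + D.J ξ u (u x) x := by
    unfold J
    conv_lhs => rw [hsplit]
    rw [setIntegral_union hdisj (fr_meas _) hK1 (K_int hx hu hum _ hξ)]
  have e2 : ∫ z in nr ξ \ nr ξ', D.K u (u x) x z ≤ ∫ z in nr ξ \ nr ξ', D.K φ (φ x) x z := by
    refine setIntegral_mono_on hK1 (hKi.mono_set sdiff_subset) ((nr_meas _).diff (nr_meas _)) ?_
    intro z hz
    refine K_mono hx fun hC => ?_
    linarith [hmax _ ⟨hmem z hz.1, hC⟩]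
  have e3 : ∫ z in nr ξ \ nr ξ', D.K φ (φ x) x z =
      (∫ z in nr ξ, D.K φ (φ x) x z) - ∫ z in nr ξ', D.K φ (φ x) x z :=
    setIntegral_sdiff (nr_meas _) hKi hsubn
  have e4 : ∫ z in nr ξ', D.K (fun y => - φ y) (- φ x) x z ≤ L * D.Cj * D.Cμ * D.kn ξ' := by
    refine near_le hx hξ' (by positivity) fun z hz _ => ?_
    have := (neg_abs_le (φ (x + D.j x z) - φ x))
    linarith [habs z (hz.trans hlt)]
  simp only [K_neg, integral_neg] at e4
  linarith

lemma sub_iff {H : Euc N → Euc N → ℝ} {u : Euc N → ℝ} {M : ℝ} (hu : D.Bd u M) (hum : D.Mes u) :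
    IsSubSol D.Ω D.j D.g D.n D.Cj (statF H) u ↔ D.WSub H u :=
  ⟨wsub_of_sub, sub_of_wsub hu hum⟩

end Dat

namespace Dat
variable (D : Dat N)

/-! ### Volume estimates -/

lemma lip_vol {f : Euc N → Euc N} {L : ℝ≥0} (hf : LipschitzWith L f) (s : Set (Euc N)) :
    volume (f '' s) ≤ (L : ℝ≥0∞) ^ N * volume s := by
  have e : (volume : Measure (Euc N)) = Measure.addHaarScalarFactor (volume : Measure (Euc N))
      (Measure.hausdorffMeasure (N:ℝ)) • (Measure.hausdorffMeasure (N:ℝ)) :=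
    Measure.isAddLeftInvariant_eq_smul _ _
  have h := hf.hausdorffMeasure_image_le (d := (N:ℝ)) (by positivity) s
  rw [e]
  simp only [Measure.smul_apply, ENNReal.smul_def, smul_eq_mul]
  rw [ENNReal.rpow_natCast] at h
  calc _ ≤ _ := mul_le_mul_right h _
    _ = _ := by ring

lemma slab_vol {d : Euc N → ℝ} {e0 x : Euc N} {w ρ : ℝ} (he0 : ‖e0‖ = 1) (hw : 0 < w) (hwρ : w ≤ ρ)
    (hd : ContinuousOn d (closedBall x ρ))
    (hmon : ∀ y ∈ closedBall x ρ, ∀ t ≥ 0, y + t • e0 ∈ closedBall x ρ → d y + t / 2 ≤ d (y + t • e0)) :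
    volume.real (closedBall x ρ ∩ d ⁻¹' Icc (-w) w) ≤
      (w / ρ) * ((11 * ρ) ^ N * (volume : Measure (Euc N)).real (ball 0 1)) := by
  have hρ : 0 < ρ := hw.trans_le hwρ
  set S := closedBall x ρ ∩ d ⁻¹' Icc (-w) w with hS
  have hSm : MeasurableSet S := (hd.preimage_isClosed_of_isClosed isClosed_closedBall isClosed_Icc).measurableSet
  set m := ⌈ρ / w⌉₊ with hm
  have hm1 : ρ / w ≤ m := Nat.le_ceil _
  have hm2 : (m : ℝ) ≤ 2 * (ρ / w) := by
    have := (Nat.ceil_lt_add_one (show 0 ≤ ρ / w by positivity)).le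
    have h1 : 1 ≤ ρ / w := by rwa [one_le_div hw]
    linarith
  have hm3 : 5 * w * m ≤ 10 * ρ := by
    calc 5 * w * m ≤ 5 * w * (2 * (ρ / w)) := by gcongr
      _ = 10 * ρ := by field_simp; norm_num
  let T : ℕ → Set (Euc N) := fun k => (fun y => y + (-(5 * w * k)) • e0) ⁻¹' S
  have hTm : ∀ k, MeasurableSet (T k) := fun k => hSm.preimage (by fun_prop)
  have hTv : ∀ k, volume.real (T k) = volume.real S := fun k => by
    unfold Measure.real; rw [measure_preimage_add_right]
  have hSfin : volume S ≠ ⊤ :=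
    ((measure_mono inter_subset_left).trans_lt measure_closedBall_lt_top).ne
  have hdis : ∀ k k' : ℕ, k' < k → Disjoint (T k') (T k) := by
    intro k k' hkk
    rw [Set.disjoint_left]
    intro y hy' hy
    have hk1 : (1:ℝ) ≤ k - k' := by
      have : (k':ℝ) + 1 ≤ k := by exact_mod_cast hkk
      linarith
    have heq : y + (-(5 * w * k')) • e0 = (y + (-(5 * w * k)) • e0) + (5 * w * (k - k')) • e0 := by
      module
    have h5 : 5 * w ≤ 5 * w * (k - k') := by nlinarith
    have := hmon _ hy.1 (5 * w * (k - k')) (by linarith) (by rw [← heq]; exact hy'.1)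
    rw [← heq] at this
    have h1 := hy.2.1
    have h2 := hy'.2.2
    linarith
  have hpd : ((Finset.range m : Finset ℕ) : Set ℕ).PairwiseDisjoint T := by
    intro a _ b _ hab
    rcases lt_or_gt_of_ne hab with h | h
    · exact hdis b a h
    · exact (hdis a b h).symm
  have hsum := measureReal_biUnion_finset (μ := volume) hpd (fun b _ => hTm b)
    (fun b _ => by
      show volume (T b) ≠ ⊤
      rw [measure_preimage_add_right]; exact hSfin)
  simp only [hTv, Finset.sum_const, Finset.card_range, nsmul_eq_mul] at hsum
  have hsub : (⋃ b ∈ Finset.range m, T b) ⊆ closedBall x (11 * ρ) := by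
    intro y hy
    simp only [mem_iUnion, Finset.mem_range] at hy
    obtain ⟨k, hk, hy⟩ := hy
    have h1 := hy.1
    rw [mem_closedBall, dist_eq_norm] at h1 ⊢
    have hk' : (k:ℝ) ≤ m := by exact_mod_cast hk.le
    have : y - x = (y + (-(5 * w * k)) • e0 - x) + (5 * w * k) • e0 := by module
    rw [this]
    refine (norm_add_le _ _).trans ?_
    rw [norm_smul, he0, Real.norm_eq_abs, abs_of_nonneg (by positivity), mul_one]
    have : 5 * w * k ≤ 5 * w * m := by gcongr
    linarith
  have hle : volume.real (⋃ b ∈ Finset.range m, T b) ≤ volume.real (closedBall x (11 * ρ)) :=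
    measureReal_mono hsub measure_closedBall_lt_top.ne
  rw [hsum, Measure.addHaar_real_closedBall _ _ (by positivity)] at hle
  simp only [finrank_euclideanSpace, Fintype.card_fin] at hle
  have h0 : ρ / w * volume.real S ≤ m * volume.real S := by gcongr
  have := h0.trans hle
  calc volume.real S = (w / ρ) * (ρ / w * volume.real S) := by field_simp
    _ ≤ _ := by gcongr

lemma inv_lip {x : Euc N} (hx : x ∈ D.C) :
    LipschitzWith (Real.toNNReal D.Aj) (Function.invFun (D.j x)) := by
  refine lipschitzWith_of_nnnorm_fderiv_le (𝕜 := ℝ) ((D.hJ0 x hx).2.2.1.differentiable one_ne_zero) fun z => ?_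
  rw [← NNReal.coe_le_coe, coe_nnnorm]
  exact ((D.hJ0 x hx).2.2.2 z).trans (Real.le_coe_toNNReal _)

/-- volume of preimages under the jump map -/
lemma jump_vol {x : Euc N} (hx : x ∈ D.C) (S : Set (Euc N)) (hS : volume S ≠ ⊤) :
    volume {z | x + D.j x z ∈ S} ≠ ⊤ ∧
    volume.real {z | x + D.j x z ∈ S} ≤ (Real.toNNReal D.Aj : ℝ) ^ N * volume.real S := by
  have hsub : {z | x + D.j x z ∈ S} ⊆ Function.invFun (D.j x) '' ((fun y => y + x) ⁻¹' S) := by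
    intro z hz
    refine ⟨D.j x z, ?_, Function.leftInverse_invFun (D.hJ0 x hx).2.1.1 z⟩
    rw [mem_preimage, add_comm]; exact hz
  have h := (measure_mono hsub).trans (lip_vol (D.inv_lip hx) _)
  rw [measure_preimage_add_right] at h
  have hfin : ((Real.toNNReal D.Aj : ℝ≥0) : ℝ≥0∞) ^ N * volume S ≠ ⊤ :=
    ENNReal.mul_ne_top (ENNReal.pow_ne_top ENNReal.coe_ne_top) hS
  refine ⟨(h.trans_lt hfin.lt_top).ne, ?_⟩
  have := ENNReal.toReal_mono hfin h
  rw [ENNReal.toReal_mul, ENNReal.toReal_pow] at this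
  exact this

/-- The slab. -/
def slab (d : Euc N → ℝ) (ξ θ : ℝ) (x : Euc N) : Set (Euc N) :=
  {z | ‖z‖ < ξ ∧ |d (x + D.j x z)| ≤ θ * ‖z‖}

lemma slab_meas {d : Euc N → ℝ} {ξ θ R : ℝ} {x : Euc N} (hx : x ∈ D.C)
    (hd : ContinuousOn d (ball x R)) (hR : D.Cj * ξ ≤ R) : MeasurableSet (D.slab d ξ θ x) := by
  have hCj := D.Cj_pos
  have hc : ContinuousOn (fun z => |d (x + D.j x z)| - θ * ‖z‖) (nr ξ) := by
    refine ContinuousOn.sub (ContinuousOn.abs (hd.comp (continuous_const.add (D.j_cont hx)).continuousOn ?_))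
      (by fun_prop)
    intro z hz
    rw [mem_ball, dist_eq_norm, add_sub_cancel_left]
    exact ((D.j_le hx z).trans_lt (mul_lt_mul_of_pos_left hz hCj)).trans_le hR
  have hop : IsOpen (nr (N := N) ξ) := isOpen_lt continuous_norm continuous_const
  have := (hc.isOpen_inter_preimage hop (isOpen_Ioi (a := (0:ℝ)))).measurableSet
  have e : D.slab d ξ θ x = nr ξ \ (nr ξ ∩ (fun z => |d (x + D.j x z)| - θ * ‖z‖) ⁻¹' Ioi 0) := by
    ext z; simp only [slab, nr, mem_ofPred_eq, Set.mem_sdiff, mem_inter_iff, mem_preimage, mem_Ioi]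
    constructor
    · rintro ⟨h1, h2⟩; exact ⟨h1, fun h => by linarith [h.2]⟩
    · rintro ⟨h1, h2⟩; refine ⟨h1, ?_⟩
      by_contra h3; exact h2 ⟨h1, by linarith⟩
  rw [e]; exact (nr_meas _).diff this

lemma slab_est {d : Euc N → ℝ} {e0 : Euc N} {ξ R : ℝ} (he0 : ‖e0‖ = 1) (hξ : 0 < ξ)
    (hR : (D.Cj + 1) * ξ ≤ R) :
    ∃ Cs > 0, ∀ x ∈ D.C, ContinuousOn d (closedBall x R) →
    (∀ y ∈ closedBall x R, ∀ t ≥ 0, y + t • e0 ∈ closedBall x R → d y + t / 2 ≤ d (y + t • e0)) →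
    ∀ θ, 0 < θ → θ ≤ 1 → ∫ z in D.slab d ξ θ x, ‖z‖ * D.wt z ≤ Cs * θ := by
  have hCj := D.Cj_pos
  have hσ1 : 0 < 1 - D.σ := by linarith [D.σ_lt]
  set v := (volume : Measure (Euc N)).real (ball 0 1) with hv
  set a := (Real.toNNReal D.Aj : ℝ) ^ N with ha
  set C1 := D.Cj + 1 with hC1
  set q : ℝ := (1/2 : ℝ) ^ (1 - D.σ) with hq
  have hq0 : 0 < q := by positivity
  have hq1 : q < 1 := Real.rpow_lt_one (by norm_num) (by norm_num) hσ1
  set P := a * (C1⁻¹ * ((11 * C1) ^ N * v)) * 2 ^ ((N:ℝ) + D.σ - 1) * ξ ^ (1 - D.σ) with hP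
  have hP0 : 0 ≤ P := by positivity
  have h1q : 0 < 1 - q := by linarith
  have hCs : 0 < P * (1 - q)⁻¹ + 1 := by positivity
  refine ⟨P * (1 - q)⁻¹ + 1, hCs, fun x hx hdc hmon θ hθ hθ1 => ?_⟩
  let ρ : ℕ → ℝ := fun k => (1/2 : ℝ) ^ k * ξ
  have hρ : ∀ k, 0 < ρ k := fun k => by positivity
  have hρξ : ∀ k, ρ k ≤ ξ := fun k => by
    have : (1/2:ℝ) ^ k ≤ 1 := pow_le_one₀ (by norm_num) (by norm_num)
    calc ρ k ≤ 1 * ξ := mul_le_mul_of_nonneg_right this hξ.le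
      _ = ξ := one_mul _
  let Sh : ℕ → Set (Euc N) := fun k => D.slab d ξ θ x ∩ {z | ρ (k+1) ≤ ‖z‖ ∧ ‖z‖ < ρ k}
  have hslm : MeasurableSet (D.slab d ξ θ x) :=
    D.slab_meas hx (hdc.mono ball_subset_closedBall) (by nlinarith)
  have hShm : ∀ k, MeasurableSet (Sh k) := fun k =>
    hslm.inter ((measurableSet_le measurable_const measurable_norm).inter
      (measurableSet_lt measurable_norm measurable_const))
  have hρanti : ∀ k k', k ≤ k' → ρ k' ≤ ρ k := fun k k' h =>
    mul_le_mul_of_nonneg_right (pow_le_pow_of_le_one (by norm_num) (by norm_num) h) hξ.le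
  have hdis : Pairwise (Function.onFun Disjoint Sh) := by
    have key : ∀ k k', k < k' → Disjoint (Sh k) (Sh k') := by
      intro k k' hk
      rw [Set.disjoint_left]
      rintro z ⟨-, h1, -⟩ ⟨-, -, h2⟩
      have := hρanti (k+1) k' hk
      linarith
    intro k k' hk
    rcases lt_or_gt_of_ne hk with h | h
    · exact key _ _ h
    · exact (key _ _ h).symm
  have hsubn : (⋃ k, Sh k) ⊆ nr ξ := iUnion_subset fun k z hz => hz.1.1
  have hint : IntegrableOn (fun z => ‖z‖ * D.wt z) (⋃ k, Sh k) := (D.wt_near hξ).mono_set hsubn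
  have hHS := hasSum_integral_iUnion hShm hdis hint
  have heqU : ∫ z in D.slab d ξ θ x, ‖z‖ * D.wt z = ∫ z in ⋃ k, Sh k, ‖z‖ * D.wt z := by
    refine setIntegral_eq_of_subset_of_forall_sdiff_eq_zero hslm (iUnion_subset fun k => inter_subset_left) ?_
    intro z hz
    by_cases hz0 : ‖z‖ = 0
    · rw [hz0, zero_mul]
    exfalso
    apply hz.2
    have hzpos : 0 < ‖z‖ := lt_of_le_of_ne (norm_nonneg _) (Ne.symm hz0)
    have hzξ : ‖z‖ < ξ := hz.1.1
    obtain ⟨k, hk1, hk2⟩ := exists_nat_pow_near_of_lt_one (x := ‖z‖ / ξ) (y := (1/2:ℝ))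
      (by positivity) (by rw [div_le_one hξ]; exact hzξ.le) (by norm_num) (by norm_num)
    rw [lt_div_iff₀ hξ] at hk1
    rw [div_le_iff₀ hξ] at hk2
    rw [mem_iUnion]
    rcases hk2.lt_or_eq with h | h
    · exact ⟨k, hz.1, hk1.le, h⟩
    · rcases Nat.eq_zero_or_pos k with h0 | h0
      · subst h0; simp at h; linarith
      · refine ⟨k - 1, hz.1, ?_, ?_⟩
        · rw [Nat.sub_add_cancel h0]; exact h.ge
        · rw [h]
          refine mul_lt_mul_of_pos_right ?_ hξ
          exact pow_lt_pow_right_of_lt_one₀ (by norm_num) (by norm_num) (by omega)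
  rw [heqU]
  have hterm : ∀ k, ∫ z in Sh k, ‖z‖ * D.wt z ≤ P * θ * q ^ k := by
    intro k
    have hCρ : 0 < C1 * ρ k := by have := hρ k; positivity
    have hCρR : C1 * ρ k ≤ R := le_trans (mul_le_mul_of_nonneg_left (hρξ k) (by positivity)) hR
    have hcb : closedBall x (C1 * ρ k) ⊆ closedBall x R := closedBall_subset_closedBall hCρR
    have hwle : θ * ρ k ≤ C1 * ρ k := mul_le_mul_of_nonneg_right (by linarith) (hρ k).le
    set S := closedBall x (C1 * ρ k) ∩ d ⁻¹' Icc (-(θ * ρ k)) (θ * ρ k) with hS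
    have hvS := slab_vol (d := d) (x := x) (w := θ * ρ k) (ρ := C1 * ρ k) he0
      (mul_pos hθ (hρ k)) hwle (hdc.mono hcb) (fun y hy t ht hyt => hmon y (hcb hy) t ht (hcb hyt))
    have hSfin : volume S ≠ ⊤ :=
      ((measure_mono inter_subset_left).trans_lt measure_closedBall_lt_top).ne
    obtain ⟨hf, hjv⟩ := D.jump_vol hx S hSfin
    have hsub : Sh k ⊆ {z | x + D.j x z ∈ S} := by
      rintro z ⟨⟨h1, h2⟩, h3, h4⟩
      refine ⟨?_, ?_⟩
      · rw [mem_closedBall, dist_eq_norm, add_sub_cancel_left]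
        refine (D.j_le hx z).trans ?_
        exact mul_le_mul (by linarith) h4.le (norm_nonneg _) (by positivity)
      · rw [mem_preimage, mem_Icc, ← abs_le]
        exact h2.trans (mul_le_mul_of_nonneg_left h4.le hθ.le)
    have hShfin : volume (Sh k) < ⊤ := (measure_mono hsub).trans_lt hf.lt_top
    have hvSh : volume.real (Sh k) ≤ a * ((θ * ρ k) / (C1 * ρ k) * ((11 * (C1 * ρ k)) ^ N * v)) :=
      (measureReal_mono hsub hf).trans (hjv.trans (mul_le_mul_of_nonneg_left hvS (by positivity)))
    have hwt : ∀ z ∈ Sh k, ‖‖z‖ * D.wt z‖ ≤ (ρ (k+1)) ^ (1 - ((N:ℝ) + D.σ)) := by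
      rintro z ⟨-, h3, -⟩
      have hz : 0 < ‖z‖ := (hρ (k+1)).trans_le h3
      rw [Real.norm_of_nonneg (mul_nonneg hz.le (D.wt_nonneg z))]
      have : ‖z‖ * D.wt z = ‖z‖ ^ (1 - ((N:ℝ) + D.σ)) := by
        unfold wt; rw [sub_eq_add_neg, Real.rpow_add hz, Real.rpow_one]
      rw [this]
      refine Real.rpow_le_rpow_of_nonpos (hρ (k+1)) h3 ?_
      have : (1:ℝ) ≤ N := by exact_mod_cast D.hN
      linarith [D.σ_pos]
    have h := norm_setIntegral_le_of_norm_le_const hShfin hwt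
    refine (le_abs_self _).trans ((Real.norm_eq_abs _ ▸ h).trans ?_)
    refine (mul_le_mul_of_nonneg_left hvSh (by have := hρ (k+1); positivity)).trans (le_of_eq ?_)
    -- algebra
    have hρk := hρ k
    have e1 : ρ (k+1) = ρ k / 2 := by simp only [ρ, pow_succ]; ring
    have e2 : (ρ k / 2) ^ (1 - ((N:ℝ) + D.σ)) = (ρ k) ^ (1 - D.σ) * ((ρ k) ^ N)⁻¹ * 2 ^ ((N:ℝ) + D.σ - 1) := by
      rw [Real.div_rpow hρk.le (by norm_num), div_eq_mul_inv, ← Real.rpow_neg (by norm_num),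
        ← Real.rpow_natCast, ← Real.rpow_neg hρk.le, ← Real.rpow_add hρk]
      congr 2 <;> ring
    have e3 : (ρ k) ^ (1 - D.σ) = q ^ k * ξ ^ (1 - D.σ) := by
      simp only [ρ]
      rw [Real.mul_rpow (by positivity) hξ.le, hq, ← Real.rpow_natCast, ← Real.rpow_mul (by norm_num),
        ← Real.rpow_natCast, ← Real.rpow_mul (by norm_num)]
      ring_nf
    rw [e1, e2, e3, hP]
    have : (11 * (C1 * ρ k)) ^ N = (11 * C1) ^ N * ρ k ^ N := by rw [← mul_pow]; ring
    rw [this]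
    have : C1 ≠ 0 := by positivity
    have : ρ k ^ N ≠ 0 := by positivity
    field_simp
  have hgeo : HasSum (fun k => P * θ * q ^ k) (P * θ * (1 - q)⁻¹) :=
    (hasSum_geometric_of_lt_one hq0.le hq1).mul_left _
  have := hasSum_le hterm hHS hgeo
  nlinarith

end Dat

namespace Dat
variable (D : Dat N)

/-! ### Local data -/

/-- Local geometric data near a point of the closed domain. -/
structure Loc (x0 : Euc N) where
  r : ℝ
  r_pos : 0 < r
  d : Euc N → ℝ
  e : Euc N → Euc N
  Lam : ℝ
  Lam_nonneg : 0 ≤ Lam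
  grad : ∀ x ∈ ball x0 r, HasGradientAt d (e x) x
  e_le : ∀ x ∈ ball x0 r, ‖e x‖ ≤ 2
  e_lip : ∀ x ∈ ball x0 r, ∀ y ∈ ball x0 r, ‖e x - e y‖ ≤ Lam * ‖x - y‖
  nonneg : ∀ x ∈ ball x0 r, x ∈ D.C → 0 ≤ d x
  nonpos : ∀ x ∈ ball x0 r, x ∉ D.C → d x ≤ 0
  bdry : ∀ x ∈ ball x0 r, x ∈ frontier D.Ω → d x = 0 ∧ e x = - D.n x
  Cs : ℝ
  Cs_pos : 0 < Cs
  ξs : ℝ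
  ξs_pos : 0 < ξs
  ξs_le : D.Cj * ξs ≤ r / 4
  slab_le : ∀ x ∈ ball x0 (r / 2), x ∈ D.C → ∀ θ, 0 < θ → θ ≤ 1 →
    ∫ z in D.slab d ξs θ x, ‖z‖ * D.wt z ≤ Cs * θ
  side : x0 ∈ D.Ω → (∀ x, e x = 0) ∧ (∀ x, d x = 1)

lemma loc_interior {x0 : Euc N} (hx0 : x0 ∈ D.Ω) : Nonempty (D.Loc x0) := by
  obtain ⟨r, hr, hsub⟩ := Metric.isOpen_iff.1 D.isOpen_Ω x0 hx0
  have hCj := D.Cj_pos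
  have hξ : D.Cj * min (1/2) (r / 4 / D.Cj) ≤ r / 4 := by
    calc D.Cj * min (1/2) (r / 4 / D.Cj) ≤ D.Cj * (r / 4 / D.Cj) := by gcongr; exact min_le_right _ _
      _ = r / 4 := by field_simp
  refine ⟨⟨r, hr, fun _ => 1, fun _ => 0, 0, le_rfl, fun x _ => ?_, fun x _ => by simp, fun x _ y _ => by simp,
    fun x _ _ => zero_le_one, fun x hx hxC => absurd (D.Ω_sub (hsub hx)) hxC, fun x hx hxb => ?_, 1, one_pos,
    min (1/2) (r / 4 / D.Cj), by positivity, hξ, fun x hx hxC θ hθ hθ1 => ?_, fun _ => ⟨fun _ => rfl, fun _ => rfl⟩⟩⟩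
  · rw [hasGradientAt_iff_hasFDerivAt]; simpa using hasFDerivAt_const (1:ℝ) x
  · rw [frontier_eq] at hxb; exact absurd (hsub hx) hxb.2
  · have : D.slab (fun _ => 1) (min (1/2) (r / 4 / D.Cj)) θ x = ∅ := by
      ext z; simp only [slab, mem_ofPred_eq, mem_empty_iff_false, iff_false, not_and, not_le]
      intro hz
      have hz2 : ‖z‖ < 1/2 := hz.trans_le (min_le_left _ _)
      rw [abs_one]; nlinarith [norm_nonneg z]
    rw [this]; simp; exact hθ.le

lemma loc_boundary {x0 : Euc N} (hx0 : x0 ∈ frontier D.Ω) : Nonempty (D.Loc x0) := by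
  have hCj := D.Cj_pos
  obtain ⟨r0, ψ, ψi, hr0, hψ, ⟨L, hL⟩, -, -, -, hψd⟩ := D.hΩ.2 x0 hx0
  set pr : Euc N →L[ℝ] ℝ := EuclideanSpace.proj (⟨N - 1, Nat.sub_lt D.hN Nat.one_pos⟩ : Fin N) with hpr
  have hfd : ∀ x ∈ ball x0 r0, HasFDerivAt (sdist D.Ω) (pr.comp (fderiv ℝ ψ x)) x := by
    intro x hx
    have h1 : HasFDerivAt ψ (fderiv ℝ ψ x) x :=
      ((hψ.differentiableOn one_ne_zero).differentiableAt (isOpen_ball.mem_nhds hx)).hasFDerivAt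
    have h2 := pr.hasFDerivAt.comp x h1
    refine h2.congr_of_eventuallyEq ?_
    filter_upwards [isOpen_ball.mem_nhds hx] with y hy
    exact (hψd y hy).symm
  let e : Euc N → Euc N := fun x => (InnerProductSpace.toDual ℝ (Euc N)).symm (pr.comp (fderiv ℝ ψ x))
  have hgrad : ∀ x ∈ ball x0 r0, HasGradientAt (sdist D.Ω) (e x) x := by
    intro x hx
    rw [hasGradientAt_iff_hasFDerivAt]
    simpa [e] using hfd x hx
  set Λ : ℝ := ‖pr‖ * L with hΛ
  have hΛ0 : 0 ≤ Λ := by positivity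
  have helip : ∀ x ∈ ball x0 r0, ∀ y ∈ ball x0 r0, ‖e x - e y‖ ≤ Λ * ‖x - y‖ := by
    intro x hx y hy
    have h1 : ‖e x - e y‖ = ‖pr.comp (fderiv ℝ ψ x - fderiv ℝ ψ y)‖ := by
      simp only [e]; rw [← map_sub, LinearIsometryEquiv.norm_map, ContinuousLinearMap.comp_sub]
    rw [h1]
    have h2 := hL.dist_le_mul x hx y hy
    rw [dist_eq_norm, dist_eq_norm] at h2
    calc _ ≤ ‖pr‖ * ‖fderiv ℝ ψ x - fderiv ℝ ψ y‖ := ContinuousLinearMap.opNorm_comp_le _ _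
      _ ≤ ‖pr‖ * (L * ‖x - y‖) := by gcongr
      _ = _ := by ring
  have hen : ∀ x ∈ ball x0 r0, x ∈ frontier D.Ω → e x = - D.n x := fun x hx hxb =>
    (hgrad x hx).unique (D.hn x hxb).2
  set r := min r0 (1 / (2 * (Λ + 1))) with hr
  have hrpos : 0 < r := by positivity
  have hrr0 : ball x0 r ⊆ ball x0 r0 := ball_subset_ball (min_le_left _ _)
  have he0 : ‖e x0‖ = 1 := by rw [hen x0 (mem_ball_self hr0) hx0, norm_neg, (D.hn x0 hx0).1]
  have hclose : ∀ x ∈ ball x0 r, ‖e x - e x0‖ ≤ 1/2 := by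
    intro x hx
    refine (helip x (hrr0 hx) x0 (mem_ball_self hr0)).trans ?_
    have h1 : ‖x - x0‖ ≤ 1 / (2 * (Λ + 1)) := by
      rw [← dist_eq_norm]; exact (mem_ball.1 hx).le.trans (min_le_right _ _)
    calc Λ * ‖x - x0‖ ≤ (Λ + 1) * (1 / (2 * (Λ + 1))) := by gcongr; linarith
      _ = 1/2 := by field_simp
  have hmono : ∀ y ∈ ball x0 r, ∀ t ≥ 0, y + t • e x0 ∈ ball x0 r →
      sdist D.Ω y + t / 2 ≤ sdist D.Ω (y + t • e x0) := by
    intro y hy t ht hyt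
    rcases ht.eq_or_lt with h0 | htp
    · rw [← h0]; simp
    have hseg : ∀ s ∈ Icc 0 t, y + s • e x0 ∈ ball x0 r := by
      intro s hs
      have hc := convex_ball x0 r
      have : y + s • e x0 = (1 - s / t) • y + (s / t) • (y + t • e x0) := by
        rw [smul_add, smul_smul, div_mul_cancel₀ _ htp.ne']; module
      rw [this]
      exact hc hy hyt (by rw [sub_nonneg, div_le_one htp]; exact hs.2) (div_nonneg hs.1 htp.le) (by ring)
    have hder : ∀ s ∈ Icc 0 t, HasDerivAt (fun s => sdist D.Ω (y + s • e x0)) ⟪e (y + s • e x0), e x0⟫ s := by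
      intro s hs
      have h1 := (hasGradientAt_iff_hasFDerivAt.1 (hgrad _ (hrr0 (hseg s hs))))
      have h2 : HasDerivAt (fun s : ℝ => y + s • e x0) (e x0) s := by
        simpa using ((hasDerivAt_id s).smul_const (e x0)).const_add y
      exact h1.comp_hasDerivAt s h2
    obtain ⟨s, hs, hs'⟩ := exists_hasDerivAt_eq_slope (fun s => sdist D.Ω (y + s • e x0))
      (fun s => ⟪e (y + s • e x0), e x0⟫) htp
      (fun s hs => (hder s hs).continuousAt.continuousWithinAt) (fun s hs => hder s (Ioo_subset_Icc_self hs))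
    simp only [zero_smul, add_zero, sub_zero] at hs'
    have hip : (1:ℝ)/2 ≤ ⟪e (y + s • e x0), e x0⟫ := by
      have h1 : ⟪e (y + s • e x0), e x0⟫ = ⟪e (y + s • e x0) - e x0, e x0⟫ + 1 := by
        rw [inner_sub_left, real_inner_self_eq_norm_sq, he0]; ring
      have h2 := abs_le.1 ((abs_real_inner_le_norm (e (y + s • e x0) - e x0) (e x0)))
      rw [he0, mul_one] at h2
      have := hclose _ (hseg s (Ioo_subset_Icc_self hs))
      linarith [h2.1]
    rw [hs', le_div_iff₀ htp] at hip
    linarith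
  set ξ := r / 4 / (D.Cj + 1) with hξ
  have hξp : 0 < ξ := by positivity
  have hξR : (D.Cj + 1) * ξ ≤ r / 4 := by rw [hξ]; apply le_of_eq; field_simp
  obtain ⟨Cs, hCs, hslab⟩ := D.slab_est (d := sdist D.Ω) he0 hξp hξR
  refine ⟨⟨r, hrpos, sdist D.Ω, e, Λ, hΛ0, fun x hx => hgrad x (hrr0 hx), fun x hx => ?_,
    fun x hx y hy => helip x (hrr0 hx) y (hrr0 hy), fun x _ hxC => ?_, fun x _ hxC => ?_, fun x hx hxb => ⟨?_, hen x (hrr0 hx) hxb⟩,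
    Cs, hCs, ξ, hξp, by nlinarith, fun x hx hxC => ?_, fun h => ?_⟩⟩
  · have := norm_add_le (e x - e x0) (e x0)
    rw [sub_add_cancel, he0] at this
    linarith [hclose x hx]
  · unfold sdist
    rw [infDist_zero_of_mem_closure hxC, sub_zero]; exact infDist_nonneg
  · unfold sdist
    rw [infDist_zero_of_mem (show x ∈ D.Ωᶜ from fun h => hxC (D.Ω_sub h))]
    linarith [infDist_nonneg (x := x) (s := D.Ω)]
  · rw [frontier_eq] at hxb
    unfold sdist
    rw [infDist_zero_of_mem_closure hxb.1, infDist_zero_of_mem (show x ∈ D.Ωᶜ from hxb.2), sub_zero]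
  · have hcb : closedBall x (r / 4) ⊆ ball x0 r := by
      intro y hy
      rw [mem_closedBall] at hy; rw [mem_ball] at hx ⊢
      linarith [dist_triangle y x x0]
    refine hslab x hxC (fun y hy => ?_) (fun y hy t ht hyt => hmono y (hcb hy) t ht (hcb hyt))
    exact (hfd y (hrr0 (hcb hy))).continuousAt.continuousWithinAt
  · rw [frontier_eq] at hx0; exact absurd h hx0.2

lemma loc_exists {x0 : Euc N} (hx0 : x0 ∈ D.C) : Nonempty (D.Loc x0) := by
  rcases D.mem_or hx0 with h | h
  · exact D.loc_interior h
  · exact D.loc_boundary h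

variable {D}

namespace Loc
variable {x0 : Euc N} (P : D.Loc x0)

lemma fderiv_at {x : Euc N} (hx : x ∈ ball x0 P.r) :
    HasFDerivAt P.d (InnerProductSpace.toDual ℝ (Euc N) (P.e x)) x :=
  hasGradientAt_iff_hasFDerivAt.1 (P.grad x hx)

lemma e_cont : ContinuousOn P.e (ball x0 P.r) :=
  (LipschitzOnWith.of_dist_le_mul (K := Real.toNNReal P.Lam) fun x hx y hy => by
    rw [dist_eq_norm, dist_eq_norm, Real.coe_toNNReal _ P.Lam_nonneg]; exact P.e_lip x hx y hy).continuousOn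

lemma cd : ContDiffOn ℝ 1 P.d (ball x0 P.r) := by
  rw [show (1 : WithTop ℕ∞) = 0 + 1 by rfl, contDiffOn_succ_iff_fderiv_of_isOpen isOpen_ball]
  refine ⟨fun x hx => (P.fderiv_at hx).differentiableAt.differentiableWithinAt, by simp, ?_⟩
  rw [contDiffOn_zero]
  refine ContinuousOn.congr (f := fun x => InnerProductSpace.toDual ℝ (Euc N) (P.e x)) ?_ (fun x hx => (P.fderiv_at hx).fderiv)
  exact (LinearIsometryEquiv.continuous _).comp_continuousOn P.e_cont

lemma d_lip {x y : Euc N} (hx : x ∈ ball x0 P.r) (hy : y ∈ ball x0 P.r) : |P.d x - P.d y| ≤ 2 * ‖x - y‖ := by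
  have := (convex_ball x0 P.r).norm_image_sub_le_of_norm_hasFDerivWithin_le (f := P.d) (C := 2)
    (fun x hx => (P.fderiv_at hx).hasFDerivWithinAt) (fun x hx => by simpa using P.e_le x hx) hy hx
  simpa using this

/-- increments of increments -/
lemma d_inc {x y x' y' : Euc N} (hx : x ∈ ball x0 (P.r / 4)) (hy : y ∈ ball x0 (P.r / 4))
    (hx' : x' ∈ ball x0 (P.r / 4)) (hy' : y' ∈ ball x0 (P.r / 4)) :
    |(P.d x' - P.d y') - (P.d x - P.d y)| ≤ P.Lam * ‖x' - x‖ * ‖x - y‖ + 2 * ‖(x' - x) - (y' - y)‖ := by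
  have hr := P.r_pos
  have hsub : ball x0 (P.r / 4) ⊆ ball x0 P.r := ball_subset_ball (by linarith)
  set w := y - x with hw
  have hwn : ‖w‖ < P.r / 2 := by
    rw [mem_ball, dist_eq_norm] at hx hy
    have : w = (y - x0) - (x - x0) := by rw [hw]; abel
    rw [this]; refine (norm_sub_le _ _).trans_lt (by linarith)
  have hsh : ∀ z ∈ ball x0 (P.r / 4), z + w ∈ ball x0 P.r := by
    intro z hz
    rw [mem_ball, dist_eq_norm] at hz ⊢
    have : z + w - x0 = (z - x0) + w := by abel
    rw [this]; exact (norm_add_le _ _).trans_lt (by linarith)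
  have h1 := (convex_ball x0 (P.r/4)).norm_image_sub_le_of_norm_hasFDerivWithin_le
    (f := fun z => P.d z - P.d (z + w)) (C := P.Lam * ‖x - y‖)
    (f' := fun z => InnerProductSpace.toDual ℝ (Euc N) (P.e z) - InnerProductSpace.toDual ℝ (Euc N) (P.e (z + w)))
    (fun z hz => by
      have ha := P.fderiv_at (hsub hz)
      have hb := (P.fderiv_at (hsh z hz)).comp z ((hasFDerivAt_id z).add_const w)
      exact (ha.sub hb).hasFDerivWithinAt)
    (fun z hz => by
      rw [← map_sub, LinearIsometryEquiv.norm_map]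
      refine (P.e_lip z (hsub hz) (z + w) (hsh z hz)).trans (le_of_eq ?_)
      have e4 : z - (z + w) = x - y := by rw [hw]; abel
      rw [e4]) hx hx'
  have e1 : x + w = y := by rw [hw]; abel
  simp only [e1, Real.norm_eq_abs] at h1
  have h2 := P.d_lip (hsh x' hx') (hsub hy')
  have e2 : x' + w - y' = (x' - x) - (y' - y) := by rw [hw]; abel
  rw [e2] at h2
  have e3 : (P.d x' - P.d y') - (P.d x - P.d y) =
    ((P.d x' - P.d (x' + w)) - (P.d x - P.d y)) + (P.d (x' + w) - P.d y') := by ring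
  rw [e3]
  refine (abs_add_le _ _).trans (add_le_add (h1.trans (le_of_eq (by ring))) h2)

lemma taylor {x y : Euc N} (hx : x ∈ ball x0 P.r) (hy : y ∈ ball x0 P.r) :
    |P.d y - P.d x - ⟪P.e x, y - x⟫| ≤ P.Lam * ‖x - y‖ * ‖x - y‖ := by
  have hseg : segment ℝ x y ⊆ ball x0 P.r := (convex_ball x0 P.r).segment_subset hx hy
  have h1 := (convex_segment x y).norm_image_sub_le_of_norm_hasFDerivWithin_le
    (f := fun z => P.d z - ⟪P.e x, z⟫) (C := P.Lam * ‖x - y‖)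
    (f' := fun z => InnerProductSpace.toDual ℝ (Euc N) (P.e z) - InnerProductSpace.toDual ℝ (Euc N) (P.e x))
    (fun z hz => ((P.fderiv_at (hseg hz)).sub (InnerProductSpace.toDual ℝ (Euc N) (P.e x)).hasFDerivAt).hasFDerivWithinAt)
    (fun z hz => by
      rw [← map_sub, LinearIsometryEquiv.norm_map]
      refine (P.e_lip z (hseg hz) x hx).trans (mul_le_mul_of_nonneg_left ?_ P.Lam_nonneg)
      obtain ⟨t, ht, rfl⟩ := (segment_eq_image' ℝ x y ▸ hz)
      rw [add_sub_cancel_left, norm_smul, Real.norm_of_nonneg ht.1, norm_sub_rev y x]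
      exact mul_le_of_le_one_left (norm_nonneg _) ht.2)
    (left_mem_segment ℝ x y) (right_mem_segment ℝ x y)
  rw [Real.norm_eq_abs, norm_sub_rev y x] at h1
  have e : P.d y - P.d x - ⟪P.e x, y - x⟫ = P.d y - ⟪P.e x, y⟫ - (P.d x - ⟪P.e x, x⟫) := by
    rw [inner_sub_right]; ring
  rw [e]; exact h1

/-- quadratic exterior-cone property at the boundary -/
lemma n_ge {x y : Euc N} (hx : x ∈ ball x0 P.r) (hy : y ∈ ball x0 P.r) (hxb : x ∈ frontier D.Ω) (hyC : y ∈ D.C) :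
    -(P.Lam * ‖x - y‖ * ‖x - y‖) ≤ ⟪x - y, D.n x⟫ := by
  have h1 := abs_le.1 (P.taylor hx hy)
  obtain ⟨h2, h3⟩ := P.bdry x hx hxb
  have h4 := P.nonneg y hy hyC
  rw [h2, h3, inner_neg_left] at h1
  have e : ⟪D.n x, y - x⟫ = - ⟪x - y, D.n x⟫ := by
    rw [real_inner_comm, ← neg_sub x y, inner_neg_left]
  rw [e] at h1
  linarith [h1.2]

end Loc

end Dat

namespace Dat
variable (D : Dat N)

variable {D}

/-! ### Gap functions and the penalisation -/

/-- A gap function. -/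
structure Gap {x0 : Euc N} (P : D.Loc x0) where
  W : Euc N → Euc N → ℝ
  V : Euc N → Euc N → Euc N
  W_nonneg : ∀ x y, 0 ≤ W x y
  W_symm : ∀ x y, W x y = W y x
  W_le : ∀ x ∈ ball x0 (P.r/4), ∀ y ∈ ball x0 (P.r/4), W x y ≤ 2 * ‖x - y‖
  W_inc : ∀ x ∈ ball x0 (P.r/4), ∀ y ∈ ball x0 (P.r/4), ∀ x' ∈ ball x0 (P.r/4), ∀ y' ∈ ball x0 (P.r/4),
    W x' y' ≤ W x y + (P.Lam * ‖x' - x‖ * ‖x - y‖ + 2 * ‖(x' - x) - (y' - y)‖)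
  W_grad : ∀ x ∈ ball x0 (P.r/4), ∀ y ∈ ball x0 (P.r/4), HasGradientAt (fun x' => W x' y ^ 2) ((2:ℝ) • V x y) x
  W_cd : ∀ y ∈ ball x0 (P.r/4), ContDiffOn ℝ 1 (fun x' => W x' y ^ 2) (ball x0 (P.r/4))
  V_n : ∀ x ∈ ball x0 (P.r/4), ∀ y ∈ ball x0 (P.r/4), x ∈ frontier D.Ω → y ∈ D.C →
    -(P.Lam * W x y * ‖x - y‖) ≤ ⟪V x y, D.n x⟫
  d_le : ∀ x ∈ ball x0 (P.r/4), ∀ y ∈ ball x0 (P.r/4), |P.d x - P.d y| ≤ 2 * W x y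

lemma sqrt_inc {a b s ρ : ℝ} (hb : 0 ≤ b) (hs : 0 ≤ s) (ha : 0 ≤ a) (h : a ≤ b + s) :
    √(a ^ 2 + ρ ^ 2) ≤ √(b ^ 2 + ρ ^ 2) + s := by
  have h0 : b ≤ √(b ^ 2 + ρ ^ 2) := Real.le_sqrt_of_sq_le (by nlinarith [sq_nonneg ρ])
  have h1 := Real.sq_sqrt (show 0 ≤ b ^ 2 + ρ ^ 2 by positivity)
  rw [Real.sqrt_le_left (by positivity)]
  nlinarith

/-- Parameters of the penalisation. -/
structure Par {x0 : Euc N} {P : D.Loc x0} (G : Gap P) where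
  χ : Euc N → ℝ
  L : ℝ
  ε : ℝ
  ρ : ℝ
  K0 : ℝ
  r1 : ℝ
  χ_cd : ContDiff ℝ 1 χ
  L_pos : 0 < L
  χ_lip : ∀ x y, |χ x - χ y| ≤ L * ‖x - y‖
  ε_pos : 0 < ε
  ρ_pos : 0 < ρ
  K0_pos : 0 < K0
  r1_pos : 0 < r1
  r1_le : r1 ≤ P.r / 4
  r1_one : r1 ≤ 1

namespace Par
variable {x0 : Euc N} {P : D.Loc x0} {G : Gap P} (p : Par G)

/-- local part -/
def A (x : Euc N) : ℝ := 1/2 * p.χ x + 1/2 * ‖x - x0‖ ^ 2 - p.L * p.ε * Real.arctan (P.d x / p.ε)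

/-- penalisation -/
def T (x y : Euc N) : ℝ :=
  p.A x + p.A y + ‖x - y‖ ^ 2 / p.ε ^ 2 + p.K0 / p.ε * (√(G.W x y ^ 2 + p.ρ ^ 2) - p.ρ)

/-- lower-order gradient -/
def q (x : Euc N) : Euc N :=
  (1/2 : ℝ) • gradient p.χ x + (x - x0) - (p.L / (1 + (P.d x / p.ε) ^ 2)) • P.e x

/-- full gradient -/
def Pv (x y : Euc N) : Euc N :=
  (2 / p.ε ^ 2) • (x - y) + (p.K0 / p.ε / √(G.W x y ^ 2 + p.ρ ^ 2)) • G.V x y + p.q x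

lemma sub4 : ball x0 (P.r/4) ⊆ ball x0 P.r := ball_subset_ball (by linarith [P.r_pos])
lemma sub1 : ball x0 p.r1 ⊆ ball x0 (P.r/4) := ball_subset_ball p.r1_le

lemma T_symm (x y : Euc N) : p.T x y = p.T y x := by
  unfold T; rw [G.W_symm x y, norm_sub_rev x y]; ring

lemma gradχ_le (x : Euc N) : ‖gradient p.χ x‖ ≤ p.L := by
  unfold gradient
  rw [LinearIsometryEquiv.norm_map]
  have : LipschitzWith (Real.toNNReal p.L) p.χ := LipschitzWith.of_dist_le_mul fun x y => by
    rw [Real.dist_eq, dist_eq_norm, Real.coe_toNNReal _ p.L_pos.le]; exact p.χ_lip x y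
  have h := norm_fderiv_le_of_lipschitz ℝ this (x₀ := x)
  rwa [Real.coe_toNNReal _ p.L_pos.le] at h

lemma q_le {x : Euc N} (hx : x ∈ ball x0 P.r) : ‖p.q x‖ ≤ p.L / 2 + ‖x - x0‖ + 2 * p.L := by
  have hL := p.L_pos
  unfold q
  refine (norm_sub_le _ _).trans (add_le_add ((norm_add_le _ _).trans (add_le_add ?_ le_rfl)) ?_)
  · rw [norm_smul, Real.norm_of_nonneg (by norm_num)]; linarith [p.gradχ_le x]
  · rw [norm_smul, Real.norm_of_nonneg (by positivity)]
    have h1 : p.L / (1 + (P.d x / p.ε) ^ 2) ≤ p.L := div_le_self hL.le (by nlinarith [sq_nonneg (P.d x / p.ε)])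
    calc _ ≤ p.L * 2 := mul_le_mul h1 (P.e_le x hx) (norm_nonneg _) hL.le
      _ = _ := by ring

lemma A_grad {x : Euc N} (hx : x ∈ ball x0 P.r) : HasGradientAt p.A (p.q x) x := by
  have hε := p.ε_pos
  rw [hasGradientAt_iff_hasFDerivAt]
  have h1 : HasFDerivAt p.χ (fderiv ℝ p.χ x) x := (p.χ_cd.differentiable one_ne_zero x).hasFDerivAt
  have h2 : HasFDerivAt (fun x => ‖x - x0‖ ^ 2) (2 • (innerSL ℝ (x - x0))) x := by
    have := ((hasStrictFDerivAt_norm_sq (x - x0)).hasFDerivAt).comp x ((hasFDerivAt_id x).sub_const x0)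
    exact this
  have h3 : HasFDerivAt (fun x => Real.arctan (P.d x / p.ε)) _ x :=
    ((P.fderiv_at hx).mul_const (p.ε⁻¹)).arctan
  have := ((h1.const_mul (1/2)).add (h2.const_mul (1/2))).sub (h3.const_mul (p.L * p.ε))
  refine this.congr_fderiv ?_
  ext v
  have hg : ⟪gradient p.χ x, v⟫ = fderiv ℝ p.χ x v := by
    unfold gradient; rw [InnerProductSpace.toDual_symm_apply]
  simp only [q, map_sub, map_add, map_smul, _root_.sub_apply, _root_.add_apply,
    _root_.smul_apply, InnerProductSpace.toDual_apply_apply, hg, smul_eq_mul, innerSL_apply_apply]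
  have : (1 + (P.d x / p.ε) ^ 2) ≠ 0 := by positivity
  simp only [← div_eq_mul_inv]
  field_simp
  simp only [nsmul_eq_mul]
  push_cast
  ring

lemma A_cd : ContDiffOn ℝ 1 p.A (ball x0 P.r) := by
  unfold A
  refine ContDiffOn.sub (ContDiffOn.add ?_ ?_) ?_
  · exact (contDiff_const.mul p.χ_cd).contDiffOn
  · exact (contDiff_const.mul ((contDiff_id.sub contDiff_const).norm_sq ℝ)).contDiffOn
  · exact contDiffOn_const.mul (Real.contDiff_arctan.comp_contDiffOn (P.cd.div_const _))

lemma T_grad {x y : Euc N} (hx : x ∈ ball x0 (P.r/4)) (hy : y ∈ ball x0 (P.r/4)) :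
    HasGradientAt (fun x' => p.T x' y) (p.Pv x y) x := by
  have hε := p.ε_pos
  have hρ := p.ρ_pos
  rw [hasGradientAt_iff_hasFDerivAt]
  have h1 := hasGradientAt_iff_hasFDerivAt.1 (p.A_grad (sub4 hx))
  have h2 : HasFDerivAt (fun x => ‖x - y‖ ^ 2) (2 • (innerSL ℝ (x - y))) x := by
    have := ((hasStrictFDerivAt_norm_sq (x - y)).hasFDerivAt).comp x ((hasFDerivAt_id x).sub_const y)
    exact this
  have h3 := hasGradientAt_iff_hasFDerivAt.1 (G.W_grad x hx y hy)
  have h4 := (h3.add_const (p.ρ ^ 2)).sqrt (by positivity)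
  have := ((h1.add_const (p.A y)).add (h2.mul_const ((p.ε ^ 2)⁻¹))).add ((h4.sub_const p.ρ).const_mul (p.K0 / p.ε))
  refine this.congr_fderiv ?_
  ext v
  have hs : √(G.W x y ^ 2 + p.ρ ^ 2) ≠ 0 := by positivity
  simp only [Pv, map_add, map_smul, _root_.add_apply,
    _root_.smul_apply, InnerProductSpace.toDual_apply_apply, smul_eq_mul, innerSL_apply_apply, nsmul_eq_mul]
  field_simp
  push_cast
  ring

lemma T_cd {y : Euc N} (hy : y ∈ ball x0 (P.r/4)) : ContDiffOn ℝ 1 (fun x' => p.T x' y) (ball x0 (P.r/4)) := by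
  have hρ := p.ρ_pos
  unfold T
  refine ContDiffOn.add (ContDiffOn.add ((p.A_cd.mono sub4).add contDiffOn_const) ?_) ?_
  · exact ((contDiff_id.sub contDiff_const).norm_sq ℝ).contDiffOn.div_const _
  · refine contDiffOn_const.mul (ContDiffOn.sub ?_ contDiffOn_const)
    exact ((G.W_cd y hy).add contDiffOn_const).sqrt (fun x _ => by positivity)

lemma A_lip {x y : Euc N} (hx : x ∈ ball x0 p.r1) (hy : y ∈ ball x0 p.r1) :
    |p.A x - p.A y| ≤ (3 * p.L + 1) * ‖x - y‖ := by
  have h1 := (convex_ball x0 p.r1).norm_image_sub_le_of_norm_hasFDerivWithin_le (f := p.A) (C := 3 * p.L + 1)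
    (fun z hz => (hasGradientAt_iff_hasFDerivAt.1 (p.A_grad (sub4 (p.sub1 hz)))).hasFDerivWithinAt)
    (fun z hz => by
      rw [LinearIsometryEquiv.norm_map]
      refine (p.q_le (sub4 (p.sub1 hz))).trans ?_
      rw [mem_ball, dist_eq_norm] at hz
      linarith [p.r1_one, p.L_pos]) hy hx
  simpa using h1

lemma W_term {a b s : ℝ} (ha : 0 ≤ a) (hb : 0 ≤ b) (hs : 0 ≤ s) (h : a ≤ b + s) :
    p.K0 / p.ε * (√(a ^ 2 + p.ρ ^ 2) - p.ρ) ≤ p.K0 / p.ε * (√(b ^ 2 + p.ρ ^ 2) - p.ρ) + p.K0 / p.ε * s := by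
  have hε := p.ε_pos
  have hK := p.K0_pos
  have := sqrt_inc (ρ := p.ρ) hb hs ha h
  rw [← mul_add]
  exact mul_le_mul_of_nonneg_left (by linarith) (by positivity)

lemma T_one {x y x' : Euc N} (hx : x ∈ ball x0 p.r1) (hy : y ∈ ball x0 p.r1) (hx' : x' ∈ ball x0 p.r1) :
    p.T x' y - p.T x y ≤ (3 * p.L + 1 + (2 * ‖x - y‖ + ‖x' - x‖) / p.ε ^ 2 + p.K0 / p.ε * (2 * P.Lam + 2)) * ‖x' - x‖ := by
  have hε := p.ε_pos
  have hΛ := P.Lam_nonneg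
  have h1 := (le_abs_self _).trans (p.A_lip hx' hx)
  have hxy : ‖x - y‖ ≤ 2 := by
    rw [mem_ball, dist_eq_norm] at hx hy
    have : x - y = (x - x0) - (y - x0) := by abel
    rw [this]; exact (norm_sub_le _ _).trans (by linarith [p.r1_one])
  have h2 := G.W_inc x (p.sub1 hx) y (p.sub1 hy) x' (p.sub1 hx') y (p.sub1 hy)
  rw [sub_self, sub_zero] at h2
  have h3 : G.W x' y ≤ G.W x y + (2 * P.Lam + 2) * ‖x' - x‖ := by
    have : P.Lam * ‖x' - x‖ * ‖x - y‖ ≤ P.Lam * ‖x' - x‖ * 2 := by gcongr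
    linarith
  have h4 := p.W_term (G.W_nonneg x' y) (G.W_nonneg x y) (by positivity) h3
  have h5 : ‖x' - y‖ ^ 2 - ‖x - y‖ ^ 2 ≤ (2 * ‖x - y‖ + ‖x' - x‖) * ‖x' - x‖ := by
    have : x' - y = (x' - x) + (x - y) := by abel
    have h := norm_add_le (x' - x) (x - y)
    rw [← this] at h
    nlinarith [norm_nonneg (x' - y), norm_nonneg (x - y), norm_nonneg (x' - x)]
  have h6 : ‖x' - y‖ ^ 2 / p.ε ^ 2 - ‖x - y‖ ^ 2 / p.ε ^ 2 ≤ (2 * ‖x - y‖ + ‖x' - x‖) / p.ε ^ 2 * ‖x' - x‖ := by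
    rw [← sub_div, div_mul_eq_mul_div]; gcongr
  unfold T
  linarith

lemma T_two {x y x' y' : Euc N} (hx : x ∈ ball x0 p.r1) (hy : y ∈ ball x0 p.r1) (hx' : x' ∈ ball x0 p.r1)
    (hy' : y' ∈ ball x0 p.r1) {s : ℝ} (hs : ‖(x' - x) - (y' - y)‖ ≤ s) :
    p.T x' y' - p.T x y ≤ (3 * p.L + 1) * (‖x' - x‖ + ‖y' - y‖) + (2 * ‖x - y‖ * s + s ^ 2) / p.ε ^ 2
      + p.K0 / p.ε * (P.Lam * ‖x' - x‖ * ‖x - y‖ + 2 * s) := by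
  have hε := p.ε_pos
  have hΛ := P.Lam_nonneg
  have hs0 : 0 ≤ s := (norm_nonneg _).trans hs
  have h1 := (le_abs_self _).trans (p.A_lip hx' hx)
  have h1' := (le_abs_self _).trans (p.A_lip hy' hy)
  have h2 := G.W_inc x (p.sub1 hx) y (p.sub1 hy) x' (p.sub1 hx') y' (p.sub1 hy')
  have h3 : G.W x' y' ≤ G.W x y + (P.Lam * ‖x' - x‖ * ‖x - y‖ + 2 * s) := by linarith
  have h4 := p.W_term (G.W_nonneg x' y') (G.W_nonneg x y) (by positivity) h3
  have h5 : ‖x' - y'‖ ^ 2 - ‖x - y‖ ^ 2 ≤ 2 * ‖x - y‖ * s + s ^ 2 := by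
    have : x' - y' = ((x' - x) - (y' - y)) + (x - y) := by abel
    have h := norm_add_le ((x' - x) - (y' - y)) (x - y)
    rw [← this] at h
    nlinarith [norm_nonneg (x' - y'), norm_nonneg (x - y), norm_nonneg ((x' - x) - (y' - y))]
  have h6 : ‖x' - y'‖ ^ 2 / p.ε ^ 2 - ‖x - y‖ ^ 2 / p.ε ^ 2 ≤ (2 * ‖x - y‖ * s + s ^ 2) / p.ε ^ 2 := by
    rw [← sub_div]; gcongr
  unfold T
  linarith

end Par

end Dat

namespace Dat
variable (D : Dat N)

variable {D}

namespace Par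
variable {x0 : Euc N} {P : D.Loc x0} {G : Gap P} (p : Par G)

/-- the gradient inequality at the boundary -/
lemma Pv_n {x y : Euc N} (hx : x ∈ ball x0 p.r1) (hy : y ∈ ball x0 p.r1) (hxb : x ∈ frontier D.Ω) (hyC : y ∈ D.C)
    (hsm : 2 * P.Lam * ‖x - y‖ ^ 2 / p.ε ^ 2 + p.K0 * P.Lam * ‖x - y‖ / p.ε + ‖x - x0‖ < p.L / 2) :
    0 < ⟪p.Pv x y, D.n x⟫ := by
  have hε := p.ε_pos
  have hρ := p.ρ_pos
  have hK := p.K0_pos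
  have hΛ := P.Lam_nonneg
  have hn := (D.hn x hxb).1
  have hx4 := p.sub1 hx
  have hy4 := p.sub1 hy
  obtain ⟨hd, he⟩ := P.bdry x (sub4 hx4) hxb
  have h1 := P.n_ge (sub4 hx4) (sub4 hy4) hxb hyC
  have h2 := G.V_n x hx4 y hy4 hxb hyC
  have h3 := abs_le.1 (abs_real_inner_le_norm (gradient p.χ x) (D.n x))
  have h4 := abs_le.1 (abs_real_inner_le_norm (x - x0) (D.n x))
  rw [hn, mul_one] at h3 h4
  have h5 := p.gradχ_le x
  set ϑ := √(G.W x y ^ 2 + p.ρ ^ 2) with hϑ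
  have hϑp : 0 < ϑ := by positivity
  have hWϑ : G.W x y ≤ ϑ := Real.le_sqrt_of_sq_le (by nlinarith [sq_nonneg p.ρ])
  have h6 : -(2 * P.Lam * ‖x - y‖ ^ 2 / p.ε ^ 2) ≤ 2 / p.ε ^ 2 * ⟪x - y, D.n x⟫ := by
    calc _ = 2 / p.ε ^ 2 * (-(P.Lam * ‖x - y‖ * ‖x - y‖)) := by ring
      _ ≤ _ := mul_le_mul_of_nonneg_left h1 (by positivity)
  have h7 : -(p.K0 * P.Lam * ‖x - y‖ / p.ε) ≤ p.K0 / p.ε / ϑ * ⟪G.V x y, D.n x⟫ := by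
    have a1 : P.Lam * G.W x y * ‖x - y‖ ≤ P.Lam * ϑ * ‖x - y‖ := by gcongr
    calc _ = p.K0 / p.ε / ϑ * (-(P.Lam * ϑ * ‖x - y‖)) := by field_simp
      _ ≤ _ := mul_le_mul_of_nonneg_left (by linarith) (by positivity)
  have e1 : ⟪p.Pv x y, D.n x⟫ = 2 / p.ε ^ 2 * ⟪x - y, D.n x⟫ + p.K0 / p.ε / ϑ * ⟪G.V x y, D.n x⟫
      + (1/2 * ⟪gradient p.χ x, D.n x⟫ + ⟪x - x0, D.n x⟫ + p.L) := by
    unfold Pv q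
    rw [he, hd]
    simp only [inner_add_left, inner_sub_left, inner_smul_left, inner_neg_left, real_inner_self_eq_norm_sq, hn, smul_neg,
      conj_trivial]
    rw [← hϑ]
    simp
  rw [e1]
  linarith [h3.1, h4.1]

/-- One-sided information at a maximum point. -/
lemma half {H : Euc N → Euc N → ℝ} {u : Euc N → ℝ} {x y : Euc N} (hw : D.WSub H u)
    (hxC : x ∈ D.C) (hyC : y ∈ D.C) (hx : x ∈ ball x0 p.r1) (hy : y ∈ ball x0 p.r1)
    (hmax : ∀ x' ∈ ball x0 p.r1, x' ∈ D.C → u x' - p.T x' y ≤ u x - p.T x y)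
    (hsm : 2 * P.Lam * ‖x - y‖ ^ 2 / p.ε ^ 2 + p.K0 * P.Lam * ‖x - y‖ / p.ε + ‖x - x0‖ < p.L / 2) :
    D.EqSub H u x (p.Pv x y) := by
  obtain ⟨ρ, hρ, hsub⟩ := Metric.isOpen_iff.1 isOpen_ball x hx
  have hg := (p.T_grad (p.sub1 hx) (p.sub1 hy)).gradient
  have := hw x hxC ρ hρ (fun x' => p.T x' y) ((p.T_cd (p.sub1 hy)).mono (hsub.trans p.sub1))
    (fun x' hx' hC => hmax x' (hsub hx') hC)
  rw [hg] at this
  rcases this with ⟨hb, hle⟩ | h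
  · exact absurd hle (not_le.2 (p.Pv_n hx hy hb hyC hsm))
  · exact h

/-- The constant in the increments. -/
def CB (M C2 : ℝ) : ℝ := D.Cj * (3 * p.L + 1 + (2 * C2 + 1) + p.K0 * (2 * P.Lam + 2) + 2 * M)

lemma CB_pos {M C2 : ℝ} (hM : 0 ≤ M) (hC2 : 0 ≤ C2) : 0 < p.CB M C2 := by
  have := D.Cj_pos; have := p.L_pos; have := P.Lam_nonneg; have := p.K0_pos
  unfold CB; positivity

lemma incr {u : Euc N → ℝ} {M C2 : ℝ} {x y : Euc N} (hu : D.Bd u M)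
    (hxC : x ∈ D.C) (hx : x ∈ ball x0 (p.r1/2)) (hy : y ∈ ball x0 p.r1)
    (hC2 : 0 ≤ C2) (hε1 : p.ε ≤ 1) (hεr : p.ε ≤ p.r1 / 2)
    (hxy : ‖x - y‖ ≤ C2 * p.ε)
    (hmax : ∀ x' ∈ ball x0 p.r1, x' ∈ D.C → u x' - p.T x' y ≤ u x - p.T x y) :
    ∀ z, x + D.j x z ∈ D.C → u (x + D.j x z) - u x ≤ p.CB M C2 / p.ε * ‖z‖ := by
  have hM := hu.nonneg hxC
  have hε := p.ε_pos
  have hL := p.L_pos; have hΛ := P.Lam_nonneg; have hK := p.K0_pos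
  have hCj := D.Cj_pos
  intro z hz
  have hj := D.j_le hxC z
  set h := D.j x z with hh
  have key : u (x + h) - u x ≤ (3 * p.L + 1 + (2 * C2 + 1) + p.K0 * (2 * P.Lam + 2) + 2 * M) / p.ε * ‖h‖ := by
    by_cases hle : ‖h‖ ≤ p.ε
    · have hmem : x + h ∈ ball x0 p.r1 := by
        rw [mem_ball, dist_eq_norm] at hx ⊢
        have : x + h - x0 = (x - x0) + h := by abel
        rw [this]; exact (norm_add_le _ _).trans_lt (by linarith)
      have hx1 : x ∈ ball x0 p.r1 := ball_subset_ball (by linarith [p.r1_pos]) hx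
      have h1 := hmax _ hmem hz
      have h2 := p.T_one hx1 hy hmem
      rw [add_sub_cancel_left] at h2
      have h3 : 3 * p.L + 1 + (2 * ‖x - y‖ + ‖h‖) / p.ε ^ 2 + p.K0 / p.ε * (2 * P.Lam + 2) ≤
          (3 * p.L + 1 + (2 * C2 + 1) + p.K0 * (2 * P.Lam + 2) + 2 * M) / p.ε := by
        have a1 : (2 * ‖x - y‖ + ‖h‖) / p.ε ^ 2 ≤ (2 * C2 + 1) / p.ε := by
          calc (2 * ‖x - y‖ + ‖h‖) / p.ε ^ 2 ≤ (2 * (C2 * p.ε) + p.ε) / p.ε ^ 2 := by gcongr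
            _ = _ := by field_simp
        have a2 : 3 * p.L + 1 ≤ (3 * p.L + 1) / p.ε := by
          rw [le_div_iff₀ hε]; nlinarith
        have a3 : 0 ≤ 2 * M / p.ε := by positivity
        have e : (3 * p.L + 1 + (2 * C2 + 1) + p.K0 * (2 * P.Lam + 2) + 2 * M) / p.ε =
          (3 * p.L + 1) / p.ε + (2 * C2 + 1) / p.ε + p.K0 / p.ε * (2 * P.Lam + 2) + 2 * M / p.ε := by ring
        rw [e]; linarith
      have := mul_le_mul_of_nonneg_right h3 (norm_nonneg h)
      linarith
    · push Not at hle
      have b1 := abs_le.1 (hu _ hz)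
      have b2 := abs_le.1 (hu _ hxC)
      have b3 : 2 * M ≤ 2 * M / p.ε * ‖h‖ := by
        rw [div_mul_eq_mul_div, le_div_iff₀ hε]; gcongr
      have b4 : 2 * M / p.ε * ‖h‖ ≤ (3 * p.L + 1 + (2 * C2 + 1) + p.K0 * (2 * P.Lam + 2) + 2 * M) / p.ε * ‖h‖ := by
        gcongr
        have : 0 ≤ p.K0 * (2 * P.Lam + 2) := by positivity
        linarith
      linarith [b1.2, b2.1]
  refine key.trans ?_
  unfold CB
  calc _ ≤ (3 * p.L + 1 + (2 * C2 + 1) + p.K0 * (2 * P.Lam + 2) + 2 * M) / p.ε * (D.Cj * ‖z‖) := by gcongr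
    _ = _ := by ring

end Par

lemma H_bound {H : Euc N → Euc N → ℝ} {u : Euc N → ℝ} {M B : ℝ} {x q : Euc N} (hu : D.Bd u M) (hum : D.Mes u)
    (hxC : x ∈ D.C) (hB : 0 < B) (hinc : ∀ z, x + D.j x z ∈ D.C → u (x + D.j x z) - u x ≤ B * ‖z‖)
    (he : D.EqSub H u x q) : H x q ≤ 1 + M + D.Cμ * (D.kA (2 * M) * B ^ D.σ) := by
  have hM := hu.nonneg hxC
  obtain ⟨ξ0, hξ0, h⟩ := he 1 one_pos
  have h1 := h (ξ0/2) (by linarith) (by linarith)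
  have h2 := J_le_min hxC (c := u x) (ξ := ξ0/2) (by linarith) hu hum (show 0 ≤ 2 * M by linarith) hB (fun z hz => by
    have b1 := abs_le.1 (hu _ hz)
    have b2 := abs_le.1 (hu _ hxC)
    linarith [b1.2, b2.1]) hinc
  have b2 := abs_le.1 (hu _ hxC)
  linarith [b2.1]

end Dat

namespace Dat
variable (D : Dat N)

variable {D}

/-! ### Combined near estimate -/

namespace Par
variable {x0 : Euc N} {P : D.Loc x0} {G : Gap P} (p : Par G)

/-- the constant of the joint increments -/
def cc (C2 : ℝ) : ℝ :=
  (3 * p.L + 1) * (2 * D.Cj) + C2 ^ 2 * (2 * D.Dj + D.Dj ^ 2) + p.K0 * C2 * (P.Lam * D.Cj + 2 * D.Dj)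

lemma cc_nonneg {C2 : ℝ} (hC2 : 0 ≤ C2) : 0 ≤ p.cc C2 := by
  have := D.Cj_pos; have := D.Dj_pos; have := p.L_pos; have := P.Lam_nonneg; have := p.K0_pos
  unfold cc; positivity

/-- slope for the mismatch region -/
def th (t : ℝ) : ℝ := 2 * p.ε ^ 2 + (2 * P.Lam * D.Cj + 4 * D.Dj) * t

lemma land_mem {x z : Euc N} {ξ0 : ℝ} (hxC : x ∈ D.C) (hx : x ∈ ball x0 (p.r1/2)) (hξr : D.Cj * ξ0 ≤ p.r1 / 2)
    (hz : ‖z‖ < ξ0) : x + D.j x z ∈ ball x0 p.r1 := by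
  have := D.j_le hxC z
  have : D.Cj * ‖z‖ ≤ D.Cj * ξ0 := by have := D.Cj_pos; gcongr
  rw [mem_ball, dist_eq_norm] at hx ⊢
  have e : x + D.j x z - x0 = (x - x0) + D.j x z := by abel
  rw [e]; exact (norm_add_le _ _).trans_lt (by linarith)

lemma pair_T {x y z : Euc N} {C2 ξ0 : ℝ} (hC2 : 0 ≤ C2)
    (hxC : x ∈ D.C) (hyC : y ∈ D.C) (hx : x ∈ ball x0 (p.r1/2)) (hy : y ∈ ball x0 (p.r1/2))
    (hxy : ‖x - y‖ ≤ C2 * p.ε) (hξr : D.Cj * ξ0 ≤ p.r1 / 2) (hξ1 : ξ0 ≤ 1) (hz : ‖z‖ < ξ0) :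
    p.T (x + D.j x z) (y + D.j y z) - p.T x y ≤ p.cc C2 * ‖z‖ := by
  have hr := p.r1_pos
  have hε := p.ε_pos
  have := D.Cj_pos; have hDj := D.Dj_pos; have hL := p.L_pos; have hΛ := P.Lam_nonneg; have hK := p.K0_pos
  have hs : ‖(x + D.j x z - x) - (y + D.j y z - y)‖ ≤ D.Dj * ‖z‖ * ‖x - y‖ := by
    rw [add_sub_cancel_left, add_sub_cancel_left]; exact D.j_diff hxC hyC z
  have hb : ball x0 (p.r1/2) ⊆ ball x0 p.r1 := ball_subset_ball (by linarith)
  have h := p.T_two (hb hx) (hb hy) (p.land_mem hxC hx hξr hz) (p.land_mem hyC hy hξr hz) hs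
  rw [add_sub_cancel_left, add_sub_cancel_left] at h
  have j1 := D.j_le hxC z
  have j2 := D.j_le hyC z
  have hz0 := norm_nonneg z
  have hxy' : ‖x - y‖ / p.ε ≤ C2 := by rwa [div_le_iff₀ hε]
  have hxy0 : 0 ≤ ‖x - y‖ / p.ε := by positivity
  have h1 : (3 * p.L + 1) * (‖D.j x z‖ + ‖D.j y z‖) ≤ (3 * p.L + 1) * (2 * D.Cj) * ‖z‖ := by
    rw [mul_assoc]; gcongr; linarith
  have h2 : (2 * ‖x - y‖ * (D.Dj * ‖z‖ * ‖x - y‖) + (D.Dj * ‖z‖ * ‖x - y‖) ^ 2) / p.ε ^ 2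
      ≤ C2 ^ 2 * (2 * D.Dj + D.Dj ^ 2) * ‖z‖ := by
    have e : (2 * ‖x - y‖ * (D.Dj * ‖z‖ * ‖x - y‖) + (D.Dj * ‖z‖ * ‖x - y‖) ^ 2) / p.ε ^ 2
      = (‖x - y‖ / p.ε) ^ 2 * (2 * D.Dj + D.Dj ^ 2 * ‖z‖) * ‖z‖ := by field_simp
    rw [e]
    have : D.Dj ^ 2 * ‖z‖ ≤ D.Dj ^ 2 := mul_le_of_le_one_right (by positivity) (by linarith)
    gcongr
  have h3 : p.K0 / p.ε * (P.Lam * ‖D.j x z‖ * ‖x - y‖ + 2 * (D.Dj * ‖z‖ * ‖x - y‖))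
      ≤ p.K0 * C2 * (P.Lam * D.Cj + 2 * D.Dj) * ‖z‖ := by
    calc _ ≤ p.K0 / p.ε * (P.Lam * (D.Cj * ‖z‖) * ‖x - y‖ + 2 * (D.Dj * ‖z‖ * ‖x - y‖)) := by gcongr
      _ = p.K0 * (‖x - y‖ / p.ε) * (P.Lam * D.Cj + 2 * D.Dj) * ‖z‖ := by field_simp
      _ ≤ _ := by gcongr
  unfold cc
  linarith

lemma mismatch {x y z : Euc N} {ξ0 rr : ℝ}
    (hxC : x ∈ D.C) (hyC : y ∈ D.C) (hx : x ∈ ball x0 (p.r1/2)) (hy : y ∈ ball x0 (p.r1/2))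
    (hξr : D.Cj * ξ0 ≤ p.r1 / 2) (hz : ‖z‖ < ξ0) (hW : G.W x y ≤ p.ε ^ 2 * rr) (hrz : rr ≤ ‖z‖)
    (hm : (x + D.j x z ∈ D.C ∧ y + D.j y z ∉ D.C) ∨ (x + D.j x z ∉ D.C ∧ y + D.j y z ∈ D.C)) :
    |P.d (x + D.j x z)| ≤ p.th ‖x - y‖ * ‖z‖ := by
  have hr := p.r1_pos
  have := D.Cj_pos; have hDj := D.Dj_pos; have hΛ := P.Lam_nonneg
  have hb : ball x0 (p.r1/2) ⊆ ball x0 p.r1 := ball_subset_ball (by linarith)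
  have hx' := p.sub1 (p.land_mem hxC hx hξr hz)
  have hy' := p.sub1 (p.land_mem hyC hy hξr hz)
  have hs : ‖(x + D.j x z - x) - (y + D.j y z - y)‖ ≤ D.Dj * ‖z‖ * ‖x - y‖ := by
    rw [add_sub_cancel_left, add_sub_cancel_left]; exact D.j_diff hxC hyC z
  have h1 := G.d_le _ hx' _ hy'
  have h2 := G.W_inc x (p.sub1 (hb hx)) y (p.sub1 (hb hy)) _ hx' _ hy'
  rw [add_sub_cancel_left x] at h2
  rw [add_sub_cancel_left x] at hs
  have j1 := D.j_le hxC z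
  have h3 : P.Lam * ‖D.j x z‖ * ‖x - y‖ ≤ P.Lam * (D.Cj * ‖z‖) * ‖x - y‖ := by gcongr
  have h4 : p.ε ^ 2 * rr ≤ p.ε ^ 2 * ‖z‖ := by gcongr
  have h5 : |P.d (x + D.j x z)| ≤ |P.d (x + D.j x z) - P.d (y + D.j y z)| := by
    rcases hm with ⟨a, b⟩ | ⟨a, b⟩
    · have := P.nonneg _ (sub4 hx') a
      have := P.nonpos _ (sub4 hy') b
      rw [abs_of_nonneg (by assumption), abs_of_nonneg (by linarith)]; linarith
    · have := P.nonpos _ (sub4 hx') a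
      have := P.nonneg _ (sub4 hy') b
      rw [abs_of_nonpos (by assumption), abs_of_nonpos (by linarith)]; linarith
  unfold th
  nlinarith

lemma two_g {a b gx gy t c B δ : ℝ} (hgx : 0 ≤ gx) (hgy : 0 ≤ gy) (hgx' : gx ≤ t) (hc : 0 ≤ c) (hB : 0 ≤ B)
    (hgy' : gy ≤ t) (hd : |gx - gy| ≤ δ) (hab : a + b ≤ c) (ha : a ≤ B) (hb : b ≤ B) :
    a * gx + b * gy ≤ c * t + B * δ := by
  have h := abs_le.1 hd
  have h0 : 0 ≤ δ := (abs_nonneg _).trans hd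
  rcases le_total gx gy with h1 | h1
  · have e : a * gx + b * gy = (a + b) * gx + b * (gy - gx) := by ring
    have i1 : (a + b) * gx ≤ c * t := mul_le_mul hab hgx' hgx hc
    have i2 : b * (gy - gx) ≤ B * δ := mul_le_mul hb (by linarith) (by linarith) hB
    linarith
  · have e : a * gx + b * gy = (a + b) * gy + a * (gx - gy) := by ring
    have i1 : (a + b) * gy ≤ c * t := mul_le_mul hab hgy' hgy hc
    have i2 : a * (gx - gy) ≤ B * δ := mul_le_mul ha (by linarith) (by linarith) hB
    linarith

lemma pair_near {u1 u2 : Euc N → ℝ} {M1 M2 C2 B ξ ξ0 rr : ℝ} {x y : Euc N}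
    (hu1 : D.Bd u1 M1) (hm1 : D.Mes u1) (hu2 : D.Bd u2 M2) (hm2 : D.Mes u2) (hC2 : 0 ≤ C2) (hB : 0 ≤ B)
    (hxC : x ∈ D.C) (hyC : y ∈ D.C) (hx : x ∈ ball x0 (p.r1/2)) (hy : y ∈ ball x0 (p.r1/2))
    (hxy : ‖x - y‖ ≤ C2 * p.ε) (hξr : D.Cj * ξ0 ≤ p.r1 / 2) (hξ1 : ξ0 ≤ 1) (hξs : ξ0 ≤ P.ξs)
    (hξ : 0 < ξ) (hξ0 : ξ ≤ ξ0) (hrr : 0 < rr) (hW : G.W x y ≤ p.ε ^ 2 * rr)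
    (hth : p.th ‖x - y‖ ≤ 1)
    (hmax : ∀ x' ∈ ball x0 p.r1, x' ∈ D.C → ∀ y' ∈ ball x0 p.r1, y' ∈ D.C →
      u1 x' + u2 y' - p.T x' y' ≤ u1 x + u2 y - p.T x y)
    (hi1 : ∀ z, x + D.j x z ∈ D.C → u1 (x + D.j x z) - u1 x ≤ B * ‖z‖)
    (hi2 : ∀ z, y + D.j y z ∈ D.C → u2 (y + D.j y z) - u2 y ≤ B * ‖z‖) :
    D.J ξ u1 (u1 x) x + D.J ξ u2 (u2 y) y ≤
      (p.cc C2 * D.Cμ + B * D.Dμ * ‖x - y‖) * D.kn ξ0 + B * D.Cμ * D.kn rr + B * D.Cμ * (P.Cs * p.th ‖x - y‖)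
      + (D.J ξ0 u1 (u1 x) x + D.J ξ0 u2 (u2 y) y) := by
  have hξ0' : 0 < ξ0 := hξ.trans_le hξ0
  have hε := p.ε_pos
  have hCμ := D.Cμ_pos
  have hDμ := D.Dμ_pos
  have hcc := p.cc_nonneg hC2
  have hr := p.r1_pos
  have hPr := P.r_pos
  have := D.Cj_pos; have hDj := D.Dj_pos; have hΛ := P.Lam_nonneg
  have hth0 : 0 < p.th ‖x - y‖ := by unfold th; positivity
  set θ := p.th ‖x - y‖ with hθ
  set S := D.slab P.d P.ξs θ x with hS
  have hb : ball x0 (p.r1/2) ⊆ ball x0 (P.r/2) := ball_subset_ball (by linarith [p.r1_le])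
  have hSm : MeasurableSet S := by
    refine D.slab_meas (R := P.r/2) hxC (P.cd.continuousOn.mono ?_) (by linarith [P.ξs_le])
    intro y hy
    have := hb hx
    rw [mem_ball] at *
    linarith [dist_triangle y x x0]
  have hSn : S ⊆ nr P.ξs := fun z hz => hz.1
  have hsplit : fr (N := N) ξ = (fr ξ ∩ nr ξ0) ∪ fr ξ0 := by
    ext z; simp only [fr, nr, mem_union, mem_inter_iff, mem_ofPred_eq]
    constructor
    · intro h; rcases lt_or_ge ‖z‖ ξ0 with h1 | h1
      · exact Or.inl ⟨h, h1⟩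
      · exact Or.inr h1
    · rintro (h | h)
      · exact h.1
      · exact hξ0.trans h
  have hdisj : Disjoint (fr ξ ∩ nr (N := N) ξ0) (fr ξ0) := by
    rw [← compl_fr]; exact disjoint_compl_left.mono_left inter_subset_right
  have hK1 := K_int hxC hu1 hm1 (u1 x) hξ
  have hK2 := K_int hyC hu2 hm2 (u2 y) hξ
  set T := fr (N := N) ξ ∩ nr ξ0 with hT
  have hTm : MeasurableSet T := (fr_meas _).inter (nr_meas _)
  have hK1' : IntegrableOn (D.K u1 (u1 x) x) T := hK1.mono_set inter_subset_left
  have hK2' : IntegrableOn (D.K u2 (u2 y) y) T := hK2.mono_set inter_subset_left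
  set c' := p.cc C2 * D.Cμ + B * D.Dμ * ‖x - y‖ with hc'
  have hc0 : 0 ≤ c' := by positivity
  set f0 : Euc N → ℝ := fun z => c' * (‖z‖ * D.wt z) with hf0
  set f1 : Euc N → ℝ := fun z => B * D.Cμ * (‖z‖ * D.wt z) with hf1
  have hw : ∀ z : Euc N, 0 ≤ ‖z‖ * D.wt z := fun z => mul_nonneg (norm_nonneg _) (D.wt_nonneg z)
  have hf0n : ∀ z, 0 ≤ f0 z := fun z => mul_nonneg hc0 (hw z)
  have hf1n : ∀ z, 0 ≤ f1 z := fun z => mul_nonneg (by positivity) (hw z)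
  have hI0 : ∀ {t : ℝ}, 0 < t → IntegrableOn f0 (nr t) := fun ht => (D.wt_near ht).const_mul _
  have hI1 : ∀ {t : ℝ}, 0 < t → IntegrableOn f1 (nr t) := fun ht => (D.wt_near ht).const_mul _
  have hT1 : IntegrableOn f1 T := (hI1 hξ0').mono_set inter_subset_right
  have hpt : ∀ z ∈ T, D.K u1 (u1 x) x z + D.K u2 (u2 y) y z ≤
      f0 z + (nr rr).indicator f1 z + S.indicator f1 z := by
    intro z hz
    have hz0 : ‖z‖ < ξ0 := hz.2
    have i1 : 0 ≤ (nr rr).indicator f1 z := indicator_nonneg (fun z _ => hf1n z) z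
    have i2 : 0 ≤ S.indicator f1 z := indicator_nonneg (fun z _ => hf1n z) z
    have hmis : ((x + D.j x z ∈ D.C ∧ y + D.j y z ∉ D.C) ∨ (x + D.j x z ∉ D.C ∧ y + D.j y z ∈ D.C)) →
        f1 z ≤ (nr rr).indicator f1 z + S.indicator f1 z := by
      intro hm
      rcases lt_or_ge ‖z‖ rr with h | h
      · rw [indicator_of_mem (show z ∈ nr rr from h)]; linarith
      · have : z ∈ S := ⟨hz0.trans_le hξs, p.mismatch hxC hyC hx hy hξr hz0 hW h hm⟩
        rw [indicator_of_mem this]; linarith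
    have k1 := K_le_near (u := u1) (c := u1 x) hxC (b := B * ‖z‖) (by positivity) (hi1 z)
    have k2 := K_le_near (u := u2) (c := u2 y) hyC (b := B * ‖z‖) (by positivity) (hi2 z)
    have ef : f1 z = B * ‖z‖ * (D.Cμ * D.wt z) := by rw [hf1]; ring
    by_cases hX : x + D.j x z ∈ D.C
    · by_cases hY : y + D.j y z ∈ D.C
      · rw [K_of_mem hX, K_of_mem hY]
        have hh := hmax _ (p.land_mem hxC hx hξr hz0) hX _ (p.land_mem hyC hy hξr hz0) hY
        have hh2 := p.pair_T hC2 hxC hyC hx hy hxy hξr hξ1 hz0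
        have := two_g (D.g_nonneg hxC z) (D.g_nonneg hyC z) (D.g_le hxC z)
          (show 0 ≤ p.cc C2 * ‖z‖ by positivity) (show 0 ≤ B * ‖z‖ by positivity) (D.g_le hyC z)
          (D.g_diff hxC hyC z) (a := u1 (x + D.j x z) - u1 x) (b := u2 (y + D.j y z) - u2 y)
          (by linarith) (hi1 z hX) (hi2 z hY)
        have e : p.cc C2 * ‖z‖ * (D.Cμ * D.wt z) + B * ‖z‖ * (D.Dμ * ‖x - y‖ * D.wt z) = f0 z := by
          rw [hf0, hc']; ring
        linarith
      · rw [K_of_notMem hY]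
        have := hmis (Or.inl ⟨hX, hY⟩)
        linarith [hf0n z]
    · rw [K_of_notMem hX]
      by_cases hY : y + D.j y z ∈ D.C
      · have := hmis (Or.inr ⟨hX, hY⟩)
        linarith [hf0n z]
      · rw [K_of_notMem hY]
        linarith [hf0n z]
  have hind1 : IntegrableOn ((nr rr).indicator f1) T := hT1.indicator (nr_meas _)
  have hind2 : IntegrableOn (S.indicator f1) T := hT1.indicator hSm
  have hf0T : IntegrableOn f0 T := (hI0 hξ0').mono_set inter_subset_right
  have hint : (∫ z in T, D.K u1 (u1 x) x z) + ∫ z in T, D.K u2 (u2 y) y z ≤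
      (∫ z in T, f0 z) + (∫ z in T, (nr rr).indicator f1 z) + ∫ z in T, S.indicator f1 z := by
    have h01 : IntegrableOn (fun z => f0 z + (nr rr).indicator f1 z) T := hf0T.add hind1
    rw [← integral_add hK1' hK2', ← integral_add hf0T hind1, ← integral_add h01 hind2]
    exact setIntegral_mono_on (hK1'.add hK2') ((hf0T.add hind1).add hind2) hTm hpt
  have e0 : ∫ z in T, f0 z ≤ c' * D.kn ξ0 := by
    rw [← D.int_near hξ0', ← integral_const_mul]
    exact setIntegral_mono_set (hI0 hξ0') (ae_of_all _ hf0n) (ae_of_all _ fun z hz => hz.2)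
  have e1 : ∫ z in T, (nr rr).indicator f1 z ≤ B * D.Cμ * D.kn rr := by
    rw [setIntegral_indicator (nr_meas _), ← D.int_near hrr, ← integral_const_mul]
    exact setIntegral_mono_set (hI1 hrr) (ae_of_all _ hf1n) (ae_of_all _ fun z hz => hz.2)
  have e2 : ∫ z in T, S.indicator f1 z ≤ B * D.Cμ * (P.Cs * θ) := by
    have h1 : ∫ z in T ∩ S, f1 z ≤ ∫ z in S, f1 z :=
      setIntegral_mono_set ((hI1 P.ξs_pos).mono_set hSn) (ae_of_all _ hf1n) (ae_of_all _ fun z hz => hz.2)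
    have h2 : ∫ z in S, f1 z = B * D.Cμ * ∫ z in S, ‖z‖ * D.wt z := integral_const_mul _ _
    rw [setIntegral_indicator hSm]
    rw [h2] at h1
    refine h1.trans (mul_le_mul_of_nonneg_left (P.slab_le x (hb hx) hxC θ hth0 hth) (by positivity))
  unfold J
  have s1 : ∫ z in fr ξ, D.K u1 (u1 x) x z = (∫ z in T, D.K u1 (u1 x) x z) + ∫ z in fr ξ0, D.K u1 (u1 x) x z := by
    conv_lhs => rw [hsplit]
    rw [setIntegral_union hdisj (fr_meas _) hK1' (K_int hxC hu1 hm1 _ hξ0')]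
  have s2 : ∫ z in fr ξ, D.K u2 (u2 y) y z = (∫ z in T, D.K u2 (u2 y) y z) + ∫ z in fr ξ0, D.K u2 (u2 y) y z := by
    conv_lhs => rw [hsplit]
    rw [setIntegral_union hdisj (fr_meas _) hK2' (K_int hyC hu2 hm2 _ hξ0')]
  rw [s1, s2]
  linarith

end Par

end Dat

namespace Dat
variable (D : Dat N)

variable {D}

/-! ### Localisation function, convergence of maximum points -/

lemma usc_on {u : Euc N → ℝ} (hu : D.Usc u) : UpperSemicontinuousOn u D.C := hu

lemma chi_exists {M L : ℝ} (hM : 0 ≤ M) (hL : 0 < L) (a : Euc N) :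
    ∃ χ : Euc N → ℝ, ContDiff ℝ 1 χ ∧ (∀ x, 0 ≤ χ x) ∧ (∀ x, χ x ≤ 4 * M + 1) ∧ χ a = 0 ∧
      (∀ x y, |χ x - χ y| ≤ L * ‖x - y‖) ∧ ∃ R > 0, ∀ x, R < ‖x - a‖ → 4 * M < χ x := by
  set k := 4 * M + 1 with hk
  have hk0 : 0 < k := by linarith
  set R := k / L with hR
  have hR0 : 0 < R := by positivity
  have hkR : k / R = L := by rw [hR]; field_simp
  refine ⟨fun x => k * (‖x - a‖ ^ 2 / (R ^ 2 + ‖x - a‖ ^ 2)), ?_, fun x => by positivity, fun x => ?_, by simp,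
    fun x y => ?_, R * k, by positivity, fun x hx => ?_⟩
  · have h : ContDiff ℝ 1 (fun x : Euc N => ‖x - a‖ ^ 2) := (contDiff_id.sub contDiff_const).norm_sq ℝ
    exact contDiff_const.mul (h.div (contDiff_const.add h) (fun x => by positivity))
  · refine mul_le_of_le_one_right hk0.le ((div_le_one (by positivity)).2 ?_)
    nlinarith
  · have ht : |‖x - a‖ - ‖y - a‖| ≤ ‖x - y‖ := by
      have := abs_norm_sub_norm_le (x - a) (y - a)
      rwa [sub_sub_sub_cancel_right] at this
    have hs0 := norm_nonneg (x - a)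
    have ht0 := norm_nonneg (y - a)
    set s := ‖x - a‖
    set t := ‖y - a‖
    have e : k * (s ^ 2 / (R ^ 2 + s ^ 2)) - k * (t ^ 2 / (R ^ 2 + t ^ 2)) =
        k * ((s - t) * (R ^ 2 * (s + t) / ((R ^ 2 + s ^ 2) * (R ^ 2 + t ^ 2)))) := by
      field_simp; ring
    have h1 : R ^ 2 * (s + t) / ((R ^ 2 + s ^ 2) * (R ^ 2 + t ^ 2)) ≤ 1 / R := by
      rw [div_le_div_iff₀ (by positivity) hR0]
      have a1 : 2 * (s * R) ≤ R ^ 2 + s ^ 2 := by nlinarith [sq_nonneg (s - R)]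
      have a2 : 2 * (t * R) ≤ R ^ 2 + t ^ 2 := by nlinarith [sq_nonneg (t - R)]
      have b1 : R ^ 2 ≤ R ^ 2 + t ^ 2 := by nlinarith
      have b2 : R ^ 2 ≤ R ^ 2 + s ^ 2 := by nlinarith
      have c1 := mul_le_mul a1 b1 (by positivity) (by positivity)
      have c2 := mul_le_mul a2 b2 (by positivity) (by positivity)
      nlinarith
    have h2 : 0 ≤ R ^ 2 * (s + t) / ((R ^ 2 + s ^ 2) * (R ^ 2 + t ^ 2)) := by positivity
    rw [e, abs_mul, abs_mul, abs_of_pos hk0, abs_of_nonneg h2, ← hkR]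
    calc _ ≤ k * (‖x - y‖ * (1 / R)) := by gcongr
      _ = _ := by ring
  · have h1 : (R * k) ^ 2 < ‖x - a‖ ^ 2 := by gcongr
    have h2 : 4 * M * R ^ 2 ≤ (R * k) ^ 2 := by
      have : 4 * M ≤ k ^ 2 := by nlinarith
      calc 4 * M * R ^ 2 ≤ k ^ 2 * R ^ 2 := by gcongr
        _ = _ := by ring
    show 4 * M < k * (‖x - a‖ ^ 2 / (R ^ 2 + ‖x - a‖ ^ 2))
    rw [← mul_div_assoc, lt_div_iff₀ (by positivity)]
    nlinarith

/-- Existence of the global maximum of the localised sum. -/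
lemma chi_max {u1 u2 χ : Euc N → ℝ} {M R : ℝ} {a : Euc N} (ha : a ∈ D.C) (hu1 : D.Usc u1) (hu2 : D.Usc u2)
    (hb1 : D.Bd u1 M) (hb2 : D.Bd u2 M) (hχ : Continuous χ) (hR : 0 < R) (hχa : χ a = 0)
    (h : ∀ x, R < ‖x - a‖ → 4 * M < χ x) :
    ∃ x0 ∈ D.C, ∀ x ∈ D.C, u1 x + u2 x - χ x ≤ u1 x0 + u2 x0 - χ x0 := by
  have hc : IsCompact (D.C ∩ closedBall a R) := (isCompact_closedBall a R).inter_left D.isClosed_C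
  have hus : UpperSemicontinuousOn (fun x => (u1 x + u2 x) + -χ x) (D.C ∩ closedBall a R) := by
    refine UpperSemicontinuousOn.add (UpperSemicontinuousOn.add ?_ ?_) ?_
    · exact (usc_on hu1).mono inter_subset_left
    · exact (usc_on hu2).mono inter_subset_left
    · exact hχ.neg.continuousOn.upperSemicontinuousOn
  obtain ⟨x0, hx0, hmax⟩ := UpperSemicontinuousOn.exists_isMaxOn (s := D.C ∩ closedBall a R) ⟨a, ha, mem_closedBall_self hR.le⟩ hc hus
  refine ⟨x0, hx0.1, fun x hx => ?_⟩
  by_cases hxR : x ∈ closedBall a R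
  · have : (u1 x + u2 x) + -χ x ≤ (u1 x0 + u2 x0) + -χ x0 := hmax ⟨hx, hxR⟩
    linarith
  · rw [mem_closedBall, dist_eq_norm, not_le] at hxR
    have h1 : (u1 a + u2 a) + -χ a ≤ (u1 x0 + u2 x0) + -χ x0 := hmax ⟨ha, mem_closedBall_self hR.le⟩
    have := h x hxR
    have b1 := abs_le.1 (hb1 a ha); have b2 := abs_le.1 (hb2 a ha)
    have b3 := abs_le.1 (hb1 x hx); have b4 := abs_le.1 (hb2 x hx)
    linarith [b1.1, b2.1, b3.2, b4.2]

lemma usc_seq {u : Euc N → ℝ} (hu : D.Usc u) {xs : ℕ → Euc N} {a : Euc N} (ha : a ∈ D.C) (hxs : ∀ k, xs k ∈ D.C)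
    (h : Tendsto xs atTop (𝓝 a)) {δ : ℝ} (hδ : 0 < δ) : ∀ᶠ k in atTop, u (xs k) ≤ u a + δ := by
  have h1 : Tendsto xs atTop (𝓝[D.C] a) := tendsto_nhdsWithin_iff.2 ⟨h, Eventually.of_forall hxs⟩
  filter_upwards [h1.eventually (hu a ha (u a + δ) (by linarith))] with k hk using hk.le

lemma conv_seq {u1 u2 χ : Euc N → ℝ} {x0 : Euc N} {r : ℝ} (hu1 : D.Usc u1) (hu2 : D.Usc u2) (hχ : Continuous χ)
    (hx0 : x0 ∈ D.C)
    (hmax : ∀ x ∈ D.C, u1 x + u2 x - χ x ≤ u1 x0 + u2 x0 - χ x0)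
    {xs ys : ℕ → Euc N} (hxs : ∀ k, xs k ∈ D.C) (hys : ∀ k, ys k ∈ D.C) (hxr : ∀ k, xs k ∈ closedBall x0 r)
    {es qs : ℕ → ℝ} (hes : Tendsto es atTop (𝓝 0)) (hqs : ∀ k, 0 ≤ qs k)
    (hxy : Tendsto (fun k => ys k - xs k) atTop (𝓝 0))
    (h : ∀ k, qs k + 1/2 * ‖xs k - x0‖ ^ 2 + 1/2 * ‖ys k - x0‖ ^ 2 ≤
      u1 (xs k) + u2 (ys k) - 1/2 * χ (xs k) - 1/2 * χ (ys k) - (u1 x0 + u2 x0 - χ x0) + es k) :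
    ∃ φ : ℕ → ℕ, StrictMono φ ∧ Tendsto (xs ∘ φ) atTop (𝓝 x0) ∧ Tendsto (ys ∘ φ) atTop (𝓝 x0) ∧
      Tendsto (qs ∘ φ) atTop (𝓝 0) ∧ Tendsto (fun k => u1 (xs (φ k))) atTop (𝓝 (u1 x0)) ∧
      Tendsto (fun k => u2 (ys (φ k))) atTop (𝓝 (u2 x0)) := by
  have hc : IsCompact (D.C ∩ closedBall x0 r) := (isCompact_closedBall x0 r).inter_left D.isClosed_C
  obtain ⟨a, ha, φ, hφ, hxa⟩ := hc.tendsto_subseq (fun k => ⟨hxs k, hxr k⟩)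
  have hya : Tendsto (ys ∘ φ) atTop (𝓝 a) := by
    have := (hxy.comp hφ.tendsto_atTop).add hxa
    rw [zero_add] at this
    exact this.congr (fun k => by simp)
  have hes' : Tendsto (es ∘ φ) atTop (𝓝 0) := hes.comp hφ.tendsto_atTop
  have hχx : Tendsto (fun k => χ (xs (φ k))) atTop (𝓝 (χ a)) := (hχ.tendsto a).comp hxa
  have hχy : Tendsto (fun k => χ (ys (φ k))) atTop (𝓝 (χ a)) := (hχ.tendsto a).comp hya
  have key : a = x0 := by
    have hk : ∀ δ > 0, ‖a - x0‖ ^ 2 ≤ 2 * δ := by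
      intro δ hδ
      have l1 : Tendsto (fun k => 1/2 * ‖xs (φ k) - x0‖ ^ 2 + 1/2 * ‖ys (φ k) - x0‖ ^ 2) atTop
          (𝓝 (1/2 * ‖a - x0‖ ^ 2 + 1/2 * ‖a - x0‖ ^ 2)) :=
        (((hxa.sub_const x0).norm.pow 2).const_mul _).add (((hya.sub_const x0).norm.pow 2).const_mul _)
      have l2 : Tendsto (fun k => (u1 a + δ) + (u2 a + δ) - 1/2 * χ (xs (φ k)) - 1/2 * χ (ys (φ k))
          - (u1 x0 + u2 x0 - χ x0) + es (φ k)) atTop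
          (𝓝 ((u1 a + δ) + (u2 a + δ) - 1/2 * χ a - 1/2 * χ a - (u1 x0 + u2 x0 - χ x0) + 0)) :=
        (((tendsto_const_nhds.sub (hχx.const_mul _)).sub (hχy.const_mul _)).sub tendsto_const_nhds).add hes'
      have := le_of_tendsto_of_tendsto l1 l2 (by
        filter_upwards [usc_seq hu1 ha.1 (fun k => hxs (φ k)) hxa hδ, usc_seq hu2 ha.1 (fun k => hys (φ k)) hya hδ]
          with k h1 h2
        have := h (φ k)
        have := hqs (φ k)
        linarith)
      have := hmax a ha.1
      linarith
    have h0 : ‖a - x0‖ ^ 2 ≤ 0 := le_of_forall_pos_le_add fun δ hδ => by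
      have := hk (δ/2) (by linarith); linarith
    have : ‖a - x0‖ = 0 := by nlinarith [norm_nonneg (a - x0)]
    exact sub_eq_zero.1 (norm_eq_zero.1 this)
  subst key
  have hχs : Tendsto (fun k => 1/2 * χ (xs (φ k)) + 1/2 * χ (ys (φ k)) - χ a - es (φ k)) atTop (𝓝 0) := by
    have := (((hχx.const_mul (1/2)).add (hχy.const_mul (1/2))).sub_const (χ a)).sub hes'
    have e : 1/2 * χ a + 1/2 * χ a - χ a - 0 = 0 := by ring
    rw [e] at this; exact this
  have hev : ∀ δ > 0, ∀ᶠ k in atTop, -δ ≤ 1/2 * χ (xs (φ k)) + 1/2 * χ (ys (φ k)) - χ a - es (φ k) := fun δ hδ => by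
    filter_upwards [hχs.eventually (lt_mem_nhds (show -δ < 0 by linarith))] with k hk using hk.le
  refine ⟨φ, hφ, hxa, hya, ?_, ?_, ?_⟩
  · rw [Metric.tendsto_atTop']
    intro δ hδ
    obtain ⟨n, hn⟩ := eventually_atTop.1 (((usc_seq hu1 ha.1 (fun k => hxs (φ k)) hxa (δ := δ/4) (by linarith)).and
      (usc_seq hu2 ha.1 (fun k => hys (φ k)) hya (δ := δ/4) (by linarith))).and (hev (δ/4) (by linarith)))
    refine ⟨n, fun k hk => ?_⟩
    obtain ⟨⟨h1, h2⟩, h3⟩ := hn k hk.le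
    rw [Real.dist_eq, sub_zero, Function.comp_apply, abs_of_nonneg (hqs _)]
    have := h (φ k)
    linarith [sq_nonneg ‖xs (φ k) - a‖, sq_nonneg ‖ys (φ k) - a‖]
  · rw [Metric.tendsto_atTop']
    intro δ hδ
    obtain ⟨n, hn⟩ := eventually_atTop.1 (((usc_seq hu1 ha.1 (fun k => hxs (φ k)) hxa (δ := δ/4) (by linarith)).and
      (usc_seq hu2 ha.1 (fun k => hys (φ k)) hya (δ := δ/4) (by linarith))).and (hev (δ/4) (by linarith)))
    refine ⟨n, fun k hk => ?_⟩
    obtain ⟨⟨h1, h2⟩, h3⟩ := hn k hk.le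
    rw [Real.dist_eq, abs_lt]
    have := h (φ k)
    have := hqs (φ k)
    constructor <;> linarith [sq_nonneg ‖xs (φ k) - a‖, sq_nonneg ‖ys (φ k) - a‖]
  · rw [Metric.tendsto_atTop']
    intro δ hδ
    obtain ⟨n, hn⟩ := eventually_atTop.1 (((usc_seq hu1 ha.1 (fun k => hxs (φ k)) hxa (δ := δ/4) (by linarith)).and
      (usc_seq hu2 ha.1 (fun k => hys (φ k)) hya (δ := δ/4) (by linarith))).and (hev (δ/4) (by linarith)))
    refine ⟨n, fun k hk => ?_⟩
    obtain ⟨⟨h1, h2⟩, h3⟩ := hn k hk.le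
    rw [Real.dist_eq, abs_lt]
    have := h (φ k)
    have := hqs (φ k)
    constructor <;> linarith [sq_nonneg ‖xs (φ k) - a‖, sq_nonneg ‖ys (φ k) - a‖]

/-- maximum points of the doubled functional -/
lemma dbl_max {u1 u2 : Euc N → ℝ} (hu1 : D.Usc u1) (hu2 : D.Usc u2) {x0 : Euc N} {P : D.Loc x0} {G : Gap P} (p : Par G)
    (hx0 : x0 ∈ D.C) {r : ℝ} (hr : 0 < r) (hrP : r < P.r / 4) :
    ∃ x ∈ D.C ∩ closedBall x0 r, ∃ y ∈ D.C ∩ closedBall x0 r, ∀ x' ∈ D.C ∩ closedBall x0 r,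
      ∀ y' ∈ D.C ∩ closedBall x0 r, u1 x' + u2 y' - p.T x' y' ≤ u1 x + u2 y - p.T x y := by
  have hc : IsCompact (D.C ∩ closedBall x0 r) := (isCompact_closedBall x0 r).inter_left D.isClosed_C
  set Q := D.C ∩ closedBall x0 r with hQ
  have hQ4 : Q ⊆ ball x0 (P.r/4) := fun x hx => closedBall_subset_ball hrP hx.2
  have hWc : ContinuousOn (fun q : Euc N × Euc N => G.W q.1 q.2) (Q ×ˢ Q) := by
    rintro ⟨a, b⟩ ⟨ha, hb⟩
    rw [Metric.continuousWithinAt_iff']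
    intro δ hδ
    have hcont : Tendsto (fun q : Euc N × Euc N => (P.Lam * ‖q.1 - a‖ * ‖a - b‖ + 2 * ‖(q.1 - a) - (q.2 - b)‖) +
        (P.Lam * ‖a - q.1‖ * ‖q.1 - q.2‖ + 2 * ‖(a - q.1) - (b - q.2)‖)) (𝓝[Q ×ˢ Q] (a, b)) (𝓝 0) := by
      have : Continuous (fun q : Euc N × Euc N => (P.Lam * ‖q.1 - a‖ * ‖a - b‖ + 2 * ‖(q.1 - a) - (q.2 - b)‖) +
        (P.Lam * ‖a - q.1‖ * ‖q.1 - q.2‖ + 2 * ‖(a - q.1) - (b - q.2)‖)) := by fun_prop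
      have h := (this.tendsto (a, b)).mono_left (nhdsWithin_le_nhds (s := Q ×ˢ Q))
      simpa using h
    filter_upwards [hcont.eventually (gt_mem_nhds hδ), self_mem_nhdsWithin] with q hq hqQ
    have h1 := G.W_inc a (hQ4 ha) b (hQ4 hb) q.1 (hQ4 hqQ.1) q.2 (hQ4 hqQ.2)
    have h2 := G.W_inc q.1 (hQ4 hqQ.1) q.2 (hQ4 hqQ.2) a (hQ4 ha) b (hQ4 hb)
    have hΛ := P.Lam_nonneg
    have n1 : 0 ≤ P.Lam * ‖q.1 - a‖ * ‖a - b‖ + 2 * ‖(q.1 - a) - (q.2 - b)‖ := by positivity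
    have n2 : 0 ≤ P.Lam * ‖a - q.1‖ * ‖q.1 - q.2‖ + 2 * ‖(a - q.1) - (b - q.2)‖ := by positivity
    rw [Real.dist_eq, abs_lt]
    constructor <;> linarith
  have hA : ContinuousOn p.A Q := p.A_cd.continuousOn.mono (hQ4.trans Par.sub4)
  have hm1 : MapsTo (Prod.fst : Euc N × Euc N → Euc N) (Q ×ˢ Q) Q := fun q hq => hq.1
  have hm2 : MapsTo (Prod.snd : Euc N × Euc N → Euc N) (Q ×ˢ Q) Q := fun q hq => hq.2
  have hT : ContinuousOn (fun q : Euc N × Euc N => p.T q.1 q.2) (Q ×ˢ Q) := by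
    unfold Par.T
    refine (((hA.comp continuousOn_fst hm1).add (hA.comp continuousOn_snd hm2)).add ?_).add ?_
    · exact Continuous.continuousOn (by fun_prop)
    · exact continuousOn_const.mul ((((hWc.pow 2).add continuousOn_const).sqrt).sub continuousOn_const)
  have hus : UpperSemicontinuousOn (fun q : Euc N × Euc N => (u1 q.1 + u2 q.2) + -p.T q.1 q.2) (Q ×ˢ Q) := by
    refine UpperSemicontinuousOn.add (UpperSemicontinuousOn.add ?_ ?_) ?_
    · exact ((usc_on hu1).mono inter_subset_left).comp continuousOn_fst hm1
    · exact ((usc_on hu2).mono inter_subset_left).comp continuousOn_snd hm2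
    · exact hT.neg.upperSemicontinuousOn
  have hx0Q : x0 ∈ Q := ⟨hx0, mem_closedBall_self hr.le⟩
  obtain ⟨⟨x, y⟩, ⟨hx, hy⟩, hmax⟩ := UpperSemicontinuousOn.exists_isMaxOn (s := Q ×ˢ Q) ⟨(x0, x0), hx0Q, hx0Q⟩ (hc.prod hc) hus
  refine ⟨x, hx, y, hy, fun x' hx' y' hy' => ?_⟩
  have : (u1 x' + u2 y') + -p.T x' y' ≤ (u1 x + u2 y) + -p.T x y := hmax (show (x', y') ∈ Q ×ˢ Q from ⟨hx', hy'⟩)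
  linarith

end Dat

namespace Dat
variable (D : Dat N)

variable {D}

/-! ### Abstract comparison -/

/-- momentum -/
def PV {x0 : Euc N} {P : D.Loc x0} (G : Gap P) (K0 ε ρ : ℝ) (x y q : Euc N) : Euc N :=
  (2 / ε ^ 2) • (x - y) + (K0 / ε / √(G.W x y ^ 2 + ρ ^ 2)) • G.V x y + q

variable (D) in
/-- structure condition on a pair of Hamiltonians near a point -/
def Good (H1 H2 : Euc N → Euc N → ℝ) (e ι L0 C2 : ℝ) (x0 : Euc N) : Prop :=
  ∃ (P : D.Loc x0) (G : Gap P) (r' K0 i' : ℝ), 0 < r' ∧ 0 < K0 ∧ 0 < i' ∧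
    (∀ C5, ∃ ε1 > 0, ∀ ε ρ, 0 < ε → ε < ε1 → 0 < ρ → ∀ x ∈ D.C, x ∈ ball x0 r' → ∀ y ∈ D.C, y ∈ ball x0 r' →
      ∀ q q', ‖q‖ ≤ L0 → ‖q'‖ ≤ L0 → ‖x - y‖ ≤ C2 * ε →
      H1 x (PV G K0 ε ρ x y q) ≤ C5 * (1 + ε ^ (-D.σ)) → H2 y (PV G K0 ε ρ y x q') ≤ C5 * (1 + ε ^ (-D.σ)) →
      G.W x y ≤ ρ) ∧
    (∃ ε1 > 0, ∀ ε, 0 < ε → ε < ε1 → ∃ ρ0 > 0, ∀ ρ, 0 < ρ → ρ ≤ ρ0 →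
      ∀ x ∈ D.C, x ∈ ball x0 r' → ∀ y ∈ D.C, y ∈ ball x0 r' →
      ∀ q q', ‖q‖ ≤ L0 → ‖q'‖ ≤ L0 → ‖x - y‖ ≤ i' * ε → G.W x y ≤ ρ →
      -(e + ι) ≤ H1 x (PV G K0 ε ρ x y q) + H2 y (PV G K0 ε ρ y x q'))

lemma exists_kn {c ι : ℝ} (hι : 0 < ι) : ∃ ξ0 > 0, ∀ ξ, 0 < ξ → ξ ≤ ξ0 → c * D.kn ξ ≤ ι := by
  have h : Tendsto (fun ξ => c * D.kn ξ) (𝓝[>] 0) (𝓝 (c * 0)) := D.kn_tendsto.const_mul c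
  rw [mul_zero] at h
  have h2 := h.eventually (gt_mem_nhds hι)
  rw [eventually_nhdsWithin_iff, Metric.eventually_nhds_iff] at h2
  obtain ⟨t, ht, h2⟩ := h2
  refine ⟨t/2, by linarith, fun ξ h0 h1 => (h2 ?_ h0).le⟩
  rw [Real.dist_eq, sub_zero, abs_of_pos h0]; linarith

lemma Par.base {x0 : Euc N} {P : D.Loc x0} {G : Gap P} (p : Par G) {x y : Euc N} :
    ‖x - y‖ ^ 2 / p.ε ^ 2 + 1/2 * ‖x - x0‖ ^ 2 + 1/2 * ‖y - x0‖ ^ 2 + 1/2 * p.χ x + 1/2 * p.χ y - p.χ x0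
      - 7 * p.L * p.ε ≤ p.T x y - p.T x0 x0 ∨ G.W x0 x0 ≠ 0 := by
  by_cases hW : G.W x0 x0 = 0
  · left
    have hε := p.ε_pos
    have hρ := p.ρ_pos
    have hK := p.K0_pos
    have hL := p.L_pos
    unfold Par.T Par.A
    rw [hW]
    have h1 : √(0 ^ 2 + p.ρ ^ 2) = p.ρ := by rw [zero_pow two_ne_zero, zero_add, Real.sqrt_sq hρ.le]
    have h2 : p.ρ ≤ √(G.W x y ^ 2 + p.ρ ^ 2) := Real.le_sqrt_of_sq_le (by nlinarith [sq_nonneg (G.W x y)])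
    have h3 : 0 ≤ p.K0 / p.ε * (√(G.W x y ^ 2 + p.ρ ^ 2) - p.ρ) := mul_nonneg (by positivity) (by linarith)
    rw [h1]
    have a : ∀ t, p.L * p.ε * Real.arctan t ≤ p.L * p.ε * (7/4) := fun t => by
      have := (Real.arctan_lt_pi_div_two t).le
      have := Real.pi_lt_d2
      gcongr; linarith
    have b : ∀ t, -(p.L * p.ε * (7/4)) ≤ p.L * p.ε * Real.arctan t := fun t => by
      have := (Real.neg_pi_div_two_lt_arctan t).le
      have := Real.pi_lt_d2
      rw [← mul_neg]
      gcongr; linarith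
    have := a (P.d x / p.ε); have := a (P.d y / p.ε)
    have := b (P.d x0 / p.ε)
    simp only [sub_self, norm_zero]
    norm_num
    linarith
  · right; exact hW

set_option maxHeartbeats 1600000 in
theorem comparison {H1 H2 : Euc N → Euc N → ℝ} {u1 u2 : Euc N → ℝ} {M e : ℝ}
    (hu1 : D.Usc u1) (hu2 : D.Usc u2) (hb1 : D.Bd u1 M) (hb2 : D.Bd u2 M)
    (hw1 : D.WSub H1 u1) (hw2 : D.WSub H2 u2)
    (hG : ∀ ι > 0, ∃ L0 > 0, ∀ x0 ∈ D.C, D.Good H1 H2 e ι L0 (8 * M + 2) x0) :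
    ∀ x ∈ D.C, u1 x + u2 x ≤ e := by
  intro xs hxs
  by_contra hcon
  push Not at hcon
  have hM : 0 ≤ M := hb1.nonneg hxs
  set ι := (u1 xs + u2 xs - e) / 20 with hι
  have hι0 : 0 < ι := by rw [hι]; linarith
  have hιe : u1 xs + u2 xs = e + 20 * ι := by rw [hι]; ring
  obtain ⟨L0, hL0, hG⟩ := hG ι hι0
  have hσ := D.σ_pos
  have hCj := D.Cj_pos
  have hCμ := D.Cμ_pos
  have hDμ := D.Dμ_pos
  have hm1 := hu1.mes
  have hm2 := hu2.mes
  set C2 := 8 * M + 2 with hC2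
  have hC20 : 0 ≤ C2 := by linarith
  -- choice of L
  obtain ⟨L, hL, hLL0, hLι⟩ : ∃ L > 0, L ≤ L0 / 4 ∧ D.Cμ * (D.kA (4 * M + 1) * (D.Cj * L) ^ D.σ) ≤ ι := by
    have h : Tendsto (fun L : ℝ => D.Cμ * (D.kA (4 * M + 1) * (D.Cj * L) ^ D.σ)) (𝓝 0) (𝓝 0) := by
      have : Continuous (fun L : ℝ => D.Cμ * (D.kA (4 * M + 1) * (D.Cj * L) ^ D.σ)) := by
        refine continuous_const.mul (continuous_const.mul ?_)
        exact (continuous_const.mul continuous_id).rpow_const (fun _ => Or.inr hσ.le)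
      have := this.tendsto 0
      simpa [Real.zero_rpow hσ.ne'] using this
    have h2 := h.eventually (gt_mem_nhds hι0)
    rw [Metric.eventually_nhds_iff] at h2
    obtain ⟨t, ht, h2⟩ := h2
    refine ⟨min (t/2) (L0/4), by positivity, min_le_right _ _, (h2 ?_).le⟩
    rw [Real.dist_eq, sub_zero, abs_of_pos (by positivity)]
    exact (min_le_left _ _).trans_lt (by linarith)
  obtain ⟨χ, χcd, χ0, χ1, χa, χlip, R, hR, hχR⟩ := chi_exists hM hL xs
  have χc := χcd.continuous
  obtain ⟨x0, hx0, hmax⟩ := chi_max hxs hu1 hu2 hb1 hb2 χc hR χa hχR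
  have hx0v : e + 20 * ι ≤ u1 x0 + u2 x0 := by
    have := hmax xs hxs; have := χ0 x0; rw [χa] at *; linarith
  have hx0v' : -2 * M ≤ u1 x0 + u2 x0 - χ x0 := by
    have := hmax xs hxs; rw [χa] at this
    have := (abs_le.1 (hb1 xs hxs)).1; have := (abs_le.1 (hb2 xs hxs)).1; linarith
  obtain ⟨P, G, r', K0, i', hr', hK0, hi', S1, S2⟩ := hG x0 hx0
  have hΛ := P.Lam_nonneg
  have hPr := P.r_pos
  have hCs := P.Cs_pos
  have hξsp := P.ξs_pos
  set r1 := min (min (P.r/8) r') 1 with hr1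
  have hr1p : 0 < r1 := by positivity
  have hr1P : r1 ≤ P.r/8 := (min_le_left _ _).trans (min_le_left _ _)
  have hr1r : r1 ≤ r' := (min_le_left _ _).trans (min_le_right _ _)
  have hr11 : r1 ≤ 1 := min_le_right _ _
  have hWx0 : G.W x0 x0 = 0 := by
    have h := G.W_le x0 (mem_ball_self (by linarith)) x0 (mem_ball_self (by linarith))
    rw [sub_self, norm_zero, mul_zero] at h
    exact le_antisymm h (G.W_nonneg _ _)
  -- the parameters
  let mkp : ∀ ε ρ : ℝ, 0 < ε → 0 < ρ → Par G := fun ε ρ hε hρ =>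
    { χ := χ, L := L, ε := ε, ρ := ρ, K0 := K0, r1 := r1, χ_cd := χcd, L_pos := hL, χ_lip := χlip, ε_pos := hε,
      ρ_pos := hρ, K0_pos := hK0, r1_pos := hr1p, r1_le := by linarith, r1_one := hr11 }
  let p0 : Par G := mkp 1 1 one_pos one_pos
  set CB := p0.CB M C2 with hCB
  have hCBp : 0 < CB := p0.CB_pos hM hC20
  set cc := p0.cc C2 with hcc
  have hcc0 : 0 ≤ cc := p0.cc_nonneg hC20
  obtain ⟨ξa, hξa, hknξ⟩ := exists_kn (D := D) (c := cc * D.Cμ + CB * C2 * D.Dμ) hι0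
  set ξ0 := min (min ξa (r1 / 2 / D.Cj)) (min 1 P.ξs) with hξ0
  have hξ0p : 0 < ξ0 := by positivity
  have hξ0a : ξ0 ≤ ξa := (min_le_left _ _).trans (min_le_left _ _)
  have hξ0r : D.Cj * ξ0 ≤ r1 / 2 := by
    have : ξ0 ≤ r1 / 2 / D.Cj := (min_le_left _ _).trans (min_le_right _ _)
    rw [le_div_iff₀ hCj] at this; linarith
  have hξ01 : ξ0 ≤ 1 := (min_le_right _ _).trans (min_le_left _ _)
  have hξ0s : ξ0 ≤ P.ξs := (min_le_right _ _).trans (min_le_right _ _)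
  have hkn0 := hknξ ξ0 hξ0p hξ0a
  set C5 := 1 + M + D.Cμ * (D.kA (2 * M) * CB ^ D.σ) with hC5
  have hkA := D.kA_nonneg (A := 2 * M) (by linarith)
  obtain ⟨εa, hεa, S1⟩ := S1 C5
  obtain ⟨εb, hεb, S2⟩ := S2
  set ε1 := min (min εa εb) (min (min 1 (r1/2)) (1/(7*L))) with hε1
  have hε1p : 0 < ε1 := by positivity
  let εs : ℕ → ℝ := fun k => ε1 / ((k:ℝ) + 2)
  have hεs0 : ∀ k, 0 < εs k := fun k => by positivity
  have hεs1 : ∀ k, εs k < ε1 := fun k => div_lt_self hε1p (by have := Nat.cast_nonneg (α := ℝ) k; linarith)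
  have hεslim : Tendsto εs atTop (𝓝 0) :=
    tendsto_const_nhds.div_atTop (tendsto_atTop_add_const_right _ _ tendsto_natCast_atTop_atTop)
  have hεsa : ∀ k, εs k < εa := fun k => (hεs1 k).trans_le ((min_le_left _ _).trans (min_le_left _ _))
  have hεsb : ∀ k, εs k < εb := fun k => (hεs1 k).trans_le ((min_le_left _ _).trans (min_le_right _ _))
  have hεs2 : ∀ k, εs k ≤ 1 := fun k => ((hεs1 k).trans_le
    ((min_le_right _ _).trans ((min_le_left _ _).trans (min_le_left _ _)))).le
  have hεs3 : ∀ k, εs k ≤ r1/2 := fun k => ((hεs1 k).trans_le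
    ((min_le_right _ _).trans ((min_le_left _ _).trans (min_le_right _ _)))).le
  have hεs4 : ∀ k, 7 * L * εs k ≤ 1 := fun k => by
    have : εs k ≤ 1/(7*L) := ((hεs1 k).trans_le ((min_le_right _ _).trans (min_le_right _ _))).le
    rw [le_div_iff₀ (by positivity)] at this; linarith
  have hrr : ∀ k, ∃ rr > 0, CB / εs k * D.Cμ * D.kn rr ≤ ι := fun k => by
    have := hεs0 k
    obtain ⟨t, ht, h⟩ := exists_kn (D := D) (c := CB / εs k * D.Cμ) hι0
    exact ⟨t, ht, h t ht le_rfl⟩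
  choose rr hrr0 hrr using hrr
  choose ρ0 hρ0 S2 using fun k => S2 (εs k) (hεs0 k) (hεsb k)
  let ρs : ℕ → ℝ := fun k => min (ρ0 k) (εs k ^ 2 * rr k)
  have hρs0 : ∀ k, 0 < ρs k := fun k => lt_min (hρ0 k) (mul_pos (pow_pos (hεs0 k) 2) (hrr0 k))
  let ps : ℕ → Par G := fun k => mkp (εs k) (ρs k) (hεs0 k) (hρs0 k)
  choose xk hxk yk hyk hdbl using fun k => dbl_max hu1 hu2 (ps k) hx0 hr1p (by linarith)
  have hx0Q : x0 ∈ D.C ∩ closedBall x0 r1 := ⟨hx0, mem_closedBall_self hr1p.le⟩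
  have hest : ∀ k, ‖xk k - yk k‖ ^ 2 / εs k ^ 2 + 1/2 * ‖xk k - x0‖ ^ 2 + 1/2 * ‖yk k - x0‖ ^ 2 ≤
      u1 (xk k) + u2 (yk k) - 1/2 * χ (xk k) - 1/2 * χ (yk k) - (u1 x0 + u2 x0 - χ x0) + 7 * L * εs k := fun k => by
    have h1 := hdbl k x0 hx0Q x0 hx0Q
    have h2 := ((ps k).base (x := xk k) (y := yk k)).resolve_right (not_not.2 hWx0)
    change ‖xk k - yk k‖ ^ 2 / εs k ^ 2 + 1/2 * ‖xk k - x0‖ ^ 2 + 1/2 * ‖yk k - x0‖ ^ 2 + 1/2 * χ (xk k)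
      + 1/2 * χ (yk k) - χ x0 - 7 * L * εs k ≤ _ at h2
    linarith
  have hxyC2 : ∀ k, ‖xk k - yk k‖ ≤ C2 * εs k := fun k => by
    have h1 := hest k
    have h2 := hεs4 k
    have := χ0 (xk k); have := χ0 (yk k)
    have := (abs_le.1 (hb1 _ (hxk k).1)).2; have := (abs_le.1 (hb2 _ (hyk k).1)).2
    have h3 : ‖xk k - yk k‖ ^ 2 / εs k ^ 2 ≤ C2 ^ 2 := by
      have : 4 * M + 1 ≤ C2 ^ 2 := by rw [hC2]; nlinarith
      linarith [sq_nonneg ‖xk k - x0‖, sq_nonneg ‖yk k - x0‖]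
    rw [div_le_iff₀ (pow_pos (hεs0 k) 2), ← mul_pow] at h3
    exact le_of_sq_le_sq h3 (mul_nonneg hC20 (hεs0 k).le)
  have hxylim : Tendsto (fun k => yk k - xk k) atTop (𝓝 0) := by
    refine squeeze_zero_norm (a := fun k => C2 * εs k) (fun k => ?_) ?_
    · rw [norm_sub_rev]; exact hxyC2 k
    · simpa using hεslim.const_mul C2
  obtain ⟨φ, hφ, hxl, hyl, hql, hu1l, hu2l⟩ := conv_seq (r := r1) (es := fun k => 7 * L * εs k)
    (qs := fun k => ‖xk k - yk k‖ ^ 2 / εs k ^ 2) hu1 hu2 χc hx0 hmax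
    (fun k => (hxk k).1) (fun k => (hyk k).1) (fun k => (hxk k).2) (by simpa using hεslim.const_mul (7 * L))
    (fun k => by positivity) hxylim hest
  have hεφ : Tendsto (fun k => εs (φ k)) atTop (𝓝 0) := hεslim.comp hφ.tendsto_atTop
  have hrat : Tendsto (fun k => ‖xk (φ k) - yk (φ k)‖ / εs (φ k)) atTop (𝓝 0) := by
    have h := (Real.continuous_sqrt.tendsto 0).comp hql
    rw [Real.sqrt_zero] at h
    refine h.congr fun k => ?_
    simp only [Function.comp_apply]
    rw [← div_pow, Real.sqrt_sq (div_nonneg (norm_nonneg _) (hεs0 _).le)]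
  have hxn : Tendsto (fun k => ‖xk (φ k) - x0‖) atTop (𝓝 0) := tendsto_iff_norm_sub_tendsto_zero.1 hxl
  have hyn : Tendsto (fun k => ‖yk (φ k) - x0‖) atTop (𝓝 0) := tendsto_iff_norm_sub_tendsto_zero.1 hyl
  -- smallness
  have hsmx : Tendsto (fun k => 2 * P.Lam * (‖xk (φ k) - yk (φ k)‖ / εs (φ k)) ^ 2 +
      K0 * P.Lam * (‖xk (φ k) - yk (φ k)‖ / εs (φ k)) + ‖xk (φ k) - x0‖) atTop (𝓝 0) := by
    simpa using (((hrat.pow 2).const_mul (2 * P.Lam)).add (hrat.const_mul (K0 * P.Lam))).add hxn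
  have hsmy : Tendsto (fun k => 2 * P.Lam * (‖xk (φ k) - yk (φ k)‖ / εs (φ k)) ^ 2 +
      K0 * P.Lam * (‖xk (φ k) - yk (φ k)‖ / εs (φ k)) + ‖yk (φ k) - x0‖) atTop (𝓝 0) := by
    simpa using (((hrat.pow 2).const_mul (2 * P.Lam)).add (hrat.const_mul (K0 * P.Lam))).add hyn
  have hthl : Tendsto (fun k => 2 * εs (φ k) + (2 * P.Lam * D.Cj + 4 * D.Dj) * (‖xk (φ k) - yk (φ k)‖ / εs (φ k)))
      atTop (𝓝 0) := by
    simpa using (hεφ.const_mul 2).add (hrat.const_mul (2 * P.Lam * D.Cj + 4 * D.Dj))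
  have hthl2 : Tendsto (fun k => CB * D.Cμ * P.Cs * (2 * εs (φ k) + (2 * P.Lam * D.Cj + 4 * D.Dj) *
      (‖xk (φ k) - yk (φ k)‖ / εs (φ k)))) atTop (𝓝 0) := by
    simpa using hthl.const_mul (CB * D.Cμ * P.Cs)
  have E1 := hsmx.eventually (gt_mem_nhds (show (0:ℝ) < L/2 by linarith))
  have E2 := hsmy.eventually (gt_mem_nhds (show (0:ℝ) < L/2 by linarith))
  have E3 := hthl.eventually (gt_mem_nhds (show (0:ℝ) < 1 by linarith))
  have E4 := hthl2.eventually (gt_mem_nhds hι0)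
  have E5 := hrat.eventually (gt_mem_nhds hi')
  have E6 := hxn.eventually (gt_mem_nhds (show (0:ℝ) < min (r1/2) (L0/4) by positivity))
  have E7 := hyn.eventually (gt_mem_nhds (show (0:ℝ) < min (r1/2) (L0/4) by positivity))
  have E8 := J_usc hξ0p hb1 hu1 (fun k => (hxk (φ k)).1) hx0 hxl hu1l hι0
  have E9 := J_usc hξ0p hb2 hu2 (fun k => (hyk (φ k)).1) hx0 hyl hu2l hι0
  have E10 := (hu1l.add hu2l).eventually (lt_mem_nhds (show u1 x0 + u2 x0 - ι < u1 x0 + u2 x0 by linarith))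
  obtain ⟨k0, ⟨⟨⟨⟨⟨⟨⟨⟨⟨e1, e2⟩, e3⟩, e4⟩, e5⟩, e6⟩, e7⟩, e8⟩, e9⟩, e10⟩⟩ :=
    (((((((((E1.and E2).and E3).and E4).and E5).and E6).and E7).and E8).and E9).and E10).exists
  set k := φ k0 with hk
  clear_value k
  clear E1 E2 E3 E4 E5 E6 E7 E8 E9 E10 hsmx hsmy hthl hthl2 hxl hyl hql hu1l hu2l hεφ hrat hxn hyn
  set x := xk k with hx
  set y := yk k with hy
  set p := ps k with hp
  have hε := hεs0 k
  have pε : p.ε = εs k := rfl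
  have pL : p.L = L := rfl
  have pK : p.K0 = K0 := rfl
  have pρ : p.ρ = ρs k := rfl
  have pr : p.r1 = r1 := rfl
  have pCB : p.CB M C2 = CB := rfl
  have pcc : p.cc C2 = cc := rfl
  have hxC := (hxk k).1
  have hyC := (hyk k).1
  have hxb : x ∈ ball x0 (r1/2) := by rw [mem_ball, dist_eq_norm]; exact e6.trans_le (min_le_left _ _)
  have hyb : y ∈ ball x0 (r1/2) := by rw [mem_ball, dist_eq_norm]; exact e7.trans_le (min_le_left _ _)
  have hxb1 : x ∈ ball x0 r1 := ball_subset_ball (by linarith) hxb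
  have hyb1 : y ∈ ball x0 r1 := ball_subset_ball (by linarith) hyb
  have hd : ∀ x' ∈ ball x0 r1, x' ∈ D.C → ∀ y' ∈ ball x0 r1, y' ∈ D.C →
      u1 x' + u2 y' - p.T x' y' ≤ u1 x + u2 y - p.T x y := fun x' hx' hx'C y' hy' hy'C =>
    hdbl k x' ⟨hx'C, ball_subset_closedBall hx'⟩ y' ⟨hy'C, ball_subset_closedBall hy'⟩
  have hd1 : ∀ x' ∈ ball x0 p.r1, x' ∈ D.C → u1 x' - p.T x' y ≤ u1 x - p.T x y := fun x' hx' hx'C => by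
    have := hd x' hx' hx'C y hyb1 hyC; linarith
  have hd2 : ∀ y' ∈ ball x0 p.r1, y' ∈ D.C → u2 y' - p.T y' x ≤ u2 y - p.T y x := fun y' hy' hy'C => by
    have := hd x hxb1 hxC y' hy' hy'C
    rw [p.T_symm y' x, p.T_symm y x]; linarith
  have sm1 : 2 * P.Lam * ‖x - y‖ ^ 2 / p.ε ^ 2 + p.K0 * P.Lam * ‖x - y‖ / p.ε + ‖x - x0‖ < p.L / 2 := by
    rw [pε, pK, pL]
    calc _ = 2 * P.Lam * (‖x - y‖ / εs k) ^ 2 + K0 * P.Lam * (‖x - y‖ / εs k) + ‖x - x0‖ := by ring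
      _ < _ := e1
  have sm2 : 2 * P.Lam * ‖y - x‖ ^ 2 / p.ε ^ 2 + p.K0 * P.Lam * ‖y - x‖ / p.ε + ‖y - x0‖ < p.L / 2 := by
    rw [pε, pK, pL, norm_sub_rev y x]
    calc _ = 2 * P.Lam * (‖x - y‖ / εs k) ^ 2 + K0 * P.Lam * (‖x - y‖ / εs k) + ‖y - x0‖ := by ring
      _ < _ := e2
  have q1 := p.half hw1 hxC hyC hxb1 hyb1 hd1 sm1
  have q2 := p.half hw2 hyC hxC hyb1 hxb1 hd2 sm2
  have hxy := hxyC2 k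
  have hyx : ‖y - x‖ ≤ C2 * p.ε := by rw [norm_sub_rev]; exact hxy
  have i1 := p.incr hb1 hxC hxb hyb1 hC20 (hεs2 k) (hεs3 k) hxy hd1
  have i2 := p.incr hb2 hyC hyb hxb1 hC20 (hεs2 k) (hεs3 k) hyx hd2
  have hB : 0 < CB / εs k := by positivity
  have b1 := H_bound hb1 hm1 hxC hB i1 q1
  have b2 := H_bound hb2 hm2 hyC hB i2 q2
  have hC5' : 1 + M + D.Cμ * (D.kA (2 * M) * (CB / εs k) ^ D.σ) ≤ C5 * (1 + εs k ^ (-D.σ)) := by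
    have h1 : (CB / εs k) ^ D.σ = CB ^ D.σ * εs k ^ (-D.σ) := by
      rw [Real.div_rpow hCBp.le hε.le, Real.rpow_neg hε.le]; rfl
    have h2 : 0 ≤ εs k ^ (-D.σ) := by positivity
    have h3 : 0 ≤ CB ^ D.σ := by positivity
    have h4 : 0 ≤ D.Cμ * (D.kA (2 * M) * CB ^ D.σ) := by positivity
    rw [h1, hC5]
    nlinarith [mul_nonneg (show 0 ≤ 1 + M by linarith) h2]
  have hq1 : ‖p.q x‖ ≤ L0 := by
    have := p.q_le (Par.sub4 (p.sub1 hxb1)); rw [pL] at this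
    have := e6.trans_le (min_le_right _ _); linarith
  have hq2 : ‖p.q y‖ ≤ L0 := by
    have := p.q_le (Par.sub4 (p.sub1 hyb1)); rw [pL] at this
    have := e7.trans_le (min_le_right _ _); linarith
  have hxr' := ball_subset_ball hr1r hxb1
  have hyr' := ball_subset_ball hr1r hyb1
  have hW := S1 (εs k) (ρs k) hε (hεsa k) (hρs0 k) x hxC hxr' y hyC hyr' (p.q x) (p.q y) hq1 hq2 hxy
    (b1.trans hC5') (b2.trans hC5')
  have hxi : ‖x - y‖ ≤ i' * εs k := by
    have := e5.le; rwa [div_le_iff₀ hε] at this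
  have hS2 := S2 k (ρs k) (hρs0 k) (min_le_left _ _) x hxC hxr' y hyC hyr' (p.q x) (p.q y) hq1 hq2 hxi hW
  have hthv : p.th ‖x - y‖ = εs k * (2 * εs k + (2 * P.Lam * D.Cj + 4 * D.Dj) * (‖x - y‖ / εs k)) := by
    show 2 * εs k ^ 2 + (2 * P.Lam * D.Cj + 4 * D.Dj) * ‖x - y‖ = _
    field_simp
  have hth : p.th ‖x - y‖ ≤ 1 := by
    rw [hthv]
    have := hεs2 k
    have hDj := D.Dj_pos
    have h0 : 0 ≤ 2 * εs k + (2 * P.Lam * D.Cj + 4 * D.Dj) * (‖x - y‖ / εs k) := by positivity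
    exact mul_le_one₀ this h0 e3.le
  obtain ⟨ξ1, hξ1, q1⟩ := q1 ι hι0
  obtain ⟨ξ2, hξ2, q2⟩ := q2 ι hι0
  set ξ := min (min (ξ1/2) (ξ2/2)) ξ0 with hξ
  have hξp : 0 < ξ := by positivity
  have q1 := q1 ξ hξp (lt_of_le_of_lt ((min_le_left _ _).trans (min_le_left _ _)) (by linarith))
  have q2 := q2 ξ hξp (lt_of_le_of_lt ((min_le_left _ _).trans (min_le_right _ _)) (by linarith))
  have hpn := p.pair_near hb1 hm1 hb2 hm2 hC20 hB.le hxC hyC hxb hyb hxy hξ0r hξ01 hξ0s hξp (min_le_right _ _)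
    (hrr0 k) (hW.trans (min_le_right _ _)) hth hd i1 i2
  rw [pcc] at hpn
  have t1 : (cc * D.Cμ + CB / εs k * D.Dμ * ‖x - y‖) * D.kn ξ0 ≤ ι := by
    refine le_trans (mul_le_mul_of_nonneg_right ?_ (D.kn_nonneg hξ0p.le)) hkn0
    have : CB / εs k * D.Dμ * ‖x - y‖ ≤ CB / εs k * D.Dμ * (C2 * εs k) := by gcongr
    have e : CB / εs k * D.Dμ * (C2 * εs k) = CB * C2 * D.Dμ := by field_simp
    linarith
  have t2 := hrr k
  have t3 : CB / εs k * D.Cμ * (P.Cs * p.th ‖x - y‖) ≤ ι := by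
    rw [hthv]
    refine le_trans (le_of_eq ?_) e4.le
    field_simp
  have t4 : D.J ξ0 u1 (u1 x0) x0 + D.J ξ0 u2 (u2 x0) x0 ≤ ι := by
    have hχb : D.Bd χ (4 * M + 1) := fun z _ => by rw [abs_of_nonneg (χ0 z)]; exact χ1 z
    have hχm : D.Mes χ := Mes.of_cont χc
    rw [← J_add hx0 hξ0p hb1 hm1 hb2 hm2]
    have hb12 : D.Bd (fun y => u1 y + u2 y) (M + M) := fun z hz =>
      (abs_add_le _ _).trans (add_le_add (hb1 z hz) (hb2 z hz))
    refine (J_mono hx0 hξ0p hb12 (hm1.add hm2) hχb hχm (c' := χ x0) (fun z hz => ?_)).trans ?_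
    · have := hmax z hz; linarith
    refine (J_le_min hx0 hξ0p hχb hχm (A := 4 * M + 1) (B := D.Cj * L) (by linarith) (by positivity)
      (fun z _ => ?_) (fun z _ => ?_)).trans hLι
    · have := χ1 (x0 + D.j x0 z); have := χ0 x0; linarith
    · refine (le_abs_self _).trans ((χlip _ _).trans ?_)
      rw [add_sub_cancel_left]
      have := D.j_le hx0 z
      calc L * ‖D.j x0 z‖ ≤ L * (D.Cj * ‖z‖) := by gcongr
        _ = _ := by ring
  change u1 x - D.J ξ u1 (u1 x) x + H1 x (PV G K0 (εs k) (ρs k) x y (p.q x)) ≤ ι at q1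
  change u2 y - D.J ξ u2 (u2 y) y + H2 y (PV G K0 (εs k) (ρs k) y x (p.q y)) ≤ ι at q2
  linarith

end Dat

namespace Dat
variable (D : Dat N)

variable {D}

/-! ### Gaps; coercive Hamiltonians -/

/-- the full gap -/
def gapC {x0 : Euc N} (P : D.Loc x0) : Gap P where
  W x y := ‖x - y‖
  V x y := x - y
  W_nonneg x y := norm_nonneg _
  W_symm x y := norm_sub_rev x y
  W_le x _ y _ := by linarith [norm_nonneg (x - y)]
  W_inc x _ y _ x' _ y' _ := by
    have h : x' - y' = (x - y) + ((x' - x) - (y' - y)) := by abel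
    have h1 : ‖x' - y'‖ ≤ ‖x - y‖ + ‖(x' - x) - (y' - y)‖ := by
      conv_lhs => rw [h]
      exact norm_add_le _ _
    have h2 : 0 ≤ P.Lam * ‖x' - x‖ * ‖x - y‖ := by have := P.Lam_nonneg; positivity
    linarith [norm_nonneg ((x' - x) - (y' - y))]
  W_grad x _ y _ := by
    rw [hasGradientAt_iff_hasFDerivAt]
    have := ((hasStrictFDerivAt_norm_sq (x - y)).hasFDerivAt).comp x ((hasFDerivAt_id x).sub_const y)
    refine HasFDerivAt.congr_fderiv this ?_
    ext v
    simp [two_smul]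
  W_cd y _ := ((contDiff_id.sub contDiff_const).norm_sq ℝ).contDiffOn
  V_n x hx y hy hxb hyC := P.n_ge (Par.sub4 hx) (Par.sub4 hy) hxb hyC
  d_le x hx y hy := P.d_lip (Par.sub4 hx) (Par.sub4 hy)

/-- the normal gap -/
def gapB {x0 : Euc N} (P : D.Loc x0) : Gap P where
  W x y := |P.d x - P.d y|
  V x y := (P.d x - P.d y) • P.e x
  W_nonneg x y := abs_nonneg _
  W_symm x y := abs_sub_comm _ _
  W_le x hx y hy := P.d_lip (Par.sub4 hx) (Par.sub4 hy)
  W_inc x hx y hy x' hx' y' hy' := by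
    have h1 := P.d_inc hx hy hx' hy'
    have h2 : |P.d x' - P.d y'| ≤ |P.d x - P.d y| + |(P.d x' - P.d y') - (P.d x - P.d y)| := by
      have := abs_add_le (P.d x - P.d y) ((P.d x' - P.d y') - (P.d x - P.d y))
      rwa [add_sub_cancel] at this
    linarith
  W_grad x hx y hy := by
    simp only [sq_abs]
    rw [hasGradientAt_iff_hasFDerivAt]
    have := ((P.fderiv_at (Par.sub4 hx)).sub_const (P.d y)).pow 2
    refine HasFDerivAt.congr_fderiv this ?_
    ext v
    simp [inner_smul_left]; ring
  W_cd y _ := by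
    simp only [sq_abs]
    exact ((P.cd.mono Par.sub4).sub contDiffOn_const).pow 2
  V_n x hx y hy hxb hyC := by
    obtain ⟨h1, h2⟩ := P.bdry x (Par.sub4 hx) hxb
    have h3 := P.nonneg y (Par.sub4 hy) hyC
    have hn := (D.hn x hxb).1
    have hΛ := P.Lam_nonneg
    rw [h2, h1, inner_smul_left, inner_neg_left, real_inner_self_eq_norm_sq, hn]
    have : 0 ≤ P.Lam * |0 - P.d y| * ‖x - y‖ := by positivity
    simp only [conj_trivial]
    linarith
  d_le x hx y hy := by linarith [abs_nonneg (P.d x - P.d y)]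

lemma modulus_small {ω : ℝ → ℝ} (hω : IsModulus ω) {c ι : ℝ} (hι : 0 < ι) :
    ∃ t > 0, ∀ s, 0 < s → s ≤ t → ω s * c ≤ ι := by
  have h : Tendsto (fun s => ω s * c) (𝓝[>] 0) (𝓝 (0 * c)) := hω.2.2.mul_const c
  rw [zero_mul] at h
  have h2 := h.eventually (gt_mem_nhds hι)
  rw [eventually_nhdsWithin_iff, Metric.eventually_nhds_iff] at h2
  obtain ⟨t, ht, h2⟩ := h2
  refine ⟨t/2, by linarith, fun s h0 h1 => (h2 ?_ h0).le⟩
  rw [Real.dist_eq, sub_zero, abs_of_pos h0]; linarith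

lemma PV_gapC_norm {x0 : Euc N} {P : D.Loc x0} {K0 ε ρ L0 : ℝ} (hK : 0 < K0) (hε : 0 < ε) (hρ : 0 < ρ)
    {x y q : Euc N} (hq : ‖q‖ ≤ L0) :
    ‖PV (gapC P) K0 ε ρ x y q‖ ≤ 2 / ε ^ 2 * ‖x - y‖ + K0 / ε + L0 := by
  unfold PV gapC
  dsimp only
  have hϑ : 0 < √(‖x - y‖ ^ 2 + ρ ^ 2) := by positivity
  have h1 : ‖x - y‖ ≤ √(‖x - y‖ ^ 2 + ρ ^ 2) := Real.le_sqrt_of_sq_le (by nlinarith)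
  refine (norm_add_le _ _).trans (add_le_add ((norm_add_le _ _).trans (add_le_add ?_ ?_)) hq)
  · rw [norm_smul, Real.norm_of_nonneg (by positivity)]
  · rw [norm_smul, Real.norm_of_nonneg (by positivity)]
    calc K0 / ε / √(‖x - y‖ ^ 2 + ρ ^ 2) * ‖x - y‖ ≤ K0 / ε / √(‖x - y‖ ^ 2 + ρ ^ 2) * √(‖x - y‖ ^ 2 + ρ ^ 2) := by gcongr
      _ = _ := by field_simp

lemma PV_gapC_sum {x0 : Euc N} {P : D.Loc x0} {K0 ε ρ : ℝ} {x y q q' : Euc N} :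
    PV (gapC P) K0 ε ρ x y q + PV (gapC P) K0 ε ρ y x q' = q + q' := by
  unfold PV gapC
  dsimp only
  rw [norm_sub_rev y x, ← neg_sub x y, smul_neg, smul_neg]
  abel

lemma PV_gapC_lower {x0 : Euc N} {P : D.Loc x0} {ε ρ L0 : ℝ} (hε : 0 < ε) (hρ : 0 < ρ) (hL0 : 0 < L0)
    {x y q : Euc N} (hq : ‖q‖ ≤ L0) (hεL : ε ≤ 1 / (4 * L0)) (hxy : ρ < ‖x - y‖) :
    1 / 4 / ε ≤ ‖PV (gapC P) 1 ε ρ x y q‖ := by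
  unfold PV gapC
  dsimp only
  set t := ‖x - y‖ with ht
  have ht0 : 0 < t := hρ.trans hxy
  have hϑ : 0 < √(t ^ 2 + ρ ^ 2) := by positivity
  have h1 : √(t ^ 2 + ρ ^ 2) ≤ 2 * t := by
    rw [Real.sqrt_le_left (by positivity)]; nlinarith
  rw [← add_smul]
  have h2 := norm_sub_le_norm_add ((2 / ε ^ 2 + 1 / ε / √(t ^ 2 + ρ ^ 2)) • (x - y)) q
  refine le_trans ?_ h2
  rw [norm_smul, Real.norm_of_nonneg (by positivity), ← ht]
  have h3 : 1 / 2 / ε ≤ (2 / ε ^ 2 + 1 / ε / √(t ^ 2 + ρ ^ 2)) * t := by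
    have a1 : 1 / ε / (2 * t) ≤ 1 / ε / √(t ^ 2 + ρ ^ 2) := by gcongr
    have a2 : 1 / ε / (2 * t) * t = 1 / 2 / ε := by field_simp
    have a3 : 0 ≤ 2 / ε ^ 2 := by positivity
    rw [← a2]; gcongr; linarith
  have h4 : L0 ≤ 1 / 4 / ε := by
    rw [le_div_iff₀ (by positivity)] at hεL
    rw [le_div_iff₀ hε]; linarith
  have h5 : 1 / 2 / ε = 1 / 4 / ε + 1 / 4 / ε := by ring
  linarith

lemma good_coercive {H1 H2 : Euc N → Euc N → ℝ} {m c0 Dc e ι L0 C2 : ℝ} {ω Φ : ℝ → ℝ} (hσ : D.σ < m) (hc0 : 0 < c0)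
    (hL0 : 0 < L0) (hι : 0 < ι)
    (hH1 : ∀ x ∈ D.C, ∀ p, c0 * ‖p‖ ^ m - Dc ≤ H1 x p) (hω : IsModulus ω) (hΦ0 : ∀ s, 0 ≤ s → 0 ≤ Φ s)
    (hΦ : ∀ s t, 0 ≤ s → s ≤ t → Φ s ≤ Φ t)
    (hT : ∀ x ∈ D.C, ∀ y ∈ D.C, ∀ p p', ‖p + p'‖ ≤ 2 * L0 →
      -(e + ι / 2) - ω ‖x - y‖ * Φ (max ‖p‖ ‖p'‖) ≤ H1 x p + H2 y p') {x0 : Euc N} (hx0 : x0 ∈ D.C) :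
    D.Good H1 H2 e ι L0 C2 x0 := by
  obtain ⟨P⟩ := D.loc_exists hx0
  have hσ0 := D.σ_pos
  refine ⟨P, gapC P, 1, 1, 1, one_pos, one_pos, one_pos, fun C5 => ?_, 1, one_pos, fun ε hε hε1 => ?_⟩
  · have hlim : Tendsto (fun ε : ℝ => Dc * ε ^ m + C5 * (ε ^ m + ε ^ (m - D.σ))) (𝓝 0) (𝓝 0) := by
      have c1 : Continuous (fun ε : ℝ => ε ^ m) := continuous_id.rpow_const fun _ => Or.inr (by linarith)
      have c2 : Continuous (fun ε : ℝ => ε ^ (m - D.σ)) := continuous_id.rpow_const fun _ => Or.inr (by linarith)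
      have : Continuous (fun ε : ℝ => Dc * ε ^ m + C5 * (ε ^ m + ε ^ (m - D.σ))) := by fun_prop
      have := this.tendsto 0
      rw [Real.zero_rpow (by linarith), Real.zero_rpow (by linarith)] at this
      simpa using this
    have h2 := hlim.eventually (gt_mem_nhds (show 0 < c0 * (1/4) ^ m by positivity))
    rw [Metric.eventually_nhds_iff] at h2
    obtain ⟨t, ht, h2⟩ := h2
    refine ⟨min t (1 / (4 * L0)), by positivity, fun ε ρ hε hε1 hρ x hx _ y hy _ q q' hq hq' _ hh1 _ => ?_⟩
    by_contra hcon
    have hcon : ρ < ‖x - y‖ := not_le.1 hcon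
    have h3 := h2 (y := ε) (by rw [Real.dist_eq, sub_zero, abs_of_pos hε]; exact hε1.trans_le (min_le_left _ _))
    have h4 := PV_gapC_lower (P := P) hε hρ hL0 hq (hε1.le.trans (min_le_right _ _)) hcon
    have h5 := (hH1 x hx _).trans hh1
    have hm : 0 ≤ m := by linarith
    have h6 : (1/4/ε) ^ m ≤ ‖PV (gapC P) 1 ε ρ x y q‖ ^ m := by gcongr
    rw [Real.div_rpow (by norm_num) hε.le] at h6
    have h7 : c0 * ((1/4) ^ m / ε ^ m) ≤ Dc + C5 * (1 + ε ^ (-D.σ)) := by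
      have : c0 * ((1/4) ^ m / ε ^ m) ≤ c0 * ‖PV (gapC P) 1 ε ρ x y q‖ ^ m := by gcongr
      linarith
    have hεm : 0 < ε ^ m := by positivity
    have h8 := mul_le_mul_of_nonneg_right h7 hεm.le
    have e1 : c0 * ((1/4) ^ m / ε ^ m) * ε ^ m = c0 * (1/4) ^ m := by field_simp
    have e2 : ε ^ (-D.σ) * ε ^ m = ε ^ (m - D.σ) := by rw [← Real.rpow_add hε]; congr 1; ring
    have e3 : (Dc + C5 * (1 + ε ^ (-D.σ))) * ε ^ m = Dc * ε ^ m + C5 * (ε ^ m + ε ^ (m - D.σ)) := by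
      rw [← e2]; ring
    rw [e1, e3] at h8
    linarith
  · obtain ⟨t, ht, h⟩ := modulus_small hω (c := Φ (2 / ε ^ 2 + 1 / ε + L0)) (show 0 < ι / 2 by linarith)
    refine ⟨min t 1, by positivity, fun ρ hρ hρ0 x hx _ y hy _ q q' hq hq' _ hW => ?_⟩
    have hW : ‖x - y‖ ≤ ρ := hW
    have hρ1 : ρ ≤ 1 := hρ0.trans (min_le_right _ _)
    have h1 := hT x hx y hy (PV (gapC P) 1 ε ρ x y q) (PV (gapC P) 1 ε ρ y x q') (by
      rw [PV_gapC_sum]; exact (norm_add_le _ _).trans (by linarith))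
    have n1 := PV_gapC_norm (P := P) (x := x) (y := y) one_pos hε hρ hq
    have n2 := PV_gapC_norm (P := P) (x := y) (y := x) one_pos hε hρ hq'
    rw [norm_sub_rev y x] at n2
    have n3 : 2 / ε ^ 2 * ‖x - y‖ ≤ 2 / ε ^ 2 := mul_le_of_le_one_right (by positivity) (by linarith)
    have h2 := hΦ _ _ ((norm_nonneg (PV (gapC P) 1 ε ρ x y q)).trans (le_max_left _ _))
      (max_le (n1.trans (by linarith)) (n2.trans (by linarith)) :
        max ‖PV (gapC P) 1 ε ρ x y q‖ ‖PV (gapC P) 1 ε ρ y x q'‖ ≤ 2 / ε ^ 2 + 1 / ε + L0)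
    have h3 := h ρ hρ (hρ0.trans (min_le_left _ _))
    have h4 : ω ‖x - y‖ * Φ (max ‖PV (gapC P) 1 ε ρ x y q‖ ‖PV (gapC P) 1 ε ρ y x q'‖) ≤
        ω ρ * Φ (2 / ε ^ 2 + 1 / ε + L0) :=
      mul_le_mul (hω.2.1 hW) h2 (hΦ0 _ ((norm_nonneg _).trans (le_max_left _ _))) (hω.1 _)
    linarith

variable (D) in
/-- Comparison between sub- and supersolutions for `H`. -/
def Comp (H : Euc N → Euc N → ℝ) : Prop :=
  ∀ u1 u2 : Euc N → ℝ, ∀ M, D.Usc u1 → D.Usc u2 → D.Bd u1 M → D.Bd u2 M → D.WSub H u1 → D.WSub (hat H) u2 →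
    ∀ x ∈ D.C, u1 x + u2 x ≤ 0

lemma comp_Ha {H : Euc N → Euc N → ℝ} {m c0 Dc C : ℝ} {ω : ℝ → ℝ} (h1 : AssumptionH1 D.Ω H D.σ m c0 Dc)
    (ha : AssumptionHa H C ω) : D.Comp H := by
  intro u1 u2 M hu1 hu2 hb1 hb2 hw1 hw2
  obtain ⟨hσ, hc0, -, h1⟩ := h1
  obtain ⟨hC, hω, ha⟩ := ha
  refine comparison hu1 hu2 hb1 hb2 hw1 hw2 fun ι hι => ?_
  refine ⟨ι / (4 * C), by positivity, fun x0 hx0 => ?_⟩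
  refine good_coercive (Φ := fun s => 1 + s) hσ hc0 (by positivity) hι h1 hω (fun s hs => by linarith)
    (fun s t _ hst => by linarith) (fun x hx y hy p p' hp => ?_) hx0
  have h := ha x y (-p') p
  have h2 : ‖-p' - p‖ ≤ 2 * (ι / (4 * C)) := by
    rw [← norm_neg]; convert hp using 1; congr 1; abel
  have h3 : C * ‖-p' - p‖ ≤ ι / 2 := by
    calc _ ≤ C * (2 * (ι / (4 * C))) := by gcongr
      _ = _ := by field_simp; norm_num
  have h4 : ω ‖x - y‖ * (1 + ‖-p'‖) ≤ ω ‖x - y‖ * (1 + max ‖p‖ ‖p'‖) := by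
    rw [norm_neg]
    exact mul_le_mul_of_nonneg_left (by linarith [le_max_right ‖p‖ ‖p'‖]) (hω.1 _)
  unfold hat
  linarith

lemma J_smul (ξ μ c : ℝ) (u : Euc N → ℝ) (x : Euc N) :
    D.J ξ (fun y => μ * u y) (μ * c) x = μ * D.J ξ u c x := by
  unfold J
  rw [← integral_const_mul]
  congr 1
  ext z
  by_cases h' : x + D.j x z ∈ D.C
  · rw [K_of_mem h', K_of_mem h']; ring
  · rw [K_of_notMem h', K_of_notMem h', mul_zero]

lemma WSub.mono {H H' : Euc N → Euc N → ℝ} {u : Euc N → ℝ} (hw : D.WSub H u)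
    (h : ∀ x ∈ D.C, ∀ p, H' x p ≤ H x p) : D.WSub H' u := by
  intro x hx ρ hρ φ hφ hmax
  rcases hw x hx ρ hρ φ hφ hmax with h1 | h1
  · exact Or.inl h1
  · refine Or.inr fun δ hδ => ?_
    obtain ⟨ξ0, h0, h2⟩ := h1 δ hδ
    exact ⟨ξ0, h0, fun ξ h3 h4 => by linarith [h2 ξ h3 h4, h x hx (gradient φ x)]⟩

lemma WSub.smul {H : Euc N → Euc N → ℝ} {u : Euc N → ℝ} (hw : D.WSub H u) {μ : ℝ} (hμ : 0 < μ) :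
    D.WSub (fun x p => μ * H x (μ⁻¹ • p)) (fun x => μ * u x) := by
  intro x hx ρ hρ φ hφ hmax
  have hd : DifferentiableAt ℝ φ x :=
    (hφ.differentiableOn one_ne_zero).differentiableAt (isOpen_ball.mem_nhds (mem_ball_self hρ))
  have hg : gradient (fun y => μ⁻¹ * φ y) x = μ⁻¹ • gradient φ x := by
    have h1 := (hasGradientAt_iff_hasFDerivAt.1 hd.hasGradientAt).const_mul μ⁻¹
    refine HasGradientAt.gradient (hasGradientAt_iff_hasFDerivAt.2 ?_)
    rw [map_smul]; exact h1
  have := hw x hx ρ hρ (fun y => μ⁻¹ * φ y) (contDiffOn_const.mul hφ) (fun y hy hyC => by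
    have h1 := mul_le_mul_of_nonneg_left (hmax y hy hyC) (inv_pos.2 hμ).le
    have e : ∀ z, μ⁻¹ * (μ * u z - φ z) = u z - μ⁻¹ * φ z := fun z => by field_simp
    rwa [e, e] at h1)
  rw [hg] at this
  rcases this with ⟨h1, h2⟩ | h1
  · refine Or.inl ⟨h1, ?_⟩
    rw [inner_smul_left] at h2
    by_contra hcon
    push Not at hcon
    have : 0 < μ⁻¹ * ⟪gradient φ x, D.n x⟫ := by positivity
    simp only [conj_trivial] at h2
    linarith
  · refine Or.inr fun δ hδ => ?_
    obtain ⟨ξ0, h0, h2⟩ := h1 (μ⁻¹ * δ) (by positivity)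
    refine ⟨ξ0, h0, fun ξ h3 h4 => ?_⟩
    have := mul_le_mul_of_nonneg_left (h2 ξ h3 h4) hμ.le
    rw [J_smul]
    have e : μ * (μ⁻¹ * δ) = δ := by field_simp
    rw [e] at this
    linarith

lemma comp_Hbc {H : Euc N → Euc N → ℝ} {m c0 Dc A Cb C : ℝ} {ω : ℝ → ℝ} (h1 : AssumptionH1 D.Ω H D.σ m c0 Dc)
    (hb : AssumptionHb H m A Cb) (hc : AssumptionHc H m C ω) : D.Comp H := by
  intro u1 u2 M hu1 hu2 hb1 hb2 hw1 hw2 xs hxs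
  have hM := hb1.nonneg hxs
  obtain ⟨hσ, hc0, -, h1⟩ := h1
  obtain ⟨hm, hA, hCb, hb⟩ := hb
  obtain ⟨hC, hω, hc⟩ := hc
  have key : ∀ μ ∈ Ioo (0:ℝ) 1, ∀ x ∈ D.C, μ * u1 x + u2 x ≤ (1 - μ) * A := by
    intro μ hμ
    have hμ1 : 0 < 1 - μ := by linarith [hμ.2]
    have hk : 0 < (1 - μ) * (Cb * (m - 1)) := by
      have : 0 < m - 1 := by linarith
      positivity
    refine comparison (M := M) (H1 := fun x p => H x p + (1 - μ) * (Cb * (m - 1) * ‖p‖ ^ m - A)) (H2 := hat H)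
      ?_ hu2 (fun x hx => ?_) hb2 ((hw1.smul hμ.1).mono fun x hx p => ?_) hw2 fun ι hι => ?_
    · intro x hx a ha
      have : u1 x < μ⁻¹ * a := by rw [← div_eq_inv_mul, lt_div_iff₀ hμ.1]; linarith
      filter_upwards [hu1 x hx _ this] with y hy
      rw [← div_eq_inv_mul, lt_div_iff₀ hμ.1] at hy; linarith
    · rw [abs_mul, abs_of_pos hμ.1]
      have := hb1 x hx
      nlinarith [hμ.2, abs_nonneg (u1 x)]
    · have := hb μ hμ x p
      linarith
    · set L0 := min (1/2) (min ((1 - μ) * (Cb * (m - 1))) (ι / 2) / (2 * C * 2 ^ m)) with hL0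
      have h2m : (0:ℝ) < 2 ^ m := by positivity
      have hL0p : 0 < L0 := by positivity
      have hL1 : L0 ≤ 1/2 := min_le_left _ _
      have hL2 : 2 * C * 2 ^ m * L0 ≤ min ((1 - μ) * (Cb * (m - 1))) (ι / 2) := by
        have : L0 ≤ min ((1 - μ) * (Cb * (m - 1))) (ι / 2) / (2 * C * 2 ^ m) := min_le_right _ _
        rw [le_div_iff₀ (by positivity)] at this; linarith
      refine ⟨L0, hL0p, fun x0 hx0 => ?_⟩
      refine good_coercive (Φ := fun s => 1 + s ^ m) (m := m) (c0 := c0) (Dc := Dc + (1 - μ) * A) hσ hc0 hL0p hι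
        (fun x hx p => ?_) hω (fun s hs => by positivity)
        (fun s t hs hst => by gcongr) (fun x hx y hy p p' hp => ?_) hx0
      · have := h1 x hx p
        have : 0 ≤ (1 - μ) * (Cb * (m - 1)) * ‖p‖ ^ m := by positivity
        linarith
      · have h := hc x y (-p') p
        have h2 : ‖-p' - p‖ ≤ 2 * L0 := by
          rw [← norm_neg]; convert hp using 1; congr 1; abel
        rw [norm_neg, max_comm ‖p'‖] at h
        set s := max ‖p‖ ‖p'‖ with hs
        have hs0 : 0 ≤ s := (norm_nonneg p).trans (le_max_left _ _)
        have hs1 : s ≤ ‖p‖ + 1 := max_le (by linarith) (by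
          have : ‖p'‖ ≤ ‖p‖ + ‖-p' - p‖ := by
            have := norm_sub_le (-p' - p) (-p)
            have e : -p' - p - -p = -p' := by abel
            rw [e, norm_neg, norm_neg] at this; linarith
          linarith)
        have h3 : s ^ (m - 1) ≤ 2 ^ m * (‖p‖ ^ m + 1) := by
          set t := ‖p‖ with ht
          have ht0 : 0 ≤ t := norm_nonneg _
          calc s ^ (m - 1) ≤ (t + 1) ^ (m - 1) := Real.rpow_le_rpow hs0 hs1 (by linarith)
            _ ≤ (t + 1) ^ m := Real.rpow_le_rpow_of_exponent_le (by linarith) (by linarith)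
            _ ≤ (2 * max t 1) ^ m := by
                refine Real.rpow_le_rpow (by linarith) ?_ (by linarith)
                linarith [le_max_left t 1, le_max_right t 1]
            _ = 2 ^ m * (max t 1) ^ m := Real.mul_rpow (by norm_num) (by positivity)
            _ ≤ 2 ^ m * (t ^ m + 1) := by
                gcongr
                rcases le_total t 1 with h | h
                · rw [max_eq_right h, Real.one_rpow]
                  have : 0 ≤ t ^ m := by positivity
                  linarith
                · rw [max_eq_left h]; linarith
        have h4 : C * ‖-p' - p‖ * s ^ (m - 1) ≤ (1 - μ) * (Cb * (m - 1)) * ‖p‖ ^ m + ι / 2 := by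
          have hpm : 0 ≤ ‖p‖ ^ m := by positivity
          calc _ ≤ C * (2 * L0) * (2 ^ m * (‖p‖ ^ m + 1)) := by gcongr
            _ = (2 * C * 2 ^ m * L0) * ‖p‖ ^ m + 2 * C * 2 ^ m * L0 := by ring
            _ ≤ _ := add_le_add (mul_le_mul_of_nonneg_right (hL2.trans (min_le_left _ _)) hpm)
              (hL2.trans (min_le_right _ _))
        unfold hat
        linarith
  by_contra hcon
  push Not at hcon
  set δ := u1 xs + u2 xs with hδ
  -- choose μ close to 1
  set τ := min (1/2) (δ / (2 * (M + A))) with hτ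
  have hτ0 : 0 < τ := by positivity
  have h := key (1 - τ) ⟨by linarith [min_le_left (1/2) (δ / (2 * (M + A)))], by linarith⟩ xs hxs
  have h2 : τ * (2 * (M + A)) ≤ δ := by
    have : τ ≤ δ / (2 * (M + A)) := min_le_right _ _
    rwa [le_div_iff₀ (by positivity)] at this
  have h3 := (abs_le.1 (hb1 xs hxs)).2
  nlinarith

end Dat

namespace Dat
variable (D : Dat N)

section Bellman
variable {D}
set_option linter.unusedSectionVars false
variable {A : Type} [MetricSpace A] [CompactSpace A] [Nonempty A]
  {b : Euc N → A → Euc N} {l : Euc N → A → ℝ} {H : Euc N → Euc N → ℝ}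

lemma bel_le {Mb Ml : ℝ} (hMb : ∀ x α, ‖b x α‖ ≤ Mb) (hMl : ∀ x α, |l x α| ≤ Ml) (hH : IsBellman b l H)
    (x p : Euc N) (α : A) : -⟪b x α, p⟫ - l x α ≤ H x p := by
  rw [hH]
  refine le_ciSup (f := fun α => -⟪b x α, p⟫ - l x α) ⟨Mb * ‖p‖ + Ml, ?_⟩ α
  rintro _ ⟨a, rfl⟩
  have h1 := abs_real_inner_le_norm (b x a) p
  have h2 : ‖b x a‖ * ‖p‖ ≤ Mb * ‖p‖ := by gcongr; exact hMb _ _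
  have h3 := neg_abs_le ⟪b x a, p⟫
  have h4 := neg_abs_le (l x a)
  have h5 := hMl x a
  dsimp only
  linarith

lemma bel_ex (hH : IsBellman b l H)
    (x p : Euc N) {c : ℝ} (h : c < H x p) : ∃ α, c < -⟪b x α, p⟫ - l x α := by
  rw [hH] at h
  exact exists_lt_of_lt_ciSup h

lemma bel_ge (hH : IsBellman b l H)
    (x p : Euc N) {c : ℝ} (h : ∀ α, -⟪b x α, p⟫ - l x α ≤ c) : H x p ≤ c := by
  rw [hH]
  exact ciSup_le h

lemma bel_sign {Mb : ℝ} (hMb0 : 0 < Mb) (hMb : ∀ x α, ‖b x α‖ ≤ Mb) (hb : Continuous (fun q : Euc N × A => b q.1 q.2))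
    (hL : AssumptionL D.Ω b) (hB : AssumptionB D.Ω D.n b) {x0 : Euc N} (hx0 : x0 ∈ frontier D.Ω) (P : D.Loc x0) :
    ∃ β > 0, ∃ r' > 0, r' ≤ P.r / 4 ∧ ∀ x ∈ D.C, x ∈ ball x0 r' → ∀ y ∈ D.C, y ∈ ball x0 r' → ∀ s F,
      (∀ α, -(s * ⟪b x α, P.e x⟫) ≤ F) → (∃ α, s * ⟪b y α, P.e y⟫ ≤ F) → 0 ≤ F → β * |s| ≤ F := by
  obtain ⟨Cb, hCb, hL⟩ := hL
  have hx0C : x0 ∈ D.C := D.frontier_sub hx0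
  have hr := P.r_pos
  have hΛ := P.Lam_nonneg
  have hx0b : x0 ∈ ball x0 P.r := mem_ball_self hr
  have he0 := (P.bdry x0 hx0b hx0).2
  have hcont : Continuous (fun α => ⟪b x0 α, P.e x0⟫) :=
    (hb.comp (Continuous.prodMk_right x0)).inner continuous_const
  have hvar : ∀ β > 0, ∃ r' > 0, r' ≤ P.r / 4 ∧ ∀ x ∈ D.C, x ∈ ball x0 r' → ∀ α,
      |⟪b x α, P.e x⟫ - ⟪b x0 α, P.e x0⟫| ≤ β := by
    intro β hβ
    refine ⟨min (P.r/4) (β / (2 * Cb + Mb * P.Lam)), by positivity, min_le_left _ _, fun x hx hxr α => ?_⟩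
    have hxr' : ‖x - x0‖ < min (P.r/4) (β / (2 * Cb + Mb * P.Lam)) := by rwa [mem_ball_iff_norm] at hxr
    have hxP : x ∈ ball x0 P.r := by
      rw [mem_ball_iff_norm]; have := hxr'.trans_le (min_le_left _ _); linarith
    have e1 : ⟪b x α, P.e x⟫ - ⟪b x0 α, P.e x0⟫ = ⟪b x α - b x0 α, P.e x⟫ + ⟪b x0 α, P.e x - P.e x0⟫ := by
      rw [inner_sub_left, inner_sub_right]; ring
    have h1 := abs_real_inner_le_norm (b x α - b x0 α) (P.e x)
    have h2 := abs_real_inner_le_norm (b x0 α) (P.e x - P.e x0)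
    have h3 : ‖b x α - b x0 α‖ * ‖P.e x‖ ≤ (Cb * ‖x - x0‖) * 2 :=
      mul_le_mul (hL α x hx x0 hx0C) (P.e_le x hxP) (norm_nonneg _) (by positivity)
    have h4 : ‖b x0 α‖ * ‖P.e x - P.e x0‖ ≤ Mb * (P.Lam * ‖x - x0‖) :=
      mul_le_mul (hMb _ _) (P.e_lip x hxP x0 hx0b) (norm_nonneg _) (by positivity)
    have h5 := hxr'.le.trans (min_le_right _ _)
    rw [le_div_iff₀ (by positivity)] at h5
    rw [e1]
    refine (abs_add_le _ _).trans ?_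
    linarith
  obtain ⟨αm, -, hαm⟩ := isCompact_univ.exists_isMinOn univ_nonempty hcont.continuousOn
  obtain ⟨αM, -, hαM⟩ := isCompact_univ.exists_isMaxOn univ_nonempty hcont.continuousOn
  have hαm : ∀ α, ⟪b x0 αm, P.e x0⟫ ≤ ⟪b x0 α, P.e x0⟫ := fun α => hαm (mem_univ α)
  have hαM : ∀ α, ⟪b x0 α, P.e x0⟫ ≤ ⟪b x0 αM, P.e x0⟫ := fun α => hαM (mem_univ α)
  have hcase : x0 ∈ GammaIn D.Ω D.n b ∪ GammaOut D.Ω D.n b ∪ GammaMix D.Ω D.n b := by rw [hB.1]; exact hx0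
  have hen : ∀ α, ⟪b x0 α, D.n x0⟫ = -⟪b x0 α, P.e x0⟫ := fun α => by rw [he0, inner_neg_right, neg_neg]
  have pos_case : ∀ {β s F t : ℝ}, 0 < β → β ≤ t → 0 ≤ s → s * t ≤ F → β * |s| ≤ F := by
    intro β s F t hβ ht hs h
    rw [abs_of_nonneg hs]; nlinarith
  have neg_case : ∀ {β s F t : ℝ}, 0 < β → β ≤ t → s ≤ 0 → -(s * t) ≤ F → β * |s| ≤ F := by
    intro β s F t hβ ht hs h
    rw [abs_of_nonpos hs]; nlinarith
  rcases hcase with (h | h) | h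
  · have hβ : 0 < ⟪b x0 αm, P.e x0⟫ := by have := h.2 αm; rw [hen] at this; linarith
    set β := ⟪b x0 αm, P.e x0⟫ with hβd
    obtain ⟨r', hr', hr'r, hv⟩ := hvar (β/2) (by positivity)
    refine ⟨β/2, by positivity, r', hr', hr'r, fun x hx hxr y hy hyr s F h1 ⟨α, h2⟩ hF => ?_⟩
    have a1 := abs_le.1 (hv x hx hxr α)
    have a2 := abs_le.1 (hv y hy hyr α)
    have a3 := hαm α
    rcases le_total 0 s with hs | hs
    · exact pos_case (by positivity) (by linarith) hs h2
    · exact neg_case (by positivity) (by linarith) hs (h1 α)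
  · have hβ : ⟪b x0 αM, P.e x0⟫ < 0 := by have := h.2 αM; rw [hen] at this; linarith
    set β := -⟪b x0 αM, P.e x0⟫ with hβd
    obtain ⟨r', hr', hr'r, hv⟩ := hvar (β/2) (by linarith)
    refine ⟨β/2, by linarith, r', hr', hr'r, fun x hx hxr y hy hyr s F h1 ⟨α, h2⟩ hF => ?_⟩
    have a1 := abs_le.1 (hv x hx hxr α)
    have a2 := abs_le.1 (hv y hy hyr α)
    have a3 := hαM α
    rcases le_total 0 s with hs | hs
    · refine pos_case (t := -⟪b x α, P.e x⟫) (by linarith) (by linarith) hs (by linarith [h1 α])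
    · exact neg_case (t := -⟪b y α, P.e y⟫) (by linarith) (by linarith) hs (by linarith)
  · obtain ⟨-, α1, α2, h1, h2⟩ := h
    rw [hen] at h1 h2
    set β := min ⟪b x0 α1, P.e x0⟫ (-⟪b x0 α2, P.e x0⟫) with hβd
    have hβ : 0 < β := lt_min (by linarith) h2
    have m1 : β ≤ ⟪b x0 α1, P.e x0⟫ := min_le_left _ _
    have m2 : β ≤ -⟪b x0 α2, P.e x0⟫ := min_le_right _ _
    obtain ⟨r', hr', hr'r, hv⟩ := hvar (β/2) (by positivity)
    refine ⟨β/2, by positivity, r', hr', hr'r, fun x hx hxr y hy hyr s F h1 _ hF => ?_⟩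
    have a1 := abs_le.1 (hv x hx hxr α1)
    have a2 := abs_le.1 (hv x hx hxr α2)
    rcases le_total 0 s with hs | hs
    · refine pos_case (t := -⟪b x α2, P.e x⟫) (by linarith) (by linarith) hs (by linarith [h1 α2])
    · exact neg_case (t := ⟪b x α1, P.e x⟫) (by linarith) (by linarith) hs (h1 α1)

lemma PV_gapB {x0 : Euc N} (P : D.Loc x0) (K0 ε ρ : ℝ) (x y q : Euc N) :
    PV (gapB P) K0 ε ρ x y q = (2 / ε ^ 2) • (x - y)
      + (K0 / ε / √((P.d x - P.d y) ^ 2 + ρ ^ 2) * (P.d x - P.d y)) • P.e x + q := by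
  unfold PV gapB
  dsimp only
  rw [sq_abs, smul_smul]

lemma PV_gapB' {x0 : Euc N} (P : D.Loc x0) (K0 ε ρ : ℝ) (x y q : Euc N) :
    PV (gapB P) K0 ε ρ y x q = -((2 / ε ^ 2) • (x - y))
      - (K0 / ε / √((P.d x - P.d y) ^ 2 + ρ ^ 2) * (P.d x - P.d y)) • P.e y + q := by
  rw [PV_gapB, ← neg_sub x y, smul_neg, ← neg_sub (P.d x), neg_sq, mul_neg, neg_smul]
  abel

set_option maxHeartbeats 1000000 in
lemma good_bellman {Mb Ml : ℝ} (hMb0 : 0 < Mb) (hMb : ∀ x α, ‖b x α‖ ≤ Mb) (hMl : ∀ x α, |l x α| ≤ Ml)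
    (hb : Continuous (fun q : Euc N × A => b q.1 q.2)) (hH : IsBellman b l H) (hC : AssumptionC D.Ω l)
    (hL : AssumptionL D.Ω b) (hB : AssumptionB D.Ω D.n b) {ι C2 : ℝ} (hι : 0 < ι) {x0 : Euc N} (hx0 : x0 ∈ D.C) :
    D.Good H (hat H) 0 ι (ι / (8 * Mb)) C2 x0 := by
  obtain ⟨P⟩ := D.loc_exists hx0
  have hσ0 := D.σ_pos
  have hσ1 := D.σ_lt
  have hr := P.r_pos
  have hΛ := P.Lam_nonneg
  have hMl0 : 0 ≤ Ml := (abs_nonneg _).trans (hMl 0 (Classical.arbitrary A))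
  set L0 := ι / (8 * Mb) with hL0d
  have hL0 : 0 < L0 := by positivity
  -- the first property
  have S1 : ∃ r' > 0, r' ≤ P.r / 4 ∧ ∃ K0 > 0, ∀ C5, ∃ ε1 > 0, ∀ ε ρ, 0 < ε → ε < ε1 → 0 < ρ → ∀ x ∈ D.C, x ∈ ball x0 r' →
      ∀ y ∈ D.C, y ∈ ball x0 r' → ∀ q q', ‖q‖ ≤ L0 → ‖q'‖ ≤ L0 → ‖x - y‖ ≤ C2 * ε →
      H x (PV (gapB P) K0 ε ρ x y q) ≤ C5 * (1 + ε ^ (-D.σ)) →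
      hat H y (PV (gapB P) K0 ε ρ y x q') ≤ C5 * (1 + ε ^ (-D.σ)) → (gapB P).W x y ≤ ρ := by
    rcases D.mem_or hx0 with hxi | hxb
    · refine ⟨P.r/4, by positivity, le_rfl, 1, one_pos, fun C5 => ⟨1, one_pos, ?_⟩⟩
      intro ε ρ _ _ hρ x _ _ y _ _ q q' _ _ _ _ _
      have := (P.side hxi).2
      change |P.d x - P.d y| ≤ ρ
      rw [this, this, sub_self, abs_zero]; exact hρ.le
    · obtain ⟨β, hβ, r', hr', hr'r, hS⟩ := bel_sign hMb0 hMb hb hL hB hxb P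
      refine ⟨r', hr', hr'r, 2 * (2 * Mb * |C2| + 1) / β, by positivity, fun C5 => ?_⟩
      have hlim : Tendsto (fun ε : ℝ => |C5| * (ε + ε ^ (1 - D.σ)) + ε * (Ml + Mb * L0 + 1)) (𝓝 0) (𝓝 0) := by
        have c2 : Continuous (fun ε : ℝ => ε ^ (1 - D.σ)) := continuous_id.rpow_const fun _ => Or.inr (by linarith)
        have : Continuous (fun ε : ℝ => |C5| * (ε + ε ^ (1 - D.σ)) + ε * (Ml + Mb * L0 + 1)) := by fun_prop
        have := this.tendsto 0
        rw [Real.zero_rpow (by linarith)] at this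
        simpa using this
      have h2 := hlim.eventually (gt_mem_nhds one_pos)
      rw [Metric.eventually_nhds_iff] at h2
      obtain ⟨t, ht, h2⟩ := h2
      refine ⟨t, ht, fun ε ρ hε hε1 hρ x hx hxr y hy hyr q q' hq hq' hxy hh1 hh2 => ?_⟩
      by_contra hcon
      have hcon : ρ < |P.d x - P.d y| := not_le.1 hcon
      have h3 := h2 (y := ε) (by rw [Real.dist_eq, sub_zero, abs_of_pos hε]; exact hε1)
      set K0 := 2 * (2 * Mb * |C2| + 1) / β with hK0
      have hK0p : 0 < K0 := by positivity
      set s := K0 / ε / √((P.d x - P.d y) ^ 2 + ρ ^ 2) * (P.d x - P.d y) with hs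
      have hε2 : 0 < ε ^ (-D.σ) := by positivity
      have hE : C5 * (1 + ε ^ (-D.σ)) ≤ |C5| * (1 + ε ^ (-D.σ)) := by gcongr; exact le_abs_self _
      set E := |C5| * (1 + ε ^ (-D.σ)) with hEd
      have hE0 : 0 ≤ E := by positivity
      set F := E + Ml + Mb * (2 * |C2| / ε + L0) + 1 with hF
      have hF0 : 0 ≤ F := by positivity
      have hpert : ‖(2 / ε ^ 2) • (x - y)‖ ≤ 2 * |C2| / ε := by
        rw [norm_smul, Real.norm_of_nonneg (by positivity)]
        calc 2 / ε ^ 2 * ‖x - y‖ ≤ 2 / ε ^ 2 * (|C2| * ε) := by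
              gcongr; exact hxy.trans (by gcongr; exact le_abs_self _)
          _ = _ := by field_simp
      have hin : ∀ z α w, ‖w‖ ≤ L0 → ∀ v, ‖v‖ ≤ 2 * |C2| / ε → |⟪b z α, v + w⟫| ≤ Mb * (2 * |C2| / ε + L0) := by
        intro z α w hw v hv
        refine (abs_real_inner_le_norm _ _).trans ?_
        exact mul_le_mul (hMb _ _) ((norm_add_le _ _).trans (by linarith)) (norm_nonneg _) hMb0.le
      have hmain := hS x hx hxr y hy hyr s F (fun α => ?_) ?_ hF0
      · have hd : 0 < |P.d x - P.d y| := hρ.trans hcon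
        set δ := P.d x - P.d y with hδ
        have hϑ : 0 < √(δ ^ 2 + ρ ^ 2) := by positivity
        have h5 : √(δ ^ 2 + ρ ^ 2) ≤ 2 * |δ| := by
          rw [Real.sqrt_le_left (by positivity), ← sq_abs δ]; nlinarith
        have h6 : K0 / ε / 2 ≤ |s| := by
          rw [hs, abs_mul, abs_of_pos (by positivity)]
          calc K0 / ε / 2 = K0 / ε / (2 * |δ|) * |δ| := by field_simp
            _ ≤ _ := by gcongr
        have h7 : β * (K0 / ε / 2) ≤ F := (mul_le_mul_of_nonneg_left h6 hβ.le).trans hmain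
        have h8 := mul_le_mul_of_nonneg_right h7 hε.le
        have e1 : β * (K0 / ε / 2) * ε = 2 * Mb * |C2| + 1 := by rw [hK0]; field_simp
        have e2 : ε ^ (-D.σ) * ε = ε ^ (1 - D.σ) := by
          have : 1 - D.σ = -D.σ + 1 := by ring
          rw [this, Real.rpow_add hε, Real.rpow_one]
        have e3 : F * ε = |C5| * (ε + ε ^ (1 - D.σ)) + ε * (Ml + Mb * L0 + 1) + 2 * Mb * |C2| := by
          rw [hF, hEd, ← e2]; field_simp; ring
        rw [e1, e3] at h8
        linarith
      · have h4 := (bel_le hMb hMl hH x (PV (gapB P) K0 ε ρ x y q) α).trans (hh1.trans hE)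
        rw [PV_gapB, ← hs, add_right_comm, inner_add_right, inner_smul_right] at h4
        have h5 := abs_le.1 (hin x α q hq _ hpert)
        have h6 := abs_le.1 (hMl x α)
        linarith
      · have h4 := hh2.trans hE
        unfold hat at h4
        obtain ⟨α, hα⟩ := bel_ex hH y _ (show -E - 1 < H y (-PV (gapB P) K0 ε ρ y x q') by linarith)
        refine ⟨α, ?_⟩
        rw [PV_gapB', ← hs, sub_add_eq_add_sub, inner_neg_right, neg_neg, inner_sub_right, inner_smul_right] at hα
        have h5 := abs_le.1 (hin y α q' hq' (-((2 / ε ^ 2) • (x - y))) (by rwa [norm_neg]))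
        have h6 := abs_le.1 (hMl y α)
        linarith
  obtain ⟨r', hr', hr'r, K0, hK0, S1⟩ := S1
  obtain ⟨Cb, hCb, hL⟩ := hL
  obtain ⟨ω, hω, hC⟩ := hC
  set Q := Mb * K0 * P.Lam + Cb * (2 + 2 * K0 + L0) + 1 with hQ
  have hQ0 : 0 < Q := by positivity
  set i' := min 1 (ι / (4 * Q)) with hi'
  have hi0 : 0 < i' := by positivity
  have hi1 : i' ≤ 1 := min_le_left _ _
  have hiQ : i' * Q ≤ ι / 4 := by
    calc i' * Q ≤ ι / (4 * Q) * Q := by gcongr; exact min_le_right _ _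
      _ = _ := by field_simp
  obtain ⟨t, ht, hωt⟩ := modulus_small hω (c := 1) (show 0 < ι / 4 by positivity)
  refine ⟨P, gapB P, r', K0, i', hr', hK0, hi0, S1, min 1 t, by positivity, fun ε hε hε1 => ⟨1, one_pos, ?_⟩⟩
  intro ρ hρ _ x hx hxr y hy hyr q q' hq hq' hxy _
  have hxP : x ∈ ball x0 P.r := ball_subset_ball (by linarith) hxr
  have hyP : y ∈ ball x0 P.r := ball_subset_ball (by linarith) hyr
  have hε1' : ε ≤ 1 := (hε1.trans_le (min_le_left _ _)).le
  have hεt : ε ≤ t := (hε1.trans_le (min_le_right _ _)).le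
  set δ := P.d x - P.d y with hδ
  set s := K0 / ε / √(δ ^ 2 + ρ ^ 2) * δ with hs
  have hsb : |s| ≤ K0 / ε := by
    have hϑ : 0 < √(δ ^ 2 + ρ ^ 2) := by positivity
    have h1 : |δ| ≤ √(δ ^ 2 + ρ ^ 2) := Real.abs_le_sqrt (by nlinarith)
    rw [hs, abs_mul, abs_of_pos (by positivity)]
    calc K0 / ε / √(δ ^ 2 + ρ ^ 2) * |δ| ≤ K0 / ε / √(δ ^ 2 + ρ ^ 2) * √(δ ^ 2 + ρ ^ 2) := by gcongr
      _ = _ := by field_simp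
  set p := PV (gapB P) K0 ε ρ x y q with hp
  set p' := PV (gapB P) K0 ε ρ y x q' with hp'
  have hpe : p = (2 / ε ^ 2) • (x - y) + s • P.e x + q := PV_gapB ..
  have hpe' : p' = -((2 / ε ^ 2) • (x - y)) - s • P.e y + q' := PV_gapB' ..
  have hsum : p + p' = s • (P.e x - P.e y) + (q + q') := by
    rw [hpe, hpe', smul_sub s]; abel
  have hsumn : ‖p + p'‖ ≤ K0 * P.Lam * i' + 2 * L0 := by
    rw [hsum]
    refine (norm_add_le _ _).trans (add_le_add ?_ ((norm_add_le _ _).trans (by linarith)))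
    rw [norm_smul]
    calc |s| * ‖P.e x - P.e y‖ ≤ K0 / ε * (P.Lam * (i' * ε)) := by
          refine mul_le_mul hsb ((P.e_lip x hxP y hyP).trans (by gcongr)) (norm_nonneg _) (by positivity)
      _ = _ := by field_simp
  have hpn : ε * ‖p‖ ≤ 2 + 2 * K0 + L0 := by
    have h1 : ‖p‖ ≤ 2 / ε ^ 2 * (i' * ε) + K0 / ε * 2 + L0 := by
      rw [hpe]
      refine (norm_add_le _ _).trans (add_le_add ((norm_add_le _ _).trans (add_le_add ?_ ?_)) hq)
      · rw [norm_smul, Real.norm_of_nonneg (by positivity)]; gcongr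
      · rw [norm_smul]
        exact mul_le_mul hsb (P.e_le x hxP) (norm_nonneg _) (by positivity)
    calc ε * ‖p‖ ≤ ε * (2 / ε ^ 2 * (i' * ε) + K0 / ε * 2 + L0) := by gcongr
      _ = 2 * i' + 2 * K0 + ε * L0 := by field_simp
      _ ≤ 2 * 1 + 2 * K0 + 1 * L0 := by gcongr
      _ = _ := by ring
  have key : H y (-p') ≤ H x p + ι := by
    refine bel_ge hH y (-p') fun α => ?_
    have h1 := bel_le hMb hMl hH x p α
    have h2 : -⟪b y α, -p'⟫ = ⟪b y α, p + p'⟫ + ⟪b x α - b y α, p⟫ - ⟪b x α, p⟫ := by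
      rw [inner_neg_right, inner_add_right, inner_sub_left]; ring
    have h3 : ⟪b y α, p + p'⟫ ≤ Mb * (K0 * P.Lam * i' + 2 * L0) :=
      (real_inner_le_norm _ _).trans (mul_le_mul (hMb _ _) hsumn (norm_nonneg _) hMb0.le)
    have h4 : ⟪b x α - b y α, p⟫ ≤ Cb * i' * (2 + 2 * K0 + L0) := by
      calc _ ≤ ‖b x α - b y α‖ * ‖p‖ := real_inner_le_norm _ _
        _ ≤ Cb * (i' * ε) * ‖p‖ := by gcongr; exact (hL α x hx y hy).trans (by gcongr)
        _ = Cb * i' * (ε * ‖p‖) := by ring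
        _ ≤ _ := by gcongr
    have h5 : l x α - l y α ≤ ι / 4 := by
      refine (le_abs_self _).trans ((hC α x hx y hy).trans ?_)
      have h6 := hωt t ht le_rfl
      rw [mul_one] at h6
      refine (hω.2.1 ?_).trans h6
      calc _ ≤ i' * ε := hxy
        _ ≤ 1 * t := by gcongr
        _ = t := one_mul t
    have h6 : Mb * (2 * L0) = ι / 4 := by rw [hL0d]; field_simp; norm_num
    have h7 : Mb * (K0 * P.Lam * i') + Cb * i' * (2 + 2 * K0 + L0) ≤ i' * Q := by
      have e : i' * Q = Mb * (K0 * P.Lam * i') + Cb * i' * (2 + 2 * K0 + L0) + i' := by rw [hQ]; ring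
      linarith
    rw [h2]
    linarith
  unfold hat
  linarith

lemma comp_bellman (h : StatBellmanOK D.Ω D.n b l H) : D.Comp H := by
  obtain ⟨⟨hb, ⟨Mb, hMb⟩, -, ⟨Ml, hMl⟩⟩, hH, hC, hL, hB⟩ := h
  have hMb0 : 0 < |Mb| + 1 := by positivity
  have hMb' : ∀ x α, ‖b x α‖ ≤ |Mb| + 1 := fun x α => (hMb x α).trans (by linarith [le_abs_self Mb])
  intro u1 u2 M hu1 hu2 hb1 hb2 hw1 hw2
  refine comparison hu1 hu2 hb1 hb2 hw1 hw2 fun ι hι => ?_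
  exact ⟨ι / (8 * (|Mb| + 1)), by positivity, fun x0 hx0 => good_bellman hMb0 hMb' hMl hb hH hC hL hB hι hx0⟩

end Bellman

end Dat

namespace Dat
variable (D : Dat N)

section HamCont
variable {D} {H : Euc N → Euc N → ℝ}

lemma modulus_tendsto {ω : ℝ → ℝ} (hω : IsModulus ω) (x : Euc N) : Tendsto (fun y => ω ‖x - y‖) (𝓝 x) (𝓝 0) := by
  rw [Metric.tendsto_nhds]
  intro ε hε
  obtain ⟨t, ht, h⟩ := modulus_small hω (c := 1) (half_pos hε)
  filter_upwards [Metric.ball_mem_nhds x ht] with y hy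
  rw [mem_ball_comm, mem_ball_iff_norm] at hy
  have h1 := hω.2.1 hy.le
  have h2 := h t ht le_rfl
  rw [Real.dist_eq, sub_zero, abs_of_nonneg (hω.1 _)]
  linarith

lemma hcont_of (h : ∀ R > 0, ∃ ω K, IsModulus ω ∧ 0 ≤ K ∧ ∀ x ∈ D.C, ∀ y ∈ D.C, ∀ p q : Euc N, ‖p‖ ≤ R → ‖q‖ ≤ R →
    H y p - H x q ≤ ω ‖x - y‖ * K + K * ‖x - y‖ + K * ‖p - q‖) :
    ContinuousOn (fun z : Euc N × Euc N => H z.1 z.2) (D.C ×ˢ univ) := by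
  rintro ⟨x, p⟩ ⟨hx, -⟩
  obtain ⟨ω, K, hω, hK, h⟩ := h (‖p‖ + 1) (by positivity)
  have hx : x ∈ D.C := hx
  have t1 : Tendsto (fun z : Euc N × Euc N => ω ‖x - z.1‖ * K + K * ‖x - z.1‖ + K * ‖p - z.2‖) (𝓝 (x, p)) (𝓝 0) := by
    have a1 : Tendsto (fun z : Euc N × Euc N => ω ‖x - z.1‖ * K) (𝓝 (x, p)) (𝓝 (0 * K)) :=
      ((modulus_tendsto hω x).comp (continuous_fst.tendsto (x, p))).mul_const K
    have a2 : Tendsto (fun z : Euc N × Euc N => K * ‖x - z.1‖ + K * ‖p - z.2‖) (𝓝 (x, p)) (𝓝 0) := by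
      have : Continuous (fun z : Euc N × Euc N => K * ‖x - z.1‖ + K * ‖p - z.2‖) := by fun_prop
      simpa using this.tendsto (x, p)
    have := a1.add a2
    simp only [zero_mul, add_zero] at this
    simpa only [add_assoc] using this
  change Tendsto _ _ _
  rw [tendsto_iff_dist_tendsto_zero]
  refine squeeze_zero' (Eventually.of_forall fun _ => dist_nonneg) ?_ (t1.mono_left nhdsWithin_le_nhds)
  have hev : ∀ᶠ z : Euc N × Euc N in 𝓝 (x, p), ‖z.2‖ < ‖p‖ + 1 := by
    have : Continuous (fun z : Euc N × Euc N => ‖z.2‖) := by fun_prop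
    exact (this.tendsto (x, p)).eventually (gt_mem_nhds (by simp))
  filter_upwards [self_mem_nhdsWithin, nhdsWithin_le_nhds hev] with z hz hz2
  have h1 := h x hx z.1 hz.1 z.2 p hz2.le (by linarith)
  have h2 := h z.1 hz.1 x hx p z.2 (by linarith) hz2.le
  rw [norm_sub_rev z.2] at h1
  rw [norm_sub_rev z.1] at h2
  rw [Real.dist_eq, abs_le]
  constructor <;> linarith

lemma hcont_bellman {A : Type} [MetricSpace A] [CompactSpace A] [Nonempty A]
    {b : Euc N → A → Euc N} {l : Euc N → A → ℝ} (h : StatBellmanOK D.Ω D.n b l H) :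
    ContinuousOn (fun z : Euc N × Euc N => H z.1 z.2) (D.C ×ˢ univ) := by
  obtain ⟨⟨hb, ⟨Mb, hMb⟩, -, ⟨Ml, hMl⟩⟩, hH, ⟨ω, hω, hC⟩, ⟨Cb, hCb, hL⟩, hB⟩ := h
  have hMb0 : 0 ≤ Mb := (norm_nonneg _).trans (hMb 0 (Classical.arbitrary A))
  refine hcont_of fun R hR => ⟨ω, 1 + Mb + Cb * R, hω, by positivity, fun x hx y hy p q hp hq => ?_⟩
  rw [sub_le_iff_le_add]
  refine bel_ge hH y p fun α => ?_
  have h1 := bel_le hMb hMl hH x q α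
  have h2 := hC α x hx y hy
  have h3 := (le_abs_self _).trans h2
  have e1 : -⟪b y α, p⟫ = ⟪b x α - b y α, p⟫ + ⟪b x α, q - p⟫ - ⟪b x α, q⟫ := by
    rw [inner_sub_left, inner_sub_right]; ring
  have h4 : ⟪b x α - b y α, p⟫ ≤ Cb * ‖x - y‖ * R :=
    (real_inner_le_norm _ _).trans (mul_le_mul (hL α x hx y hy) hp (norm_nonneg _) (by positivity))
  have h5 : ⟪b x α, q - p⟫ ≤ Mb * ‖p - q‖ := by
    rw [norm_sub_rev p q]
    exact (real_inner_le_norm _ _).trans (by gcongr; exact hMb _ _)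
  have h6 := hω.1 ‖x - y‖
  have a1 : 0 ≤ ω ‖x - y‖ * (Mb + Cb * R) := by positivity
  have a2 : 0 ≤ (1 + Mb) * ‖x - y‖ := by positivity
  have a3 : 0 ≤ (1 + Cb * R) * ‖p - q‖ := by positivity
  rw [e1]
  linarith

lemma hcont_Ha {C : ℝ} {ω : ℝ → ℝ} (h : AssumptionHa H C ω) :
    ContinuousOn (fun z : Euc N × Euc N => H z.1 z.2) (D.C ×ˢ univ) := by
  obtain ⟨hC, hω, h⟩ := h
  refine hcont_of fun R hR => ⟨ω, 1 + R + C, hω, by positivity, fun x hx y hy p q hp hq => ?_⟩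
  have h1 := h x y p q
  have h6 := hω.1 ‖x - y‖
  have a1 : ω ‖x - y‖ * (1 + ‖p‖) ≤ ω ‖x - y‖ * (1 + R + C) := mul_le_mul_of_nonneg_left (by linarith) h6
  have a2 : C * ‖p - q‖ ≤ (1 + R + C) * ‖p - q‖ := by gcongr; linarith
  have a3 : 0 ≤ (1 + R + C) * ‖x - y‖ := by positivity
  linarith

lemma hcont_Hc {m C : ℝ} {ω : ℝ → ℝ} (hm : 1 ≤ m) (h : AssumptionHc H m C ω) :
    ContinuousOn (fun z : Euc N × Euc N => H z.1 z.2) (D.C ×ˢ univ) := by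
  obtain ⟨hC, hω, h⟩ := h
  refine hcont_of fun R hR => ⟨ω, 1 + R ^ m + C * R ^ (m - 1), hω, by positivity, fun x hx y hy p q hp hq => ?_⟩
  have h1 := h x y p q
  have h6 := hω.1 ‖x - y‖
  have hmax : max ‖p‖ ‖q‖ ≤ R := max_le hp hq
  have hmax0 : 0 ≤ max ‖p‖ ‖q‖ := (norm_nonneg p).trans (le_max_left _ _)
  have b1 : (max ‖p‖ ‖q‖) ^ m ≤ R ^ m := Real.rpow_le_rpow hmax0 hmax (by linarith)
  have b2 : (max ‖p‖ ‖q‖) ^ (m - 1) ≤ R ^ (m - 1) := Real.rpow_le_rpow hmax0 hmax (by linarith)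
  have c1 : 0 ≤ R ^ m := by positivity
  have c2 : 0 ≤ C * R ^ (m - 1) := by positivity
  have a1 : ω ‖x - y‖ * (1 + (max ‖p‖ ‖q‖) ^ m) ≤ ω ‖x - y‖ * (1 + R ^ m + C * R ^ (m - 1)) :=
    mul_le_mul_of_nonneg_left (by linarith) h6
  have a2 : C * ‖p - q‖ * (max ‖p‖ ‖q‖) ^ (m - 1) ≤ (1 + R ^ m + C * R ^ (m - 1)) * ‖p - q‖ := by
    calc _ ≤ C * ‖p - q‖ * R ^ (m - 1) := by gcongr
      _ = (C * R ^ (m - 1)) * ‖p - q‖ := by ring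
      _ ≤ _ := by gcongr; linarith
  have a3 : 0 ≤ (1 + R ^ m + C * R ^ (m - 1)) * ‖x - y‖ := by positivity
  linarith

lemma ham_ok {A : Type} [MetricSpace A] [CompactSpace A] [Nonempty A]
    {b : Euc N → A → Euc N} {l : Euc N → A → ℝ} (h : StatBellmanOK D.Ω D.n b l H ∨ StatCoerciveOK D.Ω H D.σ) :
    D.Comp H ∧ ContinuousOn (fun z : Euc N × Euc N => H z.1 z.2) (D.C ×ˢ univ) := by
  rcases h with h | ⟨m, c0, Dc, h1, ⟨hm, C, ω, h⟩ | ⟨A', Cb, hb, C, ω, h⟩⟩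
  · exact ⟨comp_bellman h, hcont_bellman h⟩
  · exact ⟨comp_Ha h1 h, hcont_Ha h⟩
  · exact ⟨comp_Hbc h1 hb h, hcont_Hc hb.1.le h⟩

end HamCont

end Dat

namespace Dat
variable (D : Dat N)

section PerronAux
variable {D} {H : Euc N → Euc N → ℝ}

lemma slope_right {F : Euc N → ℝ} {v x h : Euc N} (hF : HasGradientAt F v x) :
    Tendsto (fun t : ℝ => t⁻¹ * (F (x + t • h) - F x)) (𝓝[>] 0) (𝓝 ⟪v, h⟫) := by
  have h1 : HasDerivAt (fun t : ℝ => x + t • h) h 0 := by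
    simpa using ((hasDerivAt_id (0:ℝ)).smul_const h).const_add x
  have h2 : HasFDerivAt F (InnerProductSpace.toDual ℝ (Euc N) v) (x + (0:ℝ) • h) := by
    rw [zero_smul, add_zero]; exact hasGradientAt_iff_hasFDerivAt.1 hF
  have h3 := (h2.comp_hasDerivAt (0:ℝ) h1).tendsto_slope_zero_right
  simpa using h3

lemma inward {x : Euc N} (hx : x ∈ frontier D.Ω) : ∀ᶠ t : ℝ in 𝓝[>] 0, x + t • (-D.n x) ∈ D.C := by
  obtain ⟨P⟩ := D.loc_exists (D.frontier_sub hx)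
  have hxb : x ∈ ball x P.r := mem_ball_self P.r_pos
  obtain ⟨h1, h2⟩ := P.bdry x hxb hx
  have h3 := slope_right (h := -D.n x) (P.grad x hxb)
  have h4 : ⟪P.e x, -D.n x⟫ = 1 := by
    rw [h2, inner_neg_neg, real_inner_self_eq_norm_sq, (D.hn x hx).1]; norm_num
  rw [h4] at h3
  have h5 : Tendsto (fun t : ℝ => x + t • (-D.n x)) (𝓝[>] 0) (𝓝 x) := by
    have : Continuous (fun t : ℝ => x + t • (-D.n x)) := by fun_prop
    have := this.tendsto 0
    rw [zero_smul, add_zero] at this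
    exact this.mono_left nhdsWithin_le_nhds
  filter_upwards [h3.eventually (lt_mem_nhds one_pos), self_mem_nhdsWithin,
    h5.eventually (Metric.ball_mem_nhds x P.r_pos)] with t ht ht0 htb
  by_contra hcon
  have h6 := P.nonpos _ htb hcon
  have ht0 : 0 < t := ht0
  rw [h1, sub_zero] at ht
  have : t⁻¹ * P.d (x + t • (-D.n x)) ≤ 0 := mul_nonpos_of_nonneg_of_nonpos (by positivity) h6
  linarith

lemma grad_min {F : Euc N → ℝ} {v x : Euc N} (hF : HasGradientAt F v x) {s : ℝ} (hs : 0 < s)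
    (hm : ∀ y ∈ ball x s, y ∈ D.C → F x ≤ F y) :
    (x ∈ D.Ω → v = 0) ∧ (x ∈ frontier D.Ω → ⟪v, D.n x⟫ ≤ 0) := by
  constructor
  · intro hx
    have hloc : IsLocalMin F x := by
      filter_upwards [Metric.ball_mem_nhds x hs, D.isOpen_Ω.mem_nhds hx] with y hy hyΩ using hm y hy (D.Ω_sub hyΩ)
    have h1 := hloc.hasFDerivAt_eq_zero (hasGradientAt_iff_hasFDerivAt.1 hF)
    simpa using h1
  · intro hx
    have h3 := slope_right (h := -D.n x) hF
    have h5 : Tendsto (fun t : ℝ => x + t • (-D.n x)) (𝓝[>] 0) (𝓝 x) := by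
      have : Continuous (fun t : ℝ => x + t • (-D.n x)) := by fun_prop
      have := this.tendsto 0
      rw [zero_smul, add_zero] at this
      exact this.mono_left nhdsWithin_le_nhds
    have h6 : 0 ≤ ⟪v, -D.n x⟫ := by
      refine ge_of_tendsto h3 ?_
      filter_upwards [inward hx, self_mem_nhdsWithin, h5.eventually (Metric.ball_mem_nhds x hs)] with t ht ht0 htb
      have ht0 : 0 < t := ht0
      have := hm _ htb ht
      have : 0 ≤ F (x + t • (-D.n x)) - F x := by linarith
      positivity
    rw [inner_neg_right] at h6
    linarith

lemma grad_cont {φ : Euc N → ℝ} (hφ : ContDiff ℝ 1 φ) : Continuous (gradient φ) := by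
  unfold gradient
  exact (LinearIsometryEquiv.continuous _).comp (hφ.continuous_fderiv one_ne_zero)

lemma grad_at {φ : Euc N → ℝ} (hφ : ContDiff ℝ 1 φ) (x : Euc N) : HasGradientAt φ (gradient φ x) x :=
  ((hφ.differentiable one_ne_zero) x).hasGradientAt

lemma n_near {x0 : Euc N} (hx0 : x0 ∈ frontier D.Ω) {F : Euc N → Euc N} (hF : Continuous F)
    (h : 0 < ⟪F x0, D.n x0⟫) : ∀ᶠ x in 𝓝 x0, x ∈ frontier D.Ω → 0 < ⟪F x, D.n x⟫ := by
  obtain ⟨P⟩ := D.loc_exists (D.frontier_sub hx0)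
  have hb := Metric.ball_mem_nhds x0 P.r_pos
  have he : ContinuousAt P.e x0 := P.e_cont.continuousAt hb
  have h0 := (P.bdry x0 (mem_ball_self P.r_pos) hx0).2
  have h1 : ContinuousAt (fun x => ⟪F x, -P.e x⟫) x0 := hF.continuousAt.inner he.neg
  have h2 : 0 < ⟪F x0, -P.e x0⟫ := by rw [h0, neg_neg]; exact h
  filter_upwards [hb, h1.eventually (lt_mem_nhds h2)] with x hx hx2 hxf
  rw [(P.bdry x hx hxf).2, neg_neg] at hx2
  exact hx2

lemma sq_cd (x : Euc N) : ContDiff ℝ 1 (fun y : Euc N => ‖y - x‖ ^ 2) :=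
  (contDiff_id.sub contDiff_const).norm_sq ℝ

lemma sq_grad (x y : Euc N) : HasGradientAt (fun y : Euc N => ‖y - x‖ ^ 2) ((2:ℝ) • (y - x)) y := by
  rw [hasGradientAt_iff_hasFDerivAt]
  have := ((hasStrictFDerivAt_norm_sq (y - x)).hasFDerivAt).comp y ((hasFDerivAt_id y).sub_const x)
  refine HasFDerivAt.congr_fderiv this ?_
  ext v
  simp [two_smul]

lemma grad_add {f g : Euc N → ℝ} {a b x : Euc N} (hf : HasGradientAt f a x) (hg : HasGradientAt g b x) :
    HasGradientAt (fun y => f y + g y) (a + b) x := by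
  rw [hasGradientAt_iff_hasFDerivAt] at *
  rw [map_add]
  exact hf.add hg

lemma grad_sub {f g : Euc N → ℝ} {a b x : Euc N} (hf : HasGradientAt f a x) (hg : HasGradientAt g b x) :
    HasGradientAt (fun y => f y - g y) (a - b) x := by
  rw [hasGradientAt_iff_hasFDerivAt] at *
  rw [map_sub]
  exact hf.sub hg

lemma wsub_intro {u : Euc N → ℝ}
    (h : ∀ x ∈ D.C, ∀ r > 0, ∀ φ : Euc N → ℝ, ContDiff ℝ 1 φ →
      (∀ y ∈ ball x r, y ∈ D.C → u y - φ y + ‖y - x‖ ^ 2 ≤ u x - φ x) →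
      (x ∈ frontier D.Ω → 0 < ⟪gradient φ x, D.n x⟫) → D.EqSub H u x (gradient φ x)) : D.WSub H u := by
  intro x hx ρ hρ φ hφ hmax
  by_contra hcon
  push Not at hcon
  obtain ⟨hc1, hc2⟩ := hcon
  obtain ⟨φ', hφ', heq⟩ := cutoff hρ hφ
  have hxx : φ' x = φ x := heq x (mem_closedBall_self (by positivity))
  have hg : gradient φ' x = gradient φ x := by
    have : φ' =ᶠ[𝓝 x] φ := by
      filter_upwards [Metric.closedBall_mem_nhds x (show 0 < ρ / 4 by positivity)] with y hy using heq y hy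
    unfold gradient
    rw [this.fderiv_eq]
  have hgrad : gradient (fun y => φ' y + ‖y - x‖ ^ 2) x = gradient φ x := by
    have := (grad_add (grad_at hφ' x) (sq_grad x x)).gradient
    rw [this, hg]; simp
  have := h x hx (ρ/4) (by positivity) (fun y => φ' y + ‖y - x‖ ^ 2) (hφ'.add (sq_cd x)) (fun y hy hyC => ?_) (fun hxf => ?_)
  · rw [hgrad] at this
    exact hc2 this
  · have h1 := hmax y (ball_subset_ball (by linarith) hy) hyC
    rw [heq y (ball_subset_closedBall hy), hxx]
    simp only [sub_self, norm_zero]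
    linarith
  · rw [hgrad]; exact hc1 hxf

lemma J_const (x : Euc N) (c ξ : ℝ) : D.J ξ (fun _ => c) c x = 0 := by
  unfold J
  have : ∀ z, D.K (fun _ => c) c x z = 0 := by
    intro z
    by_cases h : x + D.j x z ∈ D.C
    · rw [K_of_mem h, sub_self, zero_mul]
    · rw [K_of_notMem h]
  simp [this]

lemma const_wsub {M0 : ℝ} (hM0 : ∀ x ∈ D.C, H x 0 ≤ M0) : D.WSub H (fun _ => -M0) := by
  refine wsub_intro fun x hx r hr φ hφ hmax hb => ?_
  obtain ⟨h1, h2⟩ := grad_min (D := D) (grad_at hφ x) hr (fun y hy hyC => by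
    have := hmax y hy hyC
    nlinarith [sq_nonneg ‖y - x‖])
  rcases D.mem_or hx with hxi | hxf
  · rw [h1 hxi]
    intro δ hδ
    refine ⟨1, one_pos, fun ξ _ _ => ?_⟩
    have := hM0 x hx
    rw [J_const]
    linarith
  · exact absurd (hb hxf) (not_lt.2 (h2 hxf))

lemma J_usc_nhds {u : Euc N → ℝ} {M ξ : ℝ} (hξ : 0 < ξ) (hu : D.Bd u M) (husc : D.Usc u) {x : Euc N} (hx : x ∈ D.C)
    (c : ℝ) {δ : ℝ} (hδ : 0 < δ) :
    ∃ η > 0, ∀ x' ∈ D.C, ‖x' - x‖ < η → ∀ c', |c' - c| < η → D.J ξ u c' x' ≤ D.J ξ u c x + δ := by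
  by_contra hcon
  push Not at hcon
  choose xs hxs hxl cs hcs hJ using fun k : ℕ => hcon (1 / ((k:ℝ) + 1)) (by positivity)
  have l0 := tendsto_one_div_add_atTop_nhds_zero_nat (𝕜 := ℝ)
  have l1 : Tendsto xs atTop (𝓝 x) := by
    rw [tendsto_iff_norm_sub_tendsto_zero]
    exact squeeze_zero (fun _ => norm_nonneg _) (fun k => (hxl k).le) l0
  have l2 : Tendsto cs atTop (𝓝 c) := by
    rw [tendsto_iff_norm_sub_tendsto_zero]
    exact squeeze_zero (fun _ => norm_nonneg _) (fun k => (hcs k).le) l0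
  obtain ⟨k, hk⟩ := (J_usc hξ hu husc hxs hx l1 l2 hδ).exists
  exact absurd (hJ k) (not_lt.2 hk)

variable (D) in
/-- upper semicontinuous envelope -/
def env (V : Euc N → ℝ) (x : Euc N) : ℝ := limsup V (𝓝[D.C] x)

section env
variable {V : Euc N → ℝ} {M : ℝ}

lemma env_bdd (hV : D.Bd V M) (x : Euc N) : IsBoundedUnder (· ≤ ·) (𝓝[D.C] x) V :=
  ⟨M, by rw [eventually_map]; filter_upwards [self_mem_nhdsWithin] with y hy using (abs_le.1 (hV y hy)).2⟩

lemma env_bdd' (hV : D.Bd V M) (x : Euc N) : IsBoundedUnder (· ≥ ·) (𝓝[D.C] x) V :=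
  ⟨-M, by rw [eventually_map]; filter_upwards [self_mem_nhdsWithin] with y hy using (abs_le.1 (hV y hy)).1⟩

lemma env_cobdd (hV : D.Bd V M) {x : Euc N} (hx : x ∈ D.C) : IsCoboundedUnder (· ≤ ·) (𝓝[D.C] x) V := by
  have : (𝓝[D.C] x).NeBot := mem_closure_iff_nhdsWithin_neBot.1 (subset_closure hx)
  exact (env_bdd' hV x).isCoboundedUnder_le

lemma env_lt (hV : D.Bd V M) {x : Euc N} {a : ℝ} (h : D.env V x < a) : ∀ᶠ y in 𝓝[D.C] x, V y < a :=
  eventually_lt_of_limsup_lt h (env_bdd hV x)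

lemma env_freq (hV : D.Bd V M) {x : Euc N} (hx : x ∈ D.C) {a : ℝ} (h : a < D.env V x) : ∃ᶠ y in 𝓝[D.C] x, a < V y :=
  frequently_lt_of_lt_limsup (env_cobdd hV hx) h

lemma le_env (hV : D.Bd V M) {x : Euc N} (hx : x ∈ D.C) : V x ≤ D.env V x := by
  by_contra hcon
  push Not at hcon
  exact lt_irrefl _ ((env_lt hV hcon).self_of_nhdsWithin hx)

lemma env_le (hV : D.Bd V M) {x : Euc N} (hx : x ∈ D.C) {a : ℝ} (h : ∀ᶠ y in 𝓝[D.C] x, V y ≤ a) : D.env V x ≤ a := by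
  by_contra hcon
  push Not at hcon
  obtain ⟨y, hy, hy2⟩ := ((env_freq hV hx hcon).and_eventually h).exists
  linarith

lemma env_bd (hV : D.Bd V M) : D.Bd (D.env V) M := fun x hx => by
  rw [abs_le]
  constructor
  · exact (abs_le.1 (hV x hx)).1.trans (le_env hV hx)
  · refine env_le hV hx ?_
    filter_upwards [self_mem_nhdsWithin] with y hy using (abs_le.1 (hV y hy)).2

lemma env_usc (hV : D.Bd V M) : D.Usc (D.env V) := fun x hx a ha => by
  obtain ⟨a', h1, h2⟩ := exists_between ha
  have h3 := env_lt hV h1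
  filter_upwards [eventually_eventually_nhdsWithin.2 h3, self_mem_nhdsWithin] with y hy hyC
  exact (env_le hV hyC (hy.mono fun _ h => h.le)).trans_lt h2

end env
end PerronAux

end Dat

namespace Dat
variable (D : Dat N)

section PerronSub
variable {D} {H : Euc N → Euc N → ℝ}

lemma frontier_ev {x : Euc N} (hx : x ∈ D.C) {F : Euc N → Euc N} (hF : Continuous F)
    (hb : x ∈ frontier D.Ω → 0 < ⟪F x, D.n x⟫) : ∀ᶠ y in 𝓝 x, y ∈ frontier D.Ω → 0 < ⟪F y, D.n y⟫ := by
  rcases D.mem_or hx with hxi | hxf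
  · filter_upwards [D.isOpen_Ω.mem_nhds hxi] with y hy hyf
    rw [frontier_eq] at hyf
    exact absurd hy hyf.2
  · exact n_near hxf hF (hb hxf)

lemma H_seq (hH : ContinuousOn (fun z : Euc N × Euc N => H z.1 z.2) (D.C ×ˢ univ)) {x : Euc N} (hx : x ∈ D.C)
    {F : Euc N → Euc N} (hF : Continuous F) :
    Tendsto (fun y => H y (F y)) (𝓝[D.C] x) (𝓝 (H x (F x))) := by
  have h1 : ContinuousWithinAt (fun z : Euc N × Euc N => H z.1 z.2) (D.C ×ˢ univ) (x, F x) := hH (x, F x) ⟨hx, trivial⟩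
  have h2 : Tendsto (fun y => (y, F y)) (𝓝[D.C] x) (𝓝[D.C ×ˢ univ] (x, F x)) := by
    refine tendsto_nhdsWithin_of_tendsto_nhds_of_eventually_within _ ?_ ?_
    · exact ((continuous_id.prodMk hF).tendsto x).mono_left nhdsWithin_le_nhds
    · filter_upwards [self_mem_nhdsWithin] with y hy using ⟨hy, trivial⟩
  exact h1.tendsto.comp h2

lemma argmax {w φ : Euc N → ℝ} (hw : D.Usc w) (hφ : Continuous φ) {x y : Euc N} {r : ℝ} (hy : y ∈ D.C)
    (hyr : y ∈ closedBall x r) :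
    ∃ x' ∈ D.C, x' ∈ closedBall x r ∧ ∀ z ∈ D.C, z ∈ closedBall x r → w z - φ z ≤ w x' - φ x' := by
  have hK : IsCompact (D.C ∩ closedBall x r) := (isCompact_closedBall x r).inter_left D.isClosed_C
  have husc : UpperSemicontinuousOn (fun z => w z + -φ z) (D.C ∩ closedBall x r) :=
    ((usc_on hw).mono inter_subset_left).add (hφ.neg.continuousOn.upperSemicontinuousOn)
  obtain ⟨x', hx', hm⟩ := husc.exists_isMaxOn (s := D.C ∩ closedBall x r) ⟨y, hy, hyr⟩ hK
  refine ⟨x', hx'.1, hx'.2, fun z hz hzr => ?_⟩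
  have := hm (show z ∈ D.C ∩ closedBall x r from ⟨hz, hzr⟩)
  simpa [sub_eq_add_neg] using this

theorem perron_sub {S : Set (Euc N → ℝ)} {M : ℝ} (hS : ∀ w ∈ S, D.Usc w ∧ D.Bd w M ∧ D.WSub H w) {V : Euc N → ℝ}
    (hV : D.Bd V M) (hle : ∀ w ∈ S, ∀ x ∈ D.C, w x ≤ V x) (happ : ∀ x ∈ D.C, ∀ δ > 0, ∃ w ∈ S, V x - δ < w x)
    (hH : ContinuousOn (fun z : Euc N × Euc N => H z.1 z.2) (D.C ×ˢ univ)) : D.WSub H (D.env V) := by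
  refine wsub_intro fun x hx r hr φ hφ hmax hb => ?_
  set U := D.env V with hU
  have hCj := D.Cj_pos
  have hCμ := D.Cμ_pos
  have hUb : D.Bd U M := env_bd hV
  have hUu : D.Usc U := env_usc hV
  obtain ⟨L, hL0, hL⟩ := C1_lip (x := x) (ρ := r) (r := r/2) (by linarith) (hφ.contDiffOn (s := ball x r))
  have hxc : x ∈ closedBall x (r/2) := mem_closedBall_self (by positivity)
  intro δ hδ
  obtain ⟨ξ1, hξ1, hkn⟩ := exists_kn (D := D) (c := L * D.Cj * D.Cμ) (show 0 < δ/4 by positivity)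
  refine ⟨min ξ1 (r / (4 * D.Cj)), by positivity, fun ξ hξ hξ0 => ?_⟩
  have hkn := hkn ξ hξ (hξ0.le.trans (min_le_left _ _))
  have hξr : D.Cj * ξ ≤ r/4 := by
    have := hξ0.le.trans (min_le_right _ _)
    rw [le_div_iff₀ (by positivity)] at this
    linarith
  -- approximating maxima
  have hex : ∀ t > 0, ∃ w ∈ S, ∃ x' ∈ D.C, x' ∈ closedBall x (r/2) ∧
      (∀ z ∈ D.C, z ∈ closedBall x (r/2) → w z - φ z ≤ w x' - φ x') ∧
      U x - φ x - (2 + L) * t ≤ w x' - φ x' := by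
    intro t ht
    have h1 := env_freq hV hx (show U x - t < D.env V x by linarith)
    have h2 : ∀ᶠ y in 𝓝[D.C] x, y ∈ ball x (min t (r/2)) :=
      nhdsWithin_le_nhds (Metric.ball_mem_nhds x (by positivity))
    obtain ⟨y, hy1, hy2, hyC⟩ := (h1.and_eventually (h2.and self_mem_nhdsWithin)).exists
    rw [mem_ball_iff_norm] at hy2
    obtain ⟨w, hw, hwy⟩ := happ y hyC t ht
    have hyr : y ∈ closedBall x (r/2) := by
      rw [mem_closedBall_iff_norm]; exact (hy2.trans_le (min_le_right _ _)).le
    obtain ⟨x', hx', hx'r, hm⟩ := argmax (hS w hw).1 hφ.continuous hyC hyr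
    refine ⟨w, hw, x', hx', hx'r, hm, ?_⟩
    have h3 := hm y hyC hyr
    have h4 := (abs_le.1 (hL y hyr x hxc)).2
    have h5 : L * ‖y - x‖ ≤ L * t := by gcongr; exact (hy2.trans_le (min_le_left _ _)).le
    linarith
  choose w hw xs hxs hxr hm hlow using fun k : ℕ => hex (1 / ((k:ℝ) + 1)) (by positivity)
  have hxlow : ∀ k, ‖xs k - x‖ ^ 2 ≤ (2 + L) * (1 / ((k:ℝ) + 1)) := by
    intro k
    have h1 := hmax (xs k) (by
      have := hxr k; rw [mem_closedBall_iff_norm] at this; rw [mem_ball_iff_norm]; linarith) (hxs k)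
    have h2 := hle _ (hw k) _ (hxs k)
    have h3 := le_env hV (hxs k)
    have := hlow k
    linarith
  have l0 : Tendsto (fun k : ℕ => (2 + L) * (1 / ((k:ℝ) + 1))) atTop (𝓝 0) := by
    simpa using (tendsto_one_div_add_atTop_nhds_zero_nat (𝕜 := ℝ)).const_mul (2 + L)
  have l1n : Tendsto (fun k => ‖xs k - x‖) atTop (𝓝 0) := by
    have : Tendsto (fun k : ℕ => √((2 + L) * (1 / ((k:ℝ) + 1)))) atTop (𝓝 0) := by
      have := (Real.continuous_sqrt.tendsto 0).comp l0
      rw [Real.sqrt_zero] at this; exact this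
    exact squeeze_zero (fun _ => norm_nonneg _) (fun k => Real.le_sqrt_of_sq_le (hxlow k)) this
  have l1 : Tendsto xs atTop (𝓝 x) := tendsto_iff_norm_sub_tendsto_zero.2 l1n
  have l1C : Tendsto xs atTop (𝓝[D.C] x) :=
    tendsto_nhdsWithin_of_tendsto_nhds_of_eventually_within _ l1 (Eventually.of_forall hxs)
  have l2 : Tendsto (fun k => w k (xs k)) atTop (𝓝 (U x)) := by
    rw [tendsto_iff_norm_sub_tendsto_zero]
    have l3 : Tendsto (fun k : ℕ => L * ‖xs k - x‖ + (2 + L) * (1 / ((k:ℝ) + 1))) atTop (𝓝 0) := by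
      simpa using (l1n.const_mul L).add l0
    refine squeeze_zero (fun _ => norm_nonneg _) (fun k => ?_) l3
    have h1 := hmax (xs k) (by
      have := hxr k; rw [mem_closedBall_iff_norm] at this; rw [mem_ball_iff_norm]; linarith) (hxs k)
    have h2 := hle _ (hw k) _ (hxs k)
    have h3 := le_env hV (hxs k)
    have h4 := hlow k
    have h5 := abs_le.1 (hL _ (hxr k) x hxc)
    have h6 : 0 ≤ (2 + L) * (1 / ((k:ℝ) + 1)) := by positivity
    have h7 := sq_nonneg ‖xs k - x‖
    rw [Real.norm_eq_abs, abs_le]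
    constructor <;> linarith
  have e1 := l1.eventually (Metric.ball_mem_nhds x (show 0 < r/4 by positivity))
  have e2 := l1.eventually (frontier_ev hx (grad_cont hφ) hb)
  have e3 := J_usc hξ hUb hUu hxs hx l1 l2 (show 0 < δ/4 by positivity)
  have e4 := ((H_seq hH hx (grad_cont hφ)).comp l1C).eventually (lt_mem_nhds (show H x (gradient φ x) - δ/4 < H x (gradient φ x) by linarith))
  have e5 := l2.eventually (lt_mem_nhds (show U x - δ/8 < U x by linarith))
  obtain ⟨k, e1, e2, e3, e4, e5⟩ := (e1.and (e2.and (e3.and (e4.and e5)))).exists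
  simp only [comp_apply] at e4
  obtain ⟨hwu, hwb, hws⟩ := hS _ (hw k)
  have e1n : ‖xs k - x‖ < r/4 := by rwa [dist_eq_norm] at e1
  have hclose : ∀ y, ‖y - xs k‖ ≤ r/4 → y ∈ closedBall x (r/2) := by
    intro y hy
    rw [mem_closedBall_iff_norm]
    calc ‖y - x‖ = ‖(y - xs k) + (xs k - x)‖ := by rw [sub_add_sub_cancel]
      _ ≤ _ := norm_add_le _ _
      _ ≤ _ := by linarith
  have hEq : D.EqSub H (w k) (xs k) (gradient φ (xs k)) := by
    rcases hws (xs k) (hxs k) (r/4) (by positivity) φ hφ.contDiffOn (fun y hy hyC =>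
      hm k y hyC (hclose y (by rw [mem_ball_iff_norm] at hy; exact hy.le))) with ⟨h1, h2⟩ | h
    · exact absurd (e2 h1) (not_lt.2 h2)
    · exact h
  obtain ⟨ξ2, hξ2, hE⟩ := hEq (δ/8) (by positivity)
  have hE := hE (min (ξ2/2) ξ) (by positivity) ((min_le_left _ _).trans_lt (by linarith))
  have hns := near_split (hxs k) (c := w k (xs k)) (B := L * D.Cj) (show 0 < min (ξ2/2) ξ by positivity)
    (min_le_right _ _) hwb hwu.mes (by positivity) (fun z hz hzC => by
      have hj := D.j_le (hxs k) z
      have hjz : ‖D.j (xs k) z‖ ≤ r/4 := hj.trans (le_trans (by gcongr) hξr)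
      have hcl := hclose (xs k + D.j (xs k) z) (by rwa [add_sub_cancel_left])
      have h1 := hm k _ hzC hcl
      have h2 := (abs_le.1 (hL _ hcl _ (hxr k))).2
      rw [add_sub_cancel_left] at h2
      have h3 : L * ‖D.j (xs k) z‖ ≤ L * D.Cj * ‖z‖ := by rw [mul_assoc]; gcongr
      linarith)
  have hmono := J_mono (hxs k) (c := w k (xs k)) (c' := w k (xs k)) hξ hwb hwu.mes hUb hUu.mes (fun y hy => by
    have h2 := hle _ (hw k) _ hy
    have h3 := le_env hV hy
    linarith)
  linarith

end PerronSub

end Dat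

namespace Dat
variable (D : Dat N)

section PerronSuper
variable {D} {H : Euc N → Euc N → ℝ}

lemma w_sub_of_eq {U w : Euc N → ℝ} {M M' : ℝ} (hUu : D.Usc U) (hUb : D.Bd U M) (hUs : D.WSub H U)
    (hwu : D.Usc w) (hwb : D.Bd w M') (hle : ∀ y ∈ D.C, U y ≤ w y) {x : Euc N} (hx : x ∈ D.C) (he : w x = U x)
    {ρ : ℝ} (hρ : 0 < ρ) {ψ : Euc N → ℝ} (hψ : ContDiffOn ℝ 1 ψ (ball x ρ))
    (hm : ∀ y ∈ ball x ρ, y ∈ D.C → w y - ψ y ≤ w x - ψ x) :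
    (x ∈ frontier D.Ω ∧ ⟪gradient ψ x, D.n x⟫ ≤ 0) ∨ D.EqSub H w x (gradient ψ x) := by
  rcases hUs x hx ρ hρ ψ hψ (fun y hy hyC => by
    have h1 := hm y hy hyC
    have h2 := hle y hyC
    linarith) with h | h
  · exact Or.inl h
  · refine Or.inr fun δ hδ => ?_
    obtain ⟨ξ0, hξ0, h0⟩ := h δ hδ
    refine ⟨ξ0, hξ0, fun ξ hξ hlt => ?_⟩
    have h1 := h0 ξ hξ hlt
    have h2 := J_mono hx (c := U x) (c' := w x) hξ hUb hUu.mes hwb hwu.mes (fun y hy => by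
      have := hle y hy
      linarith)
    linarith

theorem perron_super {U : Euc N → ℝ} {M : ℝ} (hUu : D.Usc U) (hUb : D.Bd U M) (hUs : D.WSub H U)
    (hbest : ∀ w, D.Usc w → D.Bd w (M + 1) → D.WSub H w → ∀ x ∈ D.C, w x ≤ U x)
    (hH : ContinuousOn (fun z : Euc N × Euc N => H z.1 z.2) (D.C ×ˢ univ)) :
    D.WSub (hat H) (D.env (fun y => - U y)) := by
  refine wsub_intro fun x hx r0 hr0 φ hφ hmax hb => ?_
  have hNb : D.Bd (fun y => - U y) M := hUb.neg
  set Z := D.env (fun y => - U y) with hZ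
  have hZb : D.Bd Z M := env_bd hNb
  have hZu : D.Usc Z := env_usc hNb
  have hZU : ∀ y ∈ D.C, - Z y ≤ U y := fun y hy => by
    have : - U y ≤ Z y := le_env hNb hy
    linarith
  have hCj := D.Cj_pos
  have hCμ := D.Cμ_pos
  by_contra hcon
  unfold EqSub at hcon
  push Not at hcon
  obtain ⟨δ, hδ, hcon⟩ := hcon
  obtain ⟨L, hL0, hL⟩ := C1_lip (x := x) (ρ := r0) (r := r0/2) (by linarith) (hφ.contDiffOn (s := ball x r0))
  obtain ⟨ξ2, hξ2, hkn⟩ := exists_kn (D := D) (c := L * D.Cj * D.Cμ) (show 0 < δ/4 by positivity)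
  obtain ⟨ξ1, hξ1, hξ1lt, hfail⟩ := hcon (min ξ2 (r0 / (4 * D.Cj))) (by positivity)
  have hkn := hkn ξ1 hξ1 (hξ1lt.le.trans (min_le_left _ _))
  have hξr : D.Cj * ξ1 ≤ r0/4 := by
    have := hξ1lt.le.trans (min_le_right _ _)
    rw [le_div_iff₀ (by positivity)] at this
    linarith
  obtain ⟨η, hη, hJ⟩ := J_usc_nhds hξ1 hZb hZu hx (Z x) (show 0 < δ/8 by positivity)
  unfold hat at hfail
  have e2 := frontier_ev hx (grad_cont hφ) hb
  have e4 := eventually_nhdsWithin_iff.1 ((H_seq hH hx (grad_cont hφ).neg).eventually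
    (gt_mem_nhds (show H x (- gradient φ x) < H x (- gradient φ x) + δ/8 by linarith)))
  have e5 := (hφ.continuous.tendsto x).eventually (Metric.ball_mem_nhds (φ x) (show 0 < min (η/2) (δ/16) by positivity))
  obtain ⟨s, hs, hse⟩ := Metric.eventually_nhds_iff.1 (e2.and (e4.and e5))
  set r := min (min s (r0/4)) η with hr
  have hrp : 0 < r := by positivity
  have hrs : r ≤ s := (min_le_left _ _).trans (min_le_left _ _)
  have hr4 : r ≤ r0/4 := (min_le_left _ _).trans (min_le_right _ _)
  have hrη : r ≤ η := min_le_right _ _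
  clear_value r
  set γ := min (min (r^2/4) (η/4)) (min (δ/16) (1/2)) with hγd
  have hγ : 0 < γ := by positivity
  have hγr : γ ≤ r^2/4 := (min_le_left _ _).trans (min_le_left _ _)
  have hγη : γ ≤ η/4 := (min_le_left _ _).trans (min_le_right _ _)
  have hγδ : γ ≤ δ/16 := (min_le_right _ _).trans (min_le_left _ _)
  have hγ1 : γ ≤ 1/2 := (min_le_right _ _).trans (min_le_right _ _)
  clear_value γ
  set p : Euc N → ℝ := fun y => - φ y + φ x - Z x with hp
  have hpc : Continuous p := (hφ.continuous.neg.add continuous_const).sub continuous_const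
  have hUp : ∀ y, ‖y - x‖ < r0 → y ∈ D.C → p y + ‖y - x‖ ^ 2 ≤ - Z y := fun y hy hyC => by
    have := hmax y (by rwa [mem_ball_iff_norm]) hyC
    simp only [hp]; linarith
  classical
  set w : Euc N → ℝ := fun y => if ‖y - x‖ < r then max (U y) (p y + γ) else U y with hw
  have hUw : ∀ y, U y ≤ w y := fun y => by
    simp only [hw]; split_ifs
    · exact le_max_left _ _
    · exact le_rfl
  have hout : ∀ y ∈ D.C, r/2 ≤ ‖y - x‖ → w y = U y := fun y hy hry => by
    simp only [hw]; split_ifs with h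
    · refine max_eq_left ?_
      have h1 := hUp y (by linarith) hy
      have h2 := hZU y hy
      have h3 : (r/2)^2 ≤ ‖y - x‖^2 := by gcongr
      nlinarith
    · rfl
  have hpw : ∀ y ∈ D.C, ‖y - x‖ < r0 → p y + γ ≤ w y := fun y hy hyr => by
    by_cases h : ‖y - x‖ < r
    · simp only [hw, if_pos h]; exact le_max_right _ _
    · push Not at h
      rw [hout y hy (by linarith)]
      have h1 := hUp y hyr hy
      have h2 := hZU y hy
      have h3 : r^2 ≤ ‖y - x‖^2 := by gcongr
      nlinarith
  have hwb : D.Bd w (M + 1) := fun y hy => by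
    have h1 := abs_le.1 (hUb y hy)
    rw [abs_le]
    refine ⟨by linarith [hUw y], ?_⟩
    simp only [hw]; split_ifs with h
    · refine max_le (by linarith) ?_
      have h2 := hUp y (by linarith) hy
      have h3 := hZU y hy
      nlinarith [sq_nonneg ‖y - x‖]
    · linarith
  have hwu : D.Usc w := by
    intro y hy a ha
    by_cases h : ‖y - x‖ < r
    · have ha' : max (U y) (p y + γ) < a := by simpa only [hw, if_pos h] using ha
      have f1 := hUu y hy a ((le_max_left _ _).trans_lt ha')
      have f2 : ∀ᶠ z in 𝓝 y, p z + γ < a :=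
        ((hpc.add continuous_const).tendsto y).eventually (gt_mem_nhds ((le_max_right _ _).trans_lt ha'))
      filter_upwards [f1, nhdsWithin_le_nhds f2] with z h1 h2
      simp only [hw]; split_ifs
      · exact max_lt h1 h2
      · exact h1
    · push Not at h
      have hU : U y < a := (hUw y).trans_lt ha
      have f2 : ∀ᶠ z in 𝓝 y, r/2 < ‖z - x‖ :=
        ((continuous_id.sub continuous_const).norm.tendsto y).eventually (lt_mem_nhds (show r/2 < ‖y - x‖ by linarith))
      filter_upwards [hUu y hy a hU, nhdsWithin_le_nhds f2, self_mem_nhdsWithin] with z h1 h2 h3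
      rw [hout z h3 h2.le]; exact h1
  have hws : D.WSub H w := by
    intro x' hx' ρ hρ ψ hψ hm
    by_cases he : w x' = U x'
    · exact w_sub_of_eq hUu hUb hUs hwu hwb (fun y _ => hUw y) hx' he hρ hψ hm
    have hx'r2 : ‖x' - x‖ < r/2 := by
      by_contra hc
      push Not at hc
      exact he (hout x' hx' hc)
    have hwx : w x' = p x' + γ := by
      have h1 : w x' = max (U x') (p x' + γ) := by simp only [hw]; rw [if_pos (by linarith)]
      rcases max_choice (U x') (p x' + γ) with h2 | h2
      · exact absurd (h1.trans h2) he
      · exact h1.trans h2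
    obtain ⟨g2, g4, g5⟩ := hse (y := x') (by rw [dist_eq_norm]; linarith)
    rw [dist_eq_norm, Real.norm_eq_abs, lt_min_iff] at g5
    have hψg : HasGradientAt ψ (gradient ψ x') x' :=
      (((hψ.differentiableOn one_ne_zero) x' (mem_ball_self hρ)).differentiableAt
        (Metric.ball_mem_nhds x' hρ)).hasGradientAt
    obtain ⟨m1, m2⟩ := grad_min (D := D) (grad_add hψg (grad_at hφ x')) (s := min ρ (r/2)) (by positivity)
      (fun y hy hyC => by
        rw [mem_ball_iff_norm] at hy
        have h1 := hm y (by rw [mem_ball_iff_norm]; exact hy.trans_le (min_le_left _ _)) hyC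
        have h2 : ‖y - x'‖ < r/2 := hy.trans_le (min_le_right _ _)
        have h3 : ‖y - x‖ < r0 := by
          calc ‖y - x‖ = ‖(y - x') + (x' - x)‖ := by rw [sub_add_sub_cancel]
            _ ≤ _ := norm_add_le _ _
            _ < _ := by linarith
        have h4 := hpw y hyC h3
        simp only [hp] at h4 hwx
        linarith)
    rcases D.mem_or hx' with hxi | hxf
    · right
      have hgr : gradient ψ x' = - gradient φ x' := eq_neg_of_add_eq_zero_left (m1 hxi)
      rw [hgr]
      intro δ' hδ'
      refine ⟨ξ1, hξ1, fun ξ hξ hlt => ?_⟩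
      have hns := near_split hx' (u := fun y => - w y) (c := - w x') (B := L * D.Cj) hξ hlt.le hwb.neg hwu.mes.neg
        (by positivity) (fun z hz hzC => by
          have hj := D.j_le hx' z
          have hjz : ‖D.j x' z‖ ≤ r0/4 := hj.trans (le_trans (by gcongr) hξr)
          have hcl : ‖x' + D.j x' z - x‖ ≤ r0/2 := by
            calc ‖x' + D.j x' z - x‖ = ‖(x' - x) + D.j x' z‖ := by congr 1; abel
              _ ≤ _ := norm_add_le _ _
              _ ≤ _ := by linarith
          have h1 := hpw _ hzC (by linarith)
          have h2 := (abs_le.1 (hL _ (mem_closedBall_iff_norm.2 hcl) x' (mem_closedBall_iff_norm.2 (by linarith)))).2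
          rw [add_sub_cancel_left] at h2
          have h3 : L * ‖D.j x' z‖ ≤ L * D.Cj * ‖z‖ := by rw [mul_assoc]; gcongr
          simp only [hp] at h1 hwx
          linarith)
      have hmono := J_mono hx' (u := fun y => - w y) (v := Z) (c := - w x') (c' := - w x') hξ1 hwb.neg hwu.mes.neg
        hZb hZu.mes (fun y hy => by
          have h2 := hZU y hy
          have h3 := hUw y
          linarith)
      have g5a := abs_lt.1 g5.1
      have g5b := abs_lt.1 g5.2
      have hJ' := hJ x' hx' (by linarith) (- w x') (by
        rw [hwx, abs_lt]; simp only [hp]; constructor <;> linarith)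
      have hneg := J_neg (D := D) x' w (w x') ξ
      have hH' : H x' (- gradient φ x') < H x (- gradient φ x) + δ/8 := g4 hx'
      have hwx' : w x' ≤ - Z x + δ/8 := by
        rw [hwx]; simp only [hp]; linarith
      linarith
    · left
      refine ⟨hxf, ?_⟩
      have h1 := m2 hxf
      have h2 := g2 hxf
      rw [inner_add_left] at h1
      linarith
  have f1 := env_freq hNb hx (show Z x - γ/2 < D.env (fun y => - U y) x by rw [← hZ]; linarith)
  have f2 : ∀ᶠ y in 𝓝[D.C] x, - Z x - γ/2 < p y :=
    nhdsWithin_le_nhds ((hpc.tendsto x).eventually (lt_mem_nhds (by simp only [hp]; linarith)))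
  have f3 : ∀ᶠ y in 𝓝[D.C] x, y ∈ ball x r := nhdsWithin_le_nhds (Metric.ball_mem_nhds x hrp)
  obtain ⟨y, y1, y2, y3, y4⟩ := (f1.and_eventually (f2.and (f3.and self_mem_nhdsWithin))).exists
  rw [mem_ball_iff_norm] at y3
  have h1 := hbest w hwu hwb hws y y4
  have h2 := hpw y y4 (by linarith)
  linarith

theorem exists_unique_sol (hC : D.Comp H)
    (hH : ContinuousOn (fun z : Euc N × Euc N => H z.1 z.2) (D.C ×ˢ univ)) {M : ℝ}
    (hM : ∀ x ∈ D.C, |H x 0| ≤ M) (hM0 : 0 ≤ M) :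
    ∃ U : Euc N → ℝ, D.Usc U ∧ D.Usc (fun x => - U x) ∧ D.Bd U M ∧ D.WSub H U ∧ D.WSub (hat H) (fun x => - U x) := by
  set S : Set (Euc N → ℝ) := {w | D.Usc w ∧ D.Bd w (M + 1) ∧ D.WSub H w} with hSd
  have husc : ∀ c : ℝ, D.Usc (fun _ => c) := fun c x _ a ha => Eventually.of_forall fun _ => ha
  have hcb : D.Bd (fun _ => -M) M := fun x _ => by simp [abs_of_nonneg hM0]
  have hcb' : D.Bd (fun _ => -M) (M+1) := fun x hx => (hcb x hx).trans (by linarith)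
  have hlow : D.WSub H (fun _ => -M) := const_wsub fun x hx => (abs_le.1 (hM x hx)).2
  have hhigh : D.WSub (hat H) (fun _ => -M) := const_wsub fun x hx => by
    have := (abs_le.1 (hM x hx)).1
    simp only [hat, neg_zero]; linarith
  have hS0 : (fun _ => -M) ∈ S := ⟨husc _, hcb', hlow⟩
  have hSM : ∀ w ∈ S, ∀ x ∈ D.C, w x ≤ M := fun w hw x hx => by
    have := hC w (fun _ => -M) (M+1) hw.1 (husc _) hw.2.1 hcb' hw.2.2 hhigh x hx
    linarith
  set V : Euc N → ℝ := fun x => sSup ((fun w : Euc N → ℝ => w x) '' S) with hVd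
  have hne : ∀ x, ((fun w : Euc N → ℝ => w x) '' S).Nonempty := fun x => ⟨_, mem_image_of_mem _ hS0⟩
  have hbdd : ∀ x ∈ D.C, BddAbove ((fun w : Euc N → ℝ => w x) '' S) := fun x hx =>
    ⟨M, by rintro _ ⟨w, hw, rfl⟩; exact hSM w hw x hx⟩
  have hle : ∀ w ∈ S, ∀ x ∈ D.C, w x ≤ V x := fun w hw x hx => le_csSup (hbdd x hx) ⟨w, hw, rfl⟩
  have hVM : D.Bd V M := fun x hx => by
    rw [abs_le]
    exact ⟨hle _ hS0 x hx, csSup_le (hne x) (by rintro _ ⟨w, hw, rfl⟩; exact hSM w hw x hx)⟩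
  have hVM' : D.Bd V (M+1) := fun x hx => (hVM x hx).trans (by linarith)
  have hUs : D.WSub H (D.env V) := perron_sub (S := S) (fun w hw => hw) hVM' hle (fun x hx δ hδ => by
    obtain ⟨_, ⟨w, hw, rfl⟩, h⟩ := exists_lt_of_lt_csSup (hne x) (show V x - δ < sSup ((fun w : Euc N → ℝ => w x) '' S) by
      simp only [hVd]; linarith)
    exact ⟨w, hw, h⟩) hH
  set U := D.env V with hU
  have hUu : D.Usc U := env_usc hVM
  have hUb : D.Bd U M := env_bd hVM
  have hsup : D.WSub (hat H) (D.env (fun y => - U y)) := perron_super hUu hUb hUs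
    (fun w h1 h2 h3 x hx => (hle w ⟨h1, h2, h3⟩ x hx).trans (le_env hVM hx)) hH
  have hNb : D.Bd (fun y => - U y) M := hUb.neg
  have hEu : D.Usc (D.env (fun y => - U y)) := env_usc hNb
  have heq : ∀ x ∈ D.C, D.env (fun y => - U y) x = - U x := fun x hx => by
    have h1 := hC U _ M hUu hEu hUb (env_bd hNb) hUs hsup x hx
    have h2 : - U x ≤ _ := le_env hNb hx
    linarith
  have hNu : D.Usc (fun x => - U x) := fun x hx a ha => by
    have := hEu x hx a (by rw [heq x hx]; exact ha)
    filter_upwards [this, self_mem_nhdsWithin] with y hy hyC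
    rwa [heq y hyC] at hy
  refine ⟨U, hUu, hNu, hUb, hUs, ?_⟩
  intro x hx ρ hρ ψ hψ hm
  exact w_sub_of_eq hEu (env_bd hNb) hsup hNu hNb (fun y hy => (heq y hy).le) hx (heq x hx).symm hρ hψ hm

lemma usc_of_cont {u : Euc N → ℝ} (hu : ContinuousOn u D.C) : D.Usc u := fun x hx _ ha =>
  (hu x hx).tendsto.eventually (gt_mem_nhds ha)

theorem final_sol (hC : D.Comp H)
    (hH : ContinuousOn (fun z : Euc N × Euc N => H z.1 z.2) (D.C ×ˢ univ)) (hE : AssumptionE D.Ω H) :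
    ∃ u : Euc N → ℝ, (BddOn u (closure D.Ω) ∧ ContinuousOn u (closure D.Ω) ∧
      IsSubSol D.Ω D.j D.g D.n D.Cj (statF H) u ∧ IsSuperSol D.Ω D.j D.g D.n D.Cj (statF H) u) ∧
      ∀ u' : Euc N → ℝ, BddOn u' (closure D.Ω) → ContinuousOn u' (closure D.Ω) →
        IsSubSol D.Ω D.j D.g D.n D.Cj (statF H) u' → IsSuperSol D.Ω D.j D.g D.n D.Cj (statF H) u' →
        EqOn u' u (closure D.Ω) := by
  obtain ⟨R, hR⟩ := hE 1 one_pos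
  have hM : ∀ x ∈ D.C, |H x 0| ≤ |R| := fun x hx => (hR x hx 0 (by simp)).trans (le_abs_self R)
  obtain ⟨U, h1, h2, h3, h4, h5⟩ := exists_unique_sol hC hH hM (abs_nonneg R)
  have hcont : ContinuousOn U (closure D.Ω) := fun x hx => by
    refine tendsto_order.2 ⟨fun a ha => ?_, fun a ha => h1 x hx a ha⟩
    filter_upwards [h2 x hx (-a) (by linarith)] with y hy
    linarith
  refine ⟨U, ⟨⟨_, h3⟩, hcont, (sub_iff h3 h1.mes).2 h4, super_iff.2 ((sub_iff h3.neg h2.mes).2 h5)⟩, ?_⟩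
  intro u' hb hc hs hS x hx
  obtain ⟨M', hM'⟩ := hb
  have hb' : D.Bd u' M' := hM'
  have hu := usc_of_cont (D := D) hc
  have hn := usc_of_cont (D := D) hc.neg
  have k1 := (sub_iff hb' hu.mes).1 hs
  have k2 := (sub_iff hb'.neg hn.mes).1 (super_iff.1 hS)
  have hbm : ∀ {v : Euc N → ℝ}, D.Bd v |R| → D.Bd v (max M' |R|) := fun h y hy => (h y hy).trans (le_max_right _ _)
  have hbm' : ∀ {v : Euc N → ℝ}, D.Bd v M' → D.Bd v (max M' |R|) := fun h y hy => (h y hy).trans (le_max_left _ _)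
  have c1 := hC u' _ _ hu h2 (hbm' hb') (hbm h3.neg) k1 h5 x hx
  have c2 := hC U _ _ h1 hn (hbm h3) (hbm' hb'.neg) h4 k2 x hx
  have c2' : U x + -u' x ≤ 0 := c2
  linarith

end PerronSuper

end Dat

end Aux

/-- **Existence and uniqueness for the stationary problem.**  Under (O), (M), (J0), (J1),
for `H` either of Bellman type with (C), (L), (B), or coercive with (H1), (Ha) or
(H1), (Hb), (Hc), and assuming (E), there exists a unique bounded (continuous) viscosity
solution of `u - I[u] + H(x,Du) = 0` in `Ω` with generalized Neumann boundary
condition `∂u/∂n = 0` on `∂Ω`. -/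
theorem existence_uniqueness_stationary
    (hN : 0 < N) (Ω : Set (Euc N)) (hΩ : IsW2Domain hN Ω)
    (n : Euc N → Euc N) (hn : IsExteriorNormal Ω n)
    (g : Euc N → Euc N → ℝ) (Cμ Dμ σ : ℝ) (hM : AssumptionM Ω g Cμ Dμ σ)
    (j : Euc N → Euc N → Euc N) (Aj : ℝ) (hJ0 : AssumptionJ0 Ω j Aj)
    (Cj' Cj Dj : ℝ) (hJ1 : AssumptionJ1 Ω j Cj' Cj Dj)
    {A : Type} [MetricSpace A] [CompactSpace A] [Nonempty A]
    (b : Euc N → A → Euc N) (l : Euc N → A → ℝ) (H : Euc N → Euc N → ℝ)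
    (hHam : StatBellmanOK Ω n b l H ∨ StatCoerciveOK Ω H σ)
    (hE : AssumptionE Ω H) :
    ∃ u : Euc N → ℝ,
      (BddOn u (closure Ω) ∧ ContinuousOn u (closure Ω) ∧
        IsSubSol Ω j g n Cj (statF H) u ∧ IsSuperSol Ω j g n Cj (statF H) u) ∧
      ∀ u' : Euc N → ℝ, BddOn u' (closure Ω) → ContinuousOn u' (closure Ω) →
        IsSubSol Ω j g n Cj (statF H) u' → IsSuperSol Ω j g n Cj (statF H) u' →
        EqOn u' u (closure Ω) := by
  let E : Dat N := ⟨hN, Ω, hΩ, n, hn, g, Cμ, Dμ, σ, hM, j, Aj, hJ0, Cj', Cj, Dj, hJ1⟩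
  obtain ⟨h1, h2⟩ := Dat.ham_ok (D := E) (b := b) (l := l) hHam
  exact Dat.final_sol (D := E) h1 h2 hE

end Censored

end
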